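/- Let N ≥ 1 and let f : ℝ → ℝ be a smooth, nondecreasing, convex function with f(0) > 0. Let λ > 0 be such that there exists a positive stable solution u₀ of the one-dimensional problem −u'' = λ f(u) on (−1,1) with u > 0 on (−1,1) and u(±1) = 0. Then for every k ∈ ℕ, every compact set K ⊆ ℝ^{N+1} and every η > 0, there exist a bounded open set Ω ⊆ ℝ^{N+1} with smooth boundary and a function u ∈ C²(closure Ω) such that: (i) Ω is star-shaped with respect to the origin (for every p ∈ Ω and t ∈ (0,1], t·p ∈ Ω) and Ω is invariant under each reflection (x₁,…,x_N,y) ↦ (x₁,…,−x_j,…,x_N,y) for j = 1,…,N and under (x,y) ↦ (x,−y); (ii) the Lebesgue measure of K ∩ (S Δ Ω) is less than η, where S = ℝ^N × (−1,1) is the strip and Δ denotes symmetric difference; (iii) u satisfies −Δu = λ f(u) in Ω, u > 0 in Ω, u = 0 on ∂Ω, and u is stable; (iv) u has at least k local maximum points in Ω. -/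

import Mathlib

open MeasureTheory Set Filter Topology

noncomputable section

/-- Points of `ℝ^{N+1}` written `(x, y)` with `x ∈ ℝ^N`, `y ∈ ℝ`. -/
abbrev Pt (N : ℕ) := (Fin N → ℝ) × ℝ

/-- Second directional derivative of `u` at `p` along `v`. -/
def D2 {N : ℕ} (u : Pt N → ℝ) (v : Pt N) (p : Pt N) : ℝ :=
  fderiv ℝ (fun q => fderiv ℝ u q v) p v

/-- The Laplacian of `u` at `p` (sum of pure second derivatives in coordinate directions). -/
def lap {N : ℕ} (u : Pt N → ℝ) (p : Pt N) : ℝ :=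
  (∑ j : Fin N, D2 u (Pi.single j 1, 0) p) + D2 u (0, 1) p

/-- The squared Euclidean norm of the gradient of `u` at `p`. -/
def gradSq {N : ℕ} (u : Pt N → ℝ) (p : Pt N) : ℝ :=
  (∑ j : Fin N, (fderiv ℝ u p (Pi.single j 1, 0)) ^ 2) + (fderiv ℝ u p (0, 1)) ^ 2

/-- `Ω` has smooth boundary: near each boundary point, `Ω` is the sublevel set of a smooth
function with nonvanishing gradient. -/
def SmoothBoundary {N : ℕ} (Ω : Set (Pt N)) : Prop :=
  ∀ p ∈ frontier Ω, ∃ F : Pt N → ℝ,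
    ContDiffAt ℝ (⊤ : ℕ∞) F p ∧ fderiv ℝ F p ≠ 0 ∧ ∀ᶠ q in nhds p, (q ∈ Ω ↔ F q < 0)

/-- Stability of a solution with linearized potential `gp` (`gp = g'(u)`): the quadratic form
`ξ ↦ ∫ |∇ξ|² − ∫ gp ξ²` is positive on nonzero smooth compactly supported test functions. -/
def Stable {N : ℕ} (Ω : Set (Pt N)) (gp : Pt N → ℝ) : Prop :=
  ∀ ξ : Pt N → ℝ, ContDiff ℝ (⊤ : ℕ∞) ξ → HasCompactSupport ξ → tsupport ξ ⊆ Ω → ξ ≠ 0 →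
    0 < (∫ p in Ω, gradSq ξ p) - ∫ p in Ω, gp p * (ξ p) ^ 2

/-- The superposition operator `V ↦ F ∘ V` on continuous functions on `[0,1]`. -/
def nemytskii (F : ℝ → ℝ) (hF : Continuous F) (V : C(unitInterval, ℝ)) : C(unitInterval, ℝ) :=
  ContinuousMap.comp ⟨F, hF⟩ V

theorem nemytskii_apply (F : ℝ → ℝ) (hF : Continuous F) (V : C(unitInterval, ℝ))
    (s : unitInterval) : nemytskii F hF V s = F (V s) := rfl

theorem hasFDerivAt_nemytskii {F : ℝ → ℝ} (hF : ContDiff ℝ 2 F) (V : C(unitInterval, ℝ)) :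
    HasFDerivAt (nemytskii F hF.continuous)
      (ContinuousLinearMap.mul ℝ C(unitInterval, ℝ)
        (nemytskii (deriv F) (hF.continuous_deriv (by norm_num)) V)) V := by
  have h1 : ContDiff ℝ 1 (deriv F) := ((contDiff_succ_iff_deriv (n := 1)).1 hF).2.2
  obtain ⟨C, hC⟩ := (isCompact_Icc (a := -(‖V‖ + 1)) (b := ‖V‖ + 1)).exists_bound_of_continuousOn
    (h1.continuous_deriv (by norm_num)).continuousOn
  have hlip : ∀ a ∈ Icc (-(‖V‖ + 1)) (‖V‖ + 1), ∀ b ∈ Icc (-(‖V‖ + 1)) (‖V‖ + 1),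
      ‖deriv F b - deriv F a‖ ≤ C * ‖b - a‖ := fun a ha b hb =>
    (convex_Icc _ _).norm_image_sub_le_of_norm_deriv_le
      (fun x _ => (h1.differentiable (by norm_num)) x) hC ha hb
  have hC0 : 0 ≤ C := (norm_nonneg _).trans (hC 0 ⟨by linarith [norm_nonneg V], by positivity⟩)
  refine .of_isLittleO (Asymptotics.isLittleO_iff.2 fun ε hε => ?_)
  have hball : Metric.ball V (min 1 (ε / (C + 1))) ∈ 𝓝 V := Metric.ball_mem_nhds _ (by positivity)
  filter_upwards [hball] with W hW
  rw [Metric.mem_ball, dist_eq_norm] at hW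
  have hW1 : ‖W - V‖ < 1 := hW.trans_le (min_le_left _ _)
  have hW2 : ‖W - V‖ < ε / (C + 1) := hW.trans_le (min_le_right _ _)
  rw [ContinuousMap.norm_le _ (by positivity)]
  intro s
  have hs : |W s - V s| ≤ ‖W - V‖ := by simpa using (W - V).norm_coe_le_norm s
  have hVs : |V s| ≤ ‖V‖ := V.norm_coe_le_norm s
  rw [abs_le] at hs hVs
  have hVmem : V s ∈ Icc (-(‖V‖ + 1)) (‖V‖ + 1) := ⟨by linarith, by linarith⟩
  have hWmem : W s ∈ Icc (-(‖V‖ + 1)) (‖V‖ + 1) := ⟨by linarith, by linarith⟩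
  have hseg : uIcc (V s) (W s) ⊆ Icc (-(‖V‖ + 1)) (‖V‖ + 1) :=
    (uIcc_subset_Icc hVmem hWmem)
  have key := (convex_uIcc (V s) (W s)).norm_image_sub_le_of_norm_hasDerivWithin_le
    (f := fun t => F t - deriv F (V s) * t) (f' := fun t => deriv F t - deriv F (V s))
    (C := C * ‖W - V‖)
    (fun t _ => ((((hF.differentiable (by norm_num)) t).hasDerivAt.sub
      (by simpa using (hasDerivAt_id t).const_mul (deriv F (V s)))).hasDerivWithinAt))
    (fun t ht => (hlip _ hVmem _ (hseg ht)).trans (by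
      gcongr
      rw [Real.norm_eq_abs]
      have := abs_sub_left_of_mem_uIcc ht
      exact this.trans (abs_le.2 hs)))
    left_mem_uIcc right_mem_uIcc
  have hCε : C * ‖W - V‖ ≤ ε := by
    rw [lt_div_iff₀ (by positivity)] at hW2
    nlinarith [norm_nonneg (W - V)]
  have e1 : (nemytskii F hF.continuous W - nemytskii F hF.continuous V -
      (ContinuousLinearMap.mul ℝ C(unitInterval, ℝ)
        (nemytskii (deriv F) (hF.continuous_deriv (by norm_num)) V)) (W - V)) s =
      (F (W s) - deriv F (V s) * W s) - (F (V s) - deriv F (V s) * V s) := by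
    simp [nemytskii_apply]; ring
  rw [e1]
  refine key.trans ?_
  have : ‖W s - V s‖ ≤ ‖W - V‖ := by rw [Real.norm_eq_abs]; exact abs_le.2 hs
  exact mul_le_mul hCε this (norm_nonneg _) hε.le

theorem contDiff_nemytskii (n : ℕ) : ∀ {F : ℝ → ℝ} (hF : ContDiff ℝ (⊤ : ℕ∞) F),
    ContDiff ℝ n (nemytskii F hF.continuous) := by
  induction n with
  | zero =>
    intro F hF
    exact contDiff_zero.2 (ContinuousMap.continuous_postcomp _)
  | succ n ih =>
    intro F hF
    have hF₁ : ContDiff ℝ (⊤ : ℕ∞) (deriv F) := (contDiff_infty_iff_deriv.1 hF).2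
    have hd := fun V => hasFDerivAt_nemytskii (contDiff_infty.1 hF 2) V
    push_cast
    rw [contDiff_succ_iff_fderiv]
    refine ⟨fun V => (hd V).differentiableAt, by simp, ?_⟩
    rw [funext fun V => (hd V).fderiv]
    exact (ContinuousLinearMap.contDiff _).comp (ih hF₁)

/-- The exponential weight `s ↦ exp (β s)` on `[0,1]`. -/
def expWeight (β : ℝ) : C(unitInterval, ℝ) := ⟨fun s => Real.exp (β * s), by fun_prop⟩

theorem expWeight_apply (β : ℝ) (s : unitInterval) : expWeight β s = Real.exp (β * s) := rfl

theorem expWeight_neg_mul (β : ℝ) : expWeight (-β) * expWeight β = 1 := by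
  ext s
  simp [expWeight_apply, ← Real.exp_add]

theorem continuous_volterra (β : ℝ) (g : C(unitInterval, ℝ)) : Continuous fun s : unitInterval =>
    (s : ℝ) ^ 2 * ∫ t : unitInterval,
      (1 - (t : ℝ)) * Real.exp (-(β * s * (1 - t))) * g (s * t) := by
  refine (by fun_prop : Continuous fun s : unitInterval => (s : ℝ) ^ 2).mul ?_
  have := continuous_parametric_integral_of_continuous (μ := (volume : Measure unitInterval))
    (f := fun (s t : unitInterval) => (1 - (t : ℝ)) * Real.exp (-(β * s * (1 - t))) * g (s * t))
    (by unfold Function.uncurry; fun_prop) isCompact_univ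
  simpa using this

theorem volterra_bound {β : ℝ} (hβ : 0 < β) (g : C(unitInterval, ℝ)) (s : unitInterval) :
    ‖(s : ℝ) ^ 2 * ∫ t : unitInterval, (1 - (t : ℝ)) * Real.exp (-(β * s * (1 - t))) * g (s * t)‖
      ≤ 1 / β * ‖g‖ := by
  have hs0 := s.2.1
  have hs1 := s.2.2
  rw [← integral_const_mul]
  refine (norm_integral_le_of_norm_le_const (C := 1 / β * ‖g‖) (ae_of_all _ fun t => ?_)).trans
    (by simp)
  have ht1 : 0 ≤ 1 - (t : ℝ) := by linarith [t.2.2]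
  have hx : (β * s * (1 - t)) * Real.exp (-(β * s * (1 - t))) ≤ 1 := by
    rw [Real.exp_neg, ← div_eq_mul_inv, div_le_one (Real.exp_pos _)]
    linarith [Real.add_one_le_exp (β * s * (1 - t))]
  have hg : ‖g (s * t)‖ ≤ ‖g‖ := g.norm_coe_le_norm _
  have hx2 : (s : ℝ) ^ 2 * ((1 - (t : ℝ)) * Real.exp (-(β * s * (1 - t)))) ≤ 1 / β := by
    rw [le_div_iff₀ hβ]
    calc (s : ℝ) ^ 2 * ((1 - (t : ℝ)) * Real.exp (-(β * s * (1 - t)))) * β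
        = s * ((β * s * (1 - t)) * Real.exp (-(β * s * (1 - t)))) := by ring
      _ ≤ 1 * 1 := by gcongr
      _ = 1 := one_mul _
  calc ‖(s : ℝ) ^ 2 * ((1 - (t : ℝ)) * Real.exp (-(β * s * (1 - t))) * g (s * t))‖
      = (s : ℝ) ^ 2 * ((1 - (t : ℝ)) * Real.exp (-(β * s * (1 - t)))) * ‖g (s * t)‖ := by
        rw [← mul_assoc, norm_mul, Real.norm_of_nonneg (by positivity)]
    _ ≤ 1 / β * ‖g‖ := by gcongr

/-- The weighted Volterra operator `g ↦ (s ↦ s² ∫₀¹ (1-t) exp (-β s (1-t)) g (s t) dt)`. -/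
def volterra {β : ℝ} (hβ : 0 < β) : C(unitInterval, ℝ) →L[ℝ] C(unitInterval, ℝ) :=
  LinearMap.mkContinuous
    { toFun := fun g => ⟨_, continuous_volterra β g⟩
      map_add' := fun g h => by
        ext s
        have hi : ∀ g : C(unitInterval, ℝ), Integrable fun t : unitInterval =>
            (1 - (t : ℝ)) * Real.exp (-(β * s * (1 - t))) * g (s * t) := fun g =>
          Continuous.integrable_of_hasCompactSupport (by fun_prop)
            (HasCompactSupport.of_compactSpace _)
        simp only [ContinuousMap.coe_mk, ContinuousMap.add_apply, mul_add]
        rw [integral_add (hi g) (hi h), mul_add]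
      map_smul' := fun c g => by
        ext s
        simp only [ContinuousMap.coe_mk, ContinuousMap.smul_apply, smul_eq_mul, RingHom.id_apply]
        have : ∀ t : unitInterval, (1 - (t : ℝ)) * Real.exp (-(β * s * (1 - t))) * (c * g (s * t))
            = c * ((1 - (t : ℝ)) * Real.exp (-(β * s * (1 - t))) * g (s * t)) := fun t => by ring
        simp only [this, integral_const_mul]
        ring }
    (1 / β) fun g => (ContinuousMap.norm_le _ (by positivity)).2 fun s => volterra_bound hβ g s

theorem volterra_apply {β : ℝ} (hβ : 0 < β) (g : C(unitInterval, ℝ)) (s : unitInterval) :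
    volterra hβ g s = (s : ℝ) ^ 2 *
      ∫ t : unitInterval, (1 - (t : ℝ)) * Real.exp (-(β * s * (1 - t))) * g (s * t) := rfl

theorem norm_volterra_le {β : ℝ} (hβ : 0 < β) : ‖volterra hβ‖ ≤ 1 / β :=
  LinearMap.mkContinuous_norm_le _ (by positivity) _

/-- `V s = v(m, s y)` for the solution `v(m,·)` of `v'' = -F(v)`, `v(0) = m`, `v'(0) = 0`, in
integral form. -/
def IsRescaledSolution (F : ℝ → ℝ) (m y : ℝ) (V : C(unitInterval, ℝ)) : Prop :=
  ∀ s : unitInterval, V s = m - y ^ 2 * ((s : ℝ) ^ 2 *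
    ∫ t : unitInterval, (1 - (t : ℝ)) * F (V (s * t)))

/-- The weighted fixed point map for `IsRescaledSolution`. -/
def weightedMap (F : ℝ → ℝ) (hF : Continuous F) {β : ℝ} (hβ : 0 < β) (p : ℝ × ℝ)
    (Z : C(unitInterval, ℝ)) : C(unitInterval, ℝ) :=
  p.1 • expWeight (-β) - p.2 ^ 2 •
    volterra hβ (expWeight (-β) * nemytskii F hF (expWeight β * Z))

theorem isRescaledSolution_iff (F : ℝ → ℝ) (hF : Continuous F) {β : ℝ} (hβ : 0 < β) (m y : ℝ)
    (Z : C(unitInterval, ℝ)) :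
    IsRescaledSolution F m y (expWeight β * Z) ↔ weightedMap F hF hβ (m, y) Z = Z := by
  rw [ContinuousMap.ext_iff]
  refine forall_congr' fun s => ?_
  have h1 : weightedMap F hF hβ (m, y) Z s = Real.exp (-(β * s)) * (m - y ^ 2 * ((s : ℝ) ^ 2 *
      ∫ t : unitInterval, (1 - (t : ℝ)) * F ((expWeight β * Z) (s * t)))) := by
    have : ∀ t : unitInterval, (1 - (t : ℝ)) * Real.exp (-(β * s * (1 - t))) *
        (expWeight (-β) * nemytskii F hF (expWeight β * Z)) (s * t) =
        Real.exp (-(β * s)) * ((1 - (t : ℝ)) * F ((expWeight β * Z) (s * t))) := by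
      intro t
      have : Real.exp (-(β * s)) = Real.exp (-(β * s * (1 - t))) * Real.exp (-β * (s * t)) := by
        rw [← Real.exp_add]; ring_nf
      rw [this, ContinuousMap.mul_apply, expWeight_apply, nemytskii_apply]
      push_cast
      ring
    simp only [weightedMap, ContinuousMap.sub_apply, ContinuousMap.smul_apply, smul_eq_mul,
      volterra_apply, this, integral_const_mul, expWeight_apply]
    rw [neg_mul]
    ring
  rw [h1, ContinuousMap.mul_apply, expWeight_apply, Real.exp_neg, inv_mul_eq_iff_eq_mul₀
    (Real.exp_pos _).ne', eq_comm]

theorem contractingWith_weightedMap {F : ℝ → ℝ} {K : NNReal} (hF : LipschitzWith K F) {β : ℝ}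
    (hβ : 0 < β) (p : ℝ × ℝ) (hp : p.2 ^ 2 * K / β ≤ 1 / 2) :
    ContractingWith (1 / 2) (weightedMap F hF.continuous hβ p) := by
  refine ⟨by norm_num, LipschitzWith.of_dist_le_mul fun Z W => ?_⟩
  have h0 : ‖expWeight (-β) * nemytskii F hF.continuous (expWeight β * Z) -
      expWeight (-β) * nemytskii F hF.continuous (expWeight β * W)‖ ≤ K * ‖Z - W‖ := by
    rw [ContinuousMap.norm_le _ (by positivity)]
    intro s
    have h1 := hF.dist_le_mul (expWeight β s * Z s) (expWeight β s * W s)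
    rw [Real.dist_eq, Real.dist_eq, ← mul_sub, abs_mul] at h1
    have h2 : |Z s - W s| ≤ ‖Z - W‖ := by simpa using (Z - W).norm_coe_le_norm s
    simp only [ContinuousMap.sub_apply, ContinuousMap.mul_apply, nemytskii_apply]
    rw [← mul_sub, norm_mul, Real.norm_eq_abs, Real.norm_eq_abs]
    have h3 : |expWeight (-β) s| * |expWeight β s| = 1 := by
      rw [← abs_mul, ← ContinuousMap.mul_apply, expWeight_neg_mul]; simp
    calc _ ≤ |expWeight (-β) s| * (K * (|expWeight β s| * |Z s - W s|)) := by gcongr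
      _ = K * (|expWeight (-β) s| * |expWeight β s|) * |Z s - W s| := by ring
      _ ≤ K * ‖Z - W‖ := by rw [h3, mul_one]; gcongr
  rw [dist_eq_norm, dist_eq_norm, weightedMap, weightedMap, sub_sub_sub_cancel_left, ← smul_sub,
    ← map_sub, norm_smul]
  calc ‖p.2 ^ 2‖ * _ ≤ ‖p.2 ^ 2‖ * (1 / β * (K * ‖Z - W‖)) := by
        gcongr
        refine ((volterra hβ).le_opNorm _).trans ?_
        refine mul_le_mul (norm_volterra_le hβ) ?_ (norm_nonneg _) (by positivity)
        rw [norm_sub_rev]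
        exact h0
    _ = (p.2 ^ 2 * K / β) * ‖Z - W‖ := by
        rw [Real.norm_of_nonneg (by positivity)]; ring
    _ ≤ _ := by
        push_cast
        gcongr

theorem contDiff_weightedMap (n : ℕ) {F : ℝ → ℝ} (hF : ContDiff ℝ (⊤ : ℕ∞) F) {β : ℝ} (hβ : 0 < β) :
    ContDiff ℝ n fun q : (ℝ × ℝ) × C(unitInterval, ℝ) =>
      weightedMap F hF.continuous hβ q.1 q.2 := by
  have h := contDiff_nemytskii n hF
  have h2 : ContDiff ℝ n fun q : (ℝ × ℝ) × C(unitInterval, ℝ) =>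
      nemytskii F hF.continuous (expWeight β * q.2) := h.comp (by fun_prop)
  unfold weightedMap
  exact (by fun_prop : ContDiff ℝ n fun q : (ℝ × ℝ) × C(unitInterval, ℝ) =>
    q.1.1 • expWeight (-β)).sub ((by fun_prop : ContDiff ℝ n fun q : (ℝ × ℝ) × C(unitInterval, ℝ) =>
    q.1.2 ^ 2).smul ((volterra hβ).contDiff.comp (contDiff_const.mul h2)))

theorem exists_weight (a : ℝ) (K : NNReal) : ∃ β > 0, ∀ y : ℝ, |y| ≤ a →
    y ^ 2 * K / β ≤ 1 / 2 := by
  refine ⟨2 * (a ^ 2 * K) + 1, by positivity, fun y hy => ?_⟩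
  rw [div_le_iff₀ (by positivity)]
  have : y ^ 2 ≤ a ^ 2 := sq_le_sq' (abs_le.1 hy).1 (abs_le.1 hy).2
  have := mul_le_mul_of_nonneg_right this K.2
  linarith!

theorem expWeight_mul_neg_mul (β : ℝ) (V : C(unitInterval, ℝ)) :
    expWeight β * (expWeight (-β) * V) = V := by
  rw [← mul_assoc, mul_comm (expWeight β), expWeight_neg_mul, one_mul]

theorem existsUnique_isRescaledSolution {F : ℝ → ℝ} {K : NNReal} (hF : LipschitzWith K F)
    (m y : ℝ) : ∃! V, IsRescaledSolution F m y V := by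
  obtain ⟨β, hβ, h⟩ := exists_weight |y| K
  have hc := contractingWith_weightedMap hF hβ (m, y) (h y le_rfl)
  refine ⟨expWeight β * hc.fixedPoint, (isRescaledSolution_iff F hF.continuous hβ m y _).2
    hc.fixedPoint_isFixedPt, fun V hV => ?_⟩
  rw [← expWeight_mul_neg_mul β V, isRescaledSolution_iff F hF.continuous hβ] at hV
  rw [← expWeight_mul_neg_mul β V, hc.fixedPoint_unique hV]

theorem contDiff_of_isRescaledSolution {F : ℝ → ℝ} (hF : ContDiff ℝ (⊤ : ℕ∞) F) {K : NNReal}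
    (hK : LipschitzWith K F) {V : ℝ × ℝ → C(unitInterval, ℝ)}
    (hV : ∀ p, IsRescaledSolution F p.1 p.2 (V p)) : ContDiff ℝ (⊤ : ℕ∞) V := by
  rw [contDiff_infty]
  intro n
  refine ContDiff.of_le (n := ((n + 1 : ℕ) : WithTop ℕ∞)) ?_ (by exact_mod_cast n.le_succ)
  rw [contDiff_iff_contDiffAt]
  intro p
  obtain ⟨β, hβ, h⟩ := exists_weight (|p.2| + 1) K
  have hc : ∀ q : ℝ × ℝ, |q.2| ≤ |p.2| + 1 → _ := fun q hq =>
    contractingWith_weightedMap hK hβ q (h q.2 hq)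
  set Φ : (ℝ × ℝ) × C(unitInterval, ℝ) → C(unitInterval, ℝ) := fun q =>
    q.2 - weightedMap F hF.continuous hβ q.1 q.2
  set Z : ℝ × ℝ → C(unitInterval, ℝ) := fun q => expWeight (-β) * V q
  have hZV : ∀ q, V q = expWeight β * Z q := fun q => (expWeight_mul_neg_mul β (V q)).symm
  have hZ : ∀ q, weightedMap F hF.continuous hβ q (Z q) = Z q := fun q =>
    (isRescaledSolution_iff F hF.continuous hβ q.1 q.2 _).1 (by rw [← hZV]; exact hV q)
  have hΦ : ContDiff ℝ ((n + 1 : ℕ) : WithTop ℕ∞) Φ :=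
    contDiff_snd.sub (contDiff_weightedMap _ hF hβ)
  have pn : ((n + 1 : ℕ) : WithTop ℕ∞) ≠ 0 := by exact_mod_cast n.succ_ne_zero
  have hd : fderiv ℝ Φ (p, Z p) ∘L .inr ℝ (ℝ × ℝ) C(unitInterval, ℝ) =
      1 - fderiv ℝ (weightedMap F hF.continuous hβ p) (Z p) := by
    have h1 : HasFDerivAt (fun W => Φ (p, W)) (fderiv ℝ Φ (p, Z p) ∘L
        .inr ℝ (ℝ × ℝ) C(unitInterval, ℝ)) (Z p) :=
      (hΦ.differentiable pn (p, Z p)).hasFDerivAt.comp (Z p) (hasFDerivAt_prodMk_right p (Z p))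
    have h2 : DifferentiableAt ℝ (weightedMap F hF.continuous hβ p) (Z p) :=
      (((contDiff_weightedMap (n + 1) hF hβ).comp (contDiff_prodMk_right p)).differentiable pn) _
    exact h1.unique ((hasFDerivAt_id _).sub h2.hasFDerivAt)
  have hinv : (fderiv ℝ Φ (p, Z p) ∘L .inr ℝ (ℝ × ℝ) C(unitInterval, ℝ)).IsInvertible := by
    rw [hd]
    have hn : ‖fderiv ℝ (weightedMap F hF.continuous hβ p) (Z p)‖ < 1 :=
      (norm_fderiv_le_of_lipschitz ℝ (hc p (by linarith)).2).trans_lt (by norm_num)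
    obtain ⟨e, he⟩ := isUnit_one_sub_of_norm_lt_one
      (x := fderiv ℝ (weightedMap F hF.continuous hβ p) (Z p)) hn
    exact ⟨ContinuousLinearEquiv.unitsEquiv ℝ _ e, by rw [← he]; rfl⟩
  have key : ∀ᶠ q in 𝓝 p, (hΦ.contDiffAt.implicitFunction pn hinv) q = Z q := by
    have h1 := hΦ.contDiffAt.eventually_apply_implicitFunction pn hinv
    have h2 : ∀ᶠ q : ℝ × ℝ in 𝓝 p, |q.2| < |p.2| + 1 :=
      (by fun_prop : Continuous fun q : ℝ × ℝ => |q.2|).continuousAt.eventually_lt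
        continuousAt_const (by simp)
    filter_upwards [h1, h2] with q hq hq2
    have h0 : Φ (p, Z p) = 0 := by simp [Φ, hZ]
    rw [h0] at hq
    exact (hc q hq2.le).fixedPoint_unique' (sub_eq_zero.1 hq).symm (hZ q)
  have := (hΦ.contDiffAt.contDiffAt_implicitFunction pn hinv).congr_of_eventuallyEq
    (key.mono fun q hq => hq.symm)
  rw [funext hZV]
  exact contDiffAt_const.mul this

theorem exists_smooth_flow {F : ℝ → ℝ} (hF : ContDiff ℝ (⊤ : ℕ∞) F) {K : NNReal}
    (hK : LipschitzWith K F) : ∃ v : ℝ × ℝ → ℝ, ContDiff ℝ (⊤ : ℕ∞) v ∧ (∀ m, v (m, 0) = m) ∧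
      (∀ m y, v (m, -y) = v (m, y)) ∧
      ∀ m y, HasDerivAt (fun y => v (m, y)) (-∫ r in (0 : ℝ)..y, F (v (m, r))) y := by
  choose V hV hVu using fun p : ℝ × ℝ => existsUnique_isRescaledSolution hK p.1 p.2
  have hVc := contDiff_of_isRescaledSolution hF hK hV
  set v : ℝ × ℝ → ℝ := fun p => V p 1 with hv
  have hvc : ContDiff ℝ (⊤ : ℕ∞) v :=
    (ContinuousMap.evalCLM ℝ (1 : unitInterval) : C(unitInterval, ℝ) →L[ℝ] ℝ).contDiff.comp hVc
  have hscale : ∀ m y (s : unitInterval), V (m, y) s = v (m, s * y) := by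
    intro m y s
    have : (V (m, y)).comp ⟨fun t : unitInterval => s * t, by fun_prop⟩ = V (m, s * y) := by
      refine hVu (m, s * y) _ fun t => ?_
      have := hV (m, y) (s * t)
      simp only [ContinuousMap.comp_apply, ContinuousMap.coe_mk]
      rw [this]
      push_cast
      simp only [mul_assoc]
      ring
    rw [hv]
    dsimp only
    rw [← this]
    simp
  have hcont : ∀ m, Continuous fun r => F (v (m, r)) := fun m =>
    hF.continuous.comp (hvc.continuous.comp (by fun_prop))
  have hint : ∀ m y, v (m, y) = m - (y * (∫ r in (0 : ℝ)..y, F (v (m, r))) -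
      ∫ r in (0 : ℝ)..y, r * F (v (m, r))) := by
    intro m y
    have h1 := hV (m, y) 1
    simp only [one_mul, hscale] at h1
    have h2 : (∫ t : unitInterval, (1 - (t : ℝ)) * F (v (m, t * y))) =
        ∫ t in (0 : ℝ)..1, (1 - t) * F (v (m, t * y)) := by
      rw [intervalIntegral.integral_of_le zero_le_one, ← integral_Icc_eq_integral_Ioc]
      exact integral_subtype_comap (measurableSet_Icc)
        (fun t : ℝ => (1 - t) * F (v (m, t * y)))
    have h3 := intervalIntegral.smul_integral_comp_mul_right
      (f := fun r => (y - r) * F (v (m, r))) (a := 0) (b := 1) y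
    rw [zero_mul, one_mul, smul_eq_mul] at h3
    have h4 : (∫ t in (0 : ℝ)..1, (y - t * y) * F (v (m, t * y))) =
        y * ∫ t in (0 : ℝ)..1, (1 - t) * F (v (m, t * y)) := by
      rw [← intervalIntegral.integral_const_mul]
      congr 1; ext t; ring
    have h5 : (∫ r in (0 : ℝ)..y, (y - r) * F (v (m, r))) =
        y * (∫ r in (0 : ℝ)..y, F (v (m, r))) - ∫ r in (0 : ℝ)..y, r * F (v (m, r)) := by
      rw [← intervalIntegral.integral_const_mul, ← intervalIntegral.integral_sub]
      · congr 1; ext t; ring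
      · exact (continuous_const.mul (hcont m)).intervalIntegrable _ _
      · exact (continuous_id.mul (hcont m)).intervalIntegrable _ _
    rw [h2] at h1
    rw [← h5, ← h3, h4]
    simp only [Icc.coe_one, one_mul] at h1
    rw [h1]
    ring
  refine ⟨v, hvc, fun m => by rw [hint]; simp, fun m y => ?_, fun m y => ?_⟩
  · have h1 := hV (m, -y)
    refine congrArg (fun W : C(unitInterval, ℝ) => W 1) (hVu (m, y) (V (m, -y)) fun s => ?_)
    rw [h1 s]
    simp
  · have h1 := intervalIntegral.integral_hasDerivAt_right ((hcont m).intervalIntegrable 0 y)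
      (hcont m).stronglyMeasurable.stronglyMeasurableAtFilter (hcont m).continuousAt
    have hc2 : Continuous fun r => r * F (v (m, r)) := continuous_id.mul (hcont m)
    have h2 := intervalIntegral.integral_hasDerivAt_right (hc2.intervalIntegrable 0 y)
      hc2.stronglyMeasurable.stronglyMeasurableAtFilter hc2.continuousAt
    have h3 := (((hasDerivAt_id y).mul h1).sub h2).const_sub m
    refine (h3.congr_of_eventuallyEq (Eventually.of_forall fun y => hint m y)).congr_deriv ?_
    simp

/-- `v (m, ·)` is the even solution of `-v'' = F(v)` with value `m` at the origin. -/
structure IsFlow (F : ℝ → ℝ) (v : ℝ × ℝ → ℝ) : Prop where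
  contDiff : ContDiff ℝ (⊤ : ℕ∞) v
  init : ∀ m, v (m, 0) = m
  even : ∀ m y, v (m, -y) = v (m, y)
  hasDerivAt : ∀ m y, HasDerivAt (fun y => v (m, y)) (-∫ r in (0 : ℝ)..y, F (v (m, r))) y

/-- The derivative of `v` in its second variable. -/
def slope₂ (v : ℝ × ℝ → ℝ) (p : ℝ × ℝ) : ℝ := fderiv ℝ v p (0, 1)

/-- The derivative of `v` in its first variable. -/
def slope₁ (v : ℝ × ℝ → ℝ) (p : ℝ × ℝ) : ℝ := fderiv ℝ v p (1, 0)

theorem contDiff_fderiv_apply {E : Type*} [NormedAddCommGroup E] [NormedSpace ℝ E] {g : E → ℝ}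
    (hg : ContDiff ℝ (⊤ : ℕ∞) g) (a : E) : ContDiff ℝ (⊤ : ℕ∞) fun q => fderiv ℝ g q a :=
  (hg.fderiv_right (by exact_mod_cast le_top)).clm_apply contDiff_const

theorem fderiv_fderiv_apply_comm {E : Type*} [NormedAddCommGroup E] [NormedSpace ℝ E] {g : E → ℝ}
    (hg : ContDiff ℝ (⊤ : ℕ∞) g) (a b p : E) :
    fderiv ℝ (fun q => fderiv ℝ g q a) p b = fderiv ℝ (fun q => fderiv ℝ g q b) p a := by
  have hd : DifferentiableAt ℝ (fderiv ℝ g) p :=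
    ((hg.fderiv_right (m := 1) (WithTop.coe_le_coe.2 (le_top : (1 + 1 : ℕ∞) ≤ ⊤))).differentiable
      (by norm_num)) p
  have hs := (hg.contDiffAt (x := p)).isSymmSndFDerivAt (by simp; exact WithTop.coe_le_coe.2 le_top)
  rw [fderiv_clm_apply hd (differentiableAt_const a),
    fderiv_clm_apply hd (differentiableAt_const b)]
  simpa using hs b a

theorem hasDerivAt_snd {g : ℝ × ℝ → ℝ} (hg : ContDiff ℝ (⊤ : ℕ∞) g) (m y : ℝ) :
    HasDerivAt (fun y => g (m, y)) (fderiv ℝ g (m, y) (0, 1)) y :=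
  ((hg.differentiable (by simp)) (m, y)).hasFDerivAt.comp_hasDerivAt y
    ((hasDerivAt_const y m).prodMk (hasDerivAt_id y))

theorem hasDerivAt_fst {g : ℝ × ℝ → ℝ} (hg : ContDiff ℝ (⊤ : ℕ∞) g) (m y : ℝ) :
    HasDerivAt (fun m => g (m, y)) (fderiv ℝ g (m, y) (1, 0)) m :=
  ((hg.differentiable (by simp)) (m, y)).hasFDerivAt.comp_hasDerivAt m
    ((hasDerivAt_id m).prodMk (hasDerivAt_const m y))

namespace IsFlow

variable {F : ℝ → ℝ} {v : ℝ × ℝ → ℝ}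

theorem slope₂_eq (h : IsFlow F v) (m y : ℝ) :
    slope₂ v (m, y) = -∫ r in (0 : ℝ)..y, F (v (m, r)) :=
  (hasDerivAt_snd h.contDiff m y).unique (h.hasDerivAt m y)

theorem hasDerivAt_slope₂ (h : IsFlow F v) (hF : Continuous F) (m y : ℝ) :
    HasDerivAt (fun y => slope₂ v (m, y)) (-F (v (m, y))) y := by
  have hc : Continuous fun r => F (v (m, r)) :=
    hF.comp (h.contDiff.continuous.comp (by fun_prop))
  have h1 := (intervalIntegral.integral_hasDerivAt_right (hc.intervalIntegrable 0 y)
    hc.stronglyMeasurable.stronglyMeasurableAtFilter hc.continuousAt).neg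
  exact h1.congr_of_eventuallyEq (Eventually.of_forall fun y => h.slope₂_eq m y)

theorem slope₂_zero (h : IsFlow F v) (m : ℝ) : slope₂ v (m, 0) = 0 := by
  simp [h.slope₂_eq]

theorem slope₂_nonpos (h : IsFlow F v) (hF0 : ∀ t, 0 ≤ F t) (m : ℝ) {y : ℝ} (hy : 0 ≤ y) :
    slope₂ v (m, y) ≤ 0 := by
  rw [h.slope₂_eq, neg_nonpos]
  exact intervalIntegral.integral_nonneg hy fun r _ => hF0 _

theorem antitoneOn (h : IsFlow F v) (hF0 : ∀ t, 0 ≤ F t) (m : ℝ) :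
    AntitoneOn (fun y => v (m, y)) (Ici 0) := by
  refine antitoneOn_of_deriv_nonpos (convex_Ici 0)
    (fun y _ => (hasDerivAt_snd h.contDiff m y).continuousAt.continuousWithinAt)
    (fun y _ => (hasDerivAt_snd h.contDiff m y).differentiableAt.differentiableWithinAt) ?_
  intro y hy
  rw [interior_Ici, mem_Ioi] at hy
  rw [(hasDerivAt_snd h.contDiff m y).deriv]
  exact h.slope₂_nonpos hF0 m hy.le

theorem apply_abs (h : IsFlow F v) (m y : ℝ) : v (m, |y|) = v (m, y) := by
  rcases abs_choice y with hy | hy <;> rw [hy]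
  exact h.even m y

theorem le_init (h : IsFlow F v) (hF0 : ∀ t, 0 ≤ F t) (m y : ℝ) : v (m, y) ≤ m := by
  have := h.antitoneOn hF0 m (mem_Ici.2 le_rfl) (mem_Ici.2 (abs_nonneg y)) (abs_nonneg y)
  simpa [h.apply_abs, h.init] using this

theorem slope₂_neg (h : IsFlow F v) (hF : Continuous F) (hF0 : ∀ t, 0 ≤ F t) {m y α : ℝ}
    (hα : ∀ t, α ≤ t → t ≤ m → 0 < F t) (hy : 0 < y) (hv : α ≤ v (m, y)) :
    slope₂ v (m, y) < 0 := by
  rw [h.slope₂_eq, neg_lt_zero]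
  refine intervalIntegral.intervalIntegral_pos_of_pos_on
    ((hF.comp (h.contDiff.continuous.comp (by fun_prop))).intervalIntegrable _ _)
    (fun r hr => hα _ ?_ (h.le_init hF0 m r)) hy
  exact hv.trans (h.antitoneOn hF0 m (mem_Ici.2 hr.1.le) (mem_Ici.2 hy.le) hr.2.le)

/-- The derivative of the flow with respect to its initial value. -/
theorem hasDerivAt_slope₁ (h : IsFlow F v) (m y : ℝ) :
    HasDerivAt (fun y => slope₁ v (m, y)) (fderiv ℝ (slope₂ v) (m, y) (1, 0)) y := by
  have := hasDerivAt_snd (contDiff_fderiv_apply h.contDiff (1, 0)) m y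
  rwa [fderiv_fderiv_apply_comm h.contDiff] at this

theorem hasDerivAt_fderiv_slope₂ (h : IsFlow F v) (hF : ContDiff ℝ (⊤ : ℕ∞) F) (m y : ℝ) :
    HasDerivAt (fun y => fderiv ℝ (slope₂ v) (m, y) (1, 0))
      (-(deriv F (v (m, y)) * slope₁ v (m, y))) y := by
  have hs := contDiff_fderiv_apply h.contDiff ((0, 1) : ℝ × ℝ)
  have h1 := hasDerivAt_snd (contDiff_fderiv_apply hs (1, 0)) m y
  rw [fderiv_fderiv_apply_comm hs] at h1
  have h2 : (fun q => fderiv ℝ (fun q => fderiv ℝ v q (0, 1)) q (0, 1)) = fun q => -F (v q) := by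
    funext ⟨m, y⟩
    exact (hasDerivAt_snd hs m y).unique (h.hasDerivAt_slope₂ hF.continuous m y)
  rw [h2] at h1
  have hd := (h.contDiff.differentiable (by simp)) (m, y)
  have h3 : HasFDerivAt (fun q => -F (v q)) _ (m, y) :=
    (((hF.differentiable (by simp)) (v (m, y))).hasDerivAt.comp_hasFDerivAt (m, y)
      hd.hasFDerivAt).neg
  rw [h3.fderiv] at h1
  simp only [neg_apply, smul_apply, smul_eq_mul] at h1
  exact h1

theorem slope₁_zero (h : IsFlow F v) (m : ℝ) : slope₁ v (m, 0) = 1 := by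
  refine (hasDerivAt_fst h.contDiff m 0).unique ?_
  simp only [h.init]
  exact hasDerivAt_id m

theorem fderiv_slope₂_zero (h : IsFlow F v) (m : ℝ) : fderiv ℝ (slope₂ v) (m, 0) (1, 0) = 0 := by
  refine (hasDerivAt_fst (contDiff_fderiv_apply h.contDiff ((0, 1) : ℝ × ℝ)) m 0).unique ?_
  have : (fun m => fderiv ℝ v (m, 0) (0, 1)) = fun _ => (0 : ℝ) := funext h.slope₂_zero
  rw [this]
  exact hasDerivAt_const m 0

theorem slope₁_neg (h : IsFlow F v) (m y : ℝ) : slope₁ v (m, -y) = slope₁ v (m, y) := by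
  refine (hasDerivAt_fst h.contDiff m (-y)).unique ?_
  simp only [h.even]
  exact hasDerivAt_fst h.contDiff m y

end IsFlow

theorem exists_smooth_truncation {ε : ℝ} (hε : 0 < ε) : ∃ h : ℝ → ℝ, ContDiff ℝ (⊤ : ℕ∞) h ∧
    (∀ t ≤ 0, h t = 0) ∧ (∀ t, |deriv h t| ≤ 1) ∧ (∀ t, 0 ≤ h t) ∧ ∀ t, t - ε ≤ h t := by
  set h : ℝ → ℝ := fun t => t * expNegInvGlue (t / ε) with hh
  have hsm : ContDiff ℝ (⊤ : ℕ∞) h :=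
    contDiff_id.mul (expNegInvGlue.contDiff.comp (contDiff_id.div_const ε))
  have hz : ∀ t ≤ 0, h t = 0 := fun t ht => by
    simp [hh, expNegInvGlue.zero_of_nonpos (div_nonpos_of_nonpos_of_nonneg ht hε.le)]
  have hp : ∀ t, 0 < t → h t = t * Real.exp (-(ε / t)) := fun t ht => by
    simp [hh, expNegInvGlue, not_le.2 (div_pos ht hε)]
  have h0 : ∀ t, 0 ≤ h t := fun t => by
    rcases le_or_gt t 0 with ht | ht
    · exact (hz t ht).ge
    · rw [hp t ht]; positivity
  refine ⟨h, hsm, hz, fun t => ?_, h0, fun t => ?_⟩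
  · rcases le_or_gt t 0 with ht | ht
    · have : IsLocalMin h t := Eventually.of_forall fun s => by rw [hz t ht]; exact h0 s
      simp [this.deriv_eq_zero]
    · have he : h =ᶠ[𝓝 t] fun t => t * Real.exp (-(ε / t)) := by
        filter_upwards [lt_mem_nhds ht] with s hs using hp s hs
      have hd : HasDerivAt (fun t => t * Real.exp (-(ε / t)))
          (1 * Real.exp (-(ε / t)) + t * (Real.exp (-(ε / t)) * -((0 * t - ε * 1) / t ^ 2))) t :=
        (hasDerivAt_id t).mul (((hasDerivAt_const t ε).div (hasDerivAt_id t) ht.ne').neg.exp)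
      rw [he.deriv_eq, hd.deriv]
      have e1 : 1 * Real.exp (-(ε / t)) + t * (Real.exp (-(ε / t)) * -((0 * t - ε * 1) / t ^ 2)) =
          Real.exp (-(ε / t)) * (ε / t + 1) := by field_simp; ring
      rw [e1, abs_of_nonneg (by positivity)]
      calc Real.exp (-(ε / t)) * (ε / t + 1) ≤ Real.exp (-(ε / t)) * Real.exp (ε / t) := by
            gcongr; exact Real.add_one_le_exp _
        _ = 1 := by rw [← Real.exp_add]; simp
  · rcases le_or_gt t 0 with ht | ht
    · rw [hz t ht]; linarith
    · rw [hp t ht]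
      have := mul_le_mul_of_nonneg_left (Real.one_sub_le_exp_neg (ε / t)) ht.le
      have e2 : t * (1 - ε / t) = t - ε := by field_simp
      linarith

theorem nonneg_of_stable {q z z₁ : ℝ → ℝ} (hq : Continuous q) (hq0 : ∀ y ∈ Ioo (-1 : ℝ) 1, 0 ≤ q y)
    (hst : ∀ ξ : ℝ → ℝ, ContDiff ℝ (⊤ : ℕ∞) ξ → HasCompactSupport ξ →
      tsupport ξ ⊆ Ioo (-1) 1 → ξ ≠ 0 →
      0 < (∫ y in Ioo (-1:ℝ) 1, (deriv ξ y) ^ 2) - ∫ y in Ioo (-1:ℝ) 1, q y * (ξ y) ^ 2)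
    (hzc : ContDiff ℝ (⊤ : ℕ∞) z) (hz₁ : ∀ y, HasDerivAt z (z₁ y) y)
    (hz₂ : ∀ y, HasDerivAt z₁ (-(q y * z y)) y) (hz0 : z 0 = 1) (hze : ∀ y, z (-y) = z y)
    {y₂ : ℝ} (hy₂ : 0 ≤ y₂) (hy₂' : y₂ < 1) : 0 ≤ z y₂ := by
  by_contra! hneg
  set s := -z y₂ / 4 with hs
  have hs0 : 0 < s := by rw [hs]; linarith
  set Z : ℝ → ℝ := fun y => z y + s * (1 + y ^ 2) with hZ
  have hZc : ContDiff ℝ (⊤ : ℕ∞) Z :=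
    hzc.add (contDiff_const.mul (contDiff_const.add (contDiff_id.pow 2)))
  have hZ₁ : ∀ y, HasDerivAt Z (z₁ y + s * (2 * y)) y := fun y => by
    have := (hz₁ y).add ((((hasDerivAt_id y).pow 2).const_add 1).const_mul s)
    exact this.congr_deriv (by simp)
  have hZ₂ : ∀ y, HasDerivAt (fun y => z₁ y + s * (2 * y)) (-(q y * z y) + 2 * s) y := fun y => by
    have := (hz₂ y).add (((hasDerivAt_id y).const_mul 2).const_mul s)
    exact this.congr_deriv (by ring)
  have hZe : ∀ y, Z (-y) = Z y := fun y => by simp [hZ, hze]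
  have hZy₂ : Z y₂ ≤ 0 := by
    have : y₂ ^ 2 ≤ 1 := pow_le_one₀ hy₂ hy₂'.le
    have := mul_le_mul_of_nonneg_left this hs0.le
    simp only [hZ]; linarith
  obtain ⟨a, ⟨⟨ha0, hay⟩, haZ⟩, hamin⟩ := (isCompact_Icc.inter_right
    (isClosed_le hZc.continuous continuous_const) :
      IsCompact (Icc 0 y₂ ∩ {y | Z y ≤ 0})).exists_isLeast
      ⟨y₂, ⟨hy₂, le_rfl⟩, hZy₂⟩
  have hZ0 : 0 < Z 0 := by simp only [hZ, hz0]; positivity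
  have ha : 0 < a := by
    refine lt_of_le_of_ne ha0 fun h => ?_
    rw [← h] at haZ
    exact absurd haZ (not_le.2 hZ0)
  have ha1 : a < 1 := hay.trans_lt hy₂'
  have hpos : ∀ y, |y| < a → 0 < Z y := fun y hy => by
    have : Z |y| = Z y := by rcases abs_choice y with h | h <;> rw [h]; exact hZe y
    rw [← this]
    by_contra! h
    exact absurd (hamin ⟨⟨abs_nonneg y, hy.le.trans hay⟩, h⟩) (not_le.2 hy)
  have haZ0 : Z a = 0 := by
    refine le_antisymm haZ (ge_of_tendsto
      (hZc.continuous.continuousWithinAt (s := Iio a) (x := a)) ?_)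
    filter_upwards [Ioo_mem_nhdsLT ha] with y hy
    exact (hpos y (by rw [abs_of_pos hy.1]; exact hy.2)).le
  obtain ⟨B, hB⟩ := (isCompact_Icc (a := -a) (b := a)).exists_bound_of_continuousOn hq.continuousOn
  have hB' : ∀ y, |y| ≤ a → q y ≤ |B| := fun y hy =>
    (le_abs_self _).trans ((hB y (abs_le.1 hy)).trans (le_abs_self B))
  set ε := s / (2 * (|B| + 1)) with hε
  have hε0 : 0 < ε := by positivity
  have hεB : 2 * ε * (|B| + 1) = s := by rw [hε]; field_simp
  obtain ⟨h, hhc, hhz, hh1, hh0, hhl⟩ := exists_smooth_truncation hε0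
  set ξ : ℝ → ℝ := fun y => if |y| < a then h (Z y - ε) else 0 with hξ
  have hin : ∀ y, |y| < a → ξ =ᶠ[𝓝 y] fun y => h (Z y - ε) := fun y hy => by
    filter_upwards [continuous_abs.continuousAt.eventually_lt_const hy] with t ht
    simp [hξ, ht]
  have hout : ∀ y, a ≤ |y| → ξ =ᶠ[𝓝 y] fun _ => 0 := fun y hy => by
    rcases hy.eq_or_lt with he | hl
    · have hZy : Z y = 0 := by
        rcases abs_choice y with h | h <;> rw [h] at he
        · rw [← he, haZ0]
        · rw [← hZe, ← he, haZ0]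
      filter_upwards [hZc.continuous.continuousAt.eventually_lt_const
        (hZy ▸ hε0 : Z y < ε)] with t ht
      have : h (Z t - ε) = 0 := hhz _ (by linarith)
      simp [hξ, this]
    · filter_upwards [continuous_abs.continuousAt.eventually_const_lt hl] with t ht
      simp [hξ, not_lt.2 ht.le]
  have hξc : ContDiff ℝ (⊤ : ℕ∞) ξ := contDiff_iff_contDiffAt.2 fun y => by
    rcases lt_or_ge |y| a with hy | hy
    · exact ((hhc.comp (hZc.sub contDiff_const)).contDiffAt).congr_of_eventuallyEq (hin y hy)
    · exact contDiffAt_const.congr_of_eventuallyEq (hout y hy)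
  have hts : tsupport ξ ⊆ Icc (-a) a := closure_minimal (fun y hy => by
    by_contra hn
    refine hy ?_
    have : ¬ |y| < a := fun h => hn (abs_le.1 h.le)
    simp [hξ, this]) isClosed_Icc
  have hξne : ξ ≠ 0 := fun h0 => by
    have h1 := hhl (Z 0 - ε)
    have h2 : ξ 0 = h (Z 0 - ε) := by simp [hξ, ha]
    rw [← h2, h0] at h1
    have h3 : Z 0 = 1 + s := by simp [hZ, hz0]
    have h4 : 0 ≤ ε * |B| := by positivity
    simp at h1
    nlinarith
  have hQ := hst ξ hξc (HasCompactSupport.of_support_subset_isCompact isCompact_Icc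
    ((subset_tsupport ξ).trans hts)) (hts.trans (Icc_subset_Ioo (by linarith) ha1)) hξne
  have hsub : Ioc (-a) a ⊆ Ioo (-1) 1 :=
    Ioc_subset_Icc_self.trans (Icc_subset_Ioo (by linarith) ha1)
  have hoff : ∀ y ∈ Ioo (-1 : ℝ) 1 \ Ioc (-a) a, a ≤ |y| := fun y hy => by
    by_contra! hlt
    exact hy.2 ⟨(abs_lt.1 hlt).1, (abs_lt.1 hlt).2.le⟩
  rw [setIntegral_eq_of_subset_of_forall_sdiff_eq_zero measurableSet_Ioo hsub
      (fun y hy => by rw [(hout y (hoff y hy)).deriv_eq]; simp),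
    setIntegral_eq_of_subset_of_forall_sdiff_eq_zero measurableSet_Ioo hsub
      (fun y hy => by rw [(hout y (hoff y hy)).eq_of_nhds]; simp),
    ← intervalIntegral.integral_of_le (by linarith),
    ← intervalIntegral.integral_of_le (by linarith)]
    at hQ
  have hz₁c : Continuous z₁ := continuous_iff_continuousAt.2 fun y => (hz₂ y).continuousAt
  have hcd : Continuous (deriv ξ) := hξc.continuous_deriv (by exact_mod_cast le_top)
  have hcξ := hξc.continuous
  have hcz := hzc.continuous
  have hcZ := hZc.continuous
  have hparts := intervalIntegral.integral_mul_deriv_eq_deriv_mul (a := -a) (b := a)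
    (u := Z) (v := fun y => z₁ y + s * (2 * y)) (fun y _ => hZ₁ y) (fun y _ => hZ₂ y)
    (Continuous.intervalIntegrable (by fun_prop) _ _)
    (Continuous.intervalIntegrable (by fun_prop) _ _)
  rw [hZe, haZ0, zero_mul, zero_mul, sub_zero, zero_sub] at hparts
  have hle : (∫ y in (-a)..a, (deriv ξ y) ^ 2) ≤
      ∫ y in (-a)..a, (z₁ y + s * (2 * y)) * (z₁ y + s * (2 * y)) := by
    refine intervalIntegral.integral_mono_on (by linarith)
      (Continuous.intervalIntegrable (by fun_prop) _ _)
      (Continuous.intervalIntegrable (by fun_prop) _ _) fun y _ => ?_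
    rcases lt_or_ge |y| a with hy | hy
    · have hd : HasDerivAt (fun y => h (Z y - ε)) (deriv h (Z y - ε) * (z₁ y + s * (2 * y))) y :=
        ((hhc.differentiable (by simp)) _).hasDerivAt.comp y ((hZ₁ y).sub_const ε)
      rw [(hin y hy).deriv_eq, hd.deriv, mul_pow, ← sq]
      refine mul_le_of_le_one_left (sq_nonneg _) ?_
      rw [← sq_abs]
      exact pow_le_one₀ (abs_nonneg _) (hh1 _)
    · rw [(hout y hy).deriv_eq]
      simp only [deriv_const]
      nlinarith [mul_self_nonneg (z₁ y + s * (2 * y))]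
  have hle2 : (∫ y in (-a)..a, Z y * -(-(q y * z y) + 2 * s)) ≤
      ∫ y in (-a)..a, q y * (ξ y) ^ 2 := by
    refine intervalIntegral.integral_mono_on (by linarith)
      (Continuous.intervalIntegrable (by fun_prop) _ _)
      (Continuous.intervalIntegrable (by fun_prop) _ _) fun y hy => ?_
    have hya : |y| ≤ a := abs_le.2 hy
    have hqy : 0 ≤ q y := hq0 y ⟨by linarith [hy.1], by linarith [hy.2]⟩
    have hqB := hB' y hya
    rcases lt_or_eq_of_le hya with hlt | heq
    · have hZp := hpos y hlt
      have hξy : ξ y = h (Z y - ε) := (hin y hlt).eq_of_nhds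
      have h5 : Z y ^ 2 - 4 * ε * Z y ≤ ξ y ^ 2 := by
        rw [hξy]
        have h6 := hhl (Z y - ε)
        have h7 := hh0 (Z y - ε)
        rcases le_or_gt (Z y) (2 * ε) with hc | hc
        · nlinarith
        · nlinarith
      have h8 := mul_le_mul_of_nonneg_left h5 hqy
      have h9 : z y ≤ Z y := by simp only [hZ]; nlinarith [sq_nonneg y]
      have h10 := mul_le_mul_of_nonneg_left h9 (mul_nonneg hqy hZp.le)
      have h11 : 2 * ε * q y ≤ s := by nlinarith
      have h12 := mul_le_mul_of_nonneg_left h11 hZp.le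
      nlinarith
    · have hZy : Z y = 0 := by
        rcases abs_choice y with h | h <;> rw [h] at heq
        · rw [heq, haZ0]
        · rw [← hZe, heq, haZ0]
      rw [hZy, (hout y heq.ge).eq_of_nhds]; simp
  have hneg : (∫ y in (-a)..a, Z y * -(-(q y * z y) + 2 * s)) =
      -∫ y in (-a)..a, Z y * (-(q y * z y) + 2 * s) := by
    rw [← intervalIntegral.integral_neg]
    congr 1; ext y; ring
  linarith

theorem pos_of_stable {q z z₁ : ℝ → ℝ} (hq : Continuous q) (hq0 : ∀ y ∈ Ioo (-1 : ℝ) 1, 0 ≤ q y)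
    (hst : ∀ ξ : ℝ → ℝ, ContDiff ℝ (⊤ : ℕ∞) ξ → HasCompactSupport ξ →
      tsupport ξ ⊆ Ioo (-1) 1 → ξ ≠ 0 →
      0 < (∫ y in Ioo (-1:ℝ) 1, (deriv ξ y) ^ 2) - ∫ y in Ioo (-1:ℝ) 1, q y * (ξ y) ^ 2)
    (hzc : ContDiff ℝ (⊤ : ℕ∞) z) (hz₁ : ∀ y, HasDerivAt z (z₁ y) y)
    (hz₂ : ∀ y, HasDerivAt z₁ (-(q y * z y)) y) (hz0 : z 0 = 1) (hze : ∀ y, z (-y) = z y)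
    {y : ℝ} (hy : 0 ≤ y) (hy1 : y < 1) : 0 < z y := by
  have hn : ∀ y, 0 ≤ y → y < 1 → 0 ≤ z y := fun y =>
    nonneg_of_stable hq hq0 hst hzc hz₁ hz₂ hz0 hze
  refine lt_of_le_of_ne (hn y hy hy1) fun h0 => ?_
  have hy0 : 0 < y := hy.lt_of_ne fun h => by rw [← h, hz0] at h0; norm_num at h0
  have hmin : IsLocalMin z y := by
    filter_upwards [Ioo_mem_nhds hy0 hy1] with t ht
    rw [← h0]; exact hn t ht.1.le ht.2
  have hz₁y : z₁ y = 0 := by rw [← (hz₁ y).deriv]; exact hmin.deriv_eq_zero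
  have hanti : AntitoneOn z₁ (Icc 0 y) := by
    refine antitoneOn_of_deriv_nonpos (convex_Icc 0 y)
      (fun t _ => (hz₂ t).continuousAt.continuousWithinAt)
      (fun t _ => (hz₂ t).differentiableAt.differentiableWithinAt) fun t ht => ?_
    rw [interior_Icc] at ht
    rw [(hz₂ t).deriv, neg_nonpos]
    exact mul_nonneg (hq0 t ⟨by linarith [ht.1], ht.2.trans hy1⟩) (hn t ht.1.le (ht.2.trans hy1))
  have hmono : MonotoneOn z (Icc 0 y) := by
    refine monotoneOn_of_deriv_nonneg (convex_Icc 0 y)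
      (fun t _ => (hz₁ t).continuousAt.continuousWithinAt)
      (fun t _ => (hz₁ t).differentiableAt.differentiableWithinAt) fun t ht => ?_
    rw [interior_Icc] at ht
    rw [(hz₁ t).deriv, ← hz₁y]
    exact hanti ⟨ht.1.le, ht.2.le⟩ ⟨hy, le_rfl⟩ ht.2.le
  have := hmono ⟨le_rfl, hy⟩ ⟨hy, le_rfl⟩ hy
  linarith

theorem ConvexOn.tangent_le {f : ℝ → ℝ} (hc : ConvexOn ℝ univ f) (hd : Differentiable ℝ f)
    (x y : ℝ) : f x + deriv f x * (y - x) ≤ f y := by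
  rcases lt_trichotomy x y with h | h | h
  · have := hc.deriv_le_slope (mem_univ x) (mem_univ y) h (hd x)
    rw [slope_def_field, le_div_iff₀ (sub_pos.2 h)] at this
    linarith
  · simp [h]
  · have := hc.slope_le_deriv (mem_univ y) (mem_univ x) h (hd x)
    rw [slope_def_field, div_le_iff₀ (sub_pos.2 h)] at this
    linarith

/-- The one-dimensional family of profiles: `v (M, ·)` is the stable solution on `(-1, 1)`,
embedded in the flow of a truncation `F` of the nonlinearity `lam * f`. -/
structure IsProfile (f : ℝ → ℝ) (lam : ℝ) (F : ℝ → ℝ) (v : ℝ × ℝ → ℝ) (M α : ℝ) : Prop where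
  flow : IsFlow F v
  contDiff_F : ContDiff ℝ (⊤ : ℕ∞) F
  F_nonneg : ∀ t, 0 ≤ F t
  contDiff_f : ContDiff ℝ (⊤ : ℕ∞) f
  convex : ConvexOn ℝ univ f
  mono : Monotone f
  lam_pos : 0 < lam
  α_pos : 0 < α
  M_pos : 0 < M
  f_pos : ∀ t, -α ≤ t → 0 < f t
  F_eq : ∀ t ∈ Icc (-α) M, F t = lam * f t
  deriv_F_eq : ∀ t ∈ Icc (-α) M, deriv F t = lam * deriv f t
  top : v (M, 1) = 0
  slope₁_pos : ∀ y ∈ Ico (0 : ℝ) 1, 0 < slope₁ v (M, y)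

namespace IsProfile

variable {f : ℝ → ℝ} {lam : ℝ} {F : ℝ → ℝ} {v : ℝ × ℝ → ℝ} {M α : ℝ}

theorem top_nonneg (h : IsProfile f lam F v M α) {y : ℝ} (hy : 0 ≤ y) (hy1 : y ≤ 1) :
    0 ≤ v (M, y) := by
  rw [← h.top]
  exact h.flow.antitoneOn h.F_nonneg M hy (mem_Ici.2 zero_le_one) hy1

theorem differentiable_f (h : IsProfile f lam F v M α) : Differentiable ℝ f :=
  h.contDiff_f.differentiable (by simp)

/-- The Wronskian of the difference of two profiles and the linearised profile. -/
def wronskian (v : ℝ × ℝ → ℝ) (M m y : ℝ) : ℝ :=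
  (slope₂ v (M, y) - slope₂ v (m, y)) * slope₁ v (M, y) -
    (v (M, y) - v (m, y)) * fderiv ℝ (slope₂ v) (M, y) (1, 0)

theorem hasDerivAt_wronskian (h : IsProfile f lam F v M α) {m y : ℝ} (hm : m ≤ M) (hy : 0 ≤ y)
    (hy1 : y ≤ 1) (hv : -α ≤ v (m, y)) :
    HasDerivAt (wronskian v M m) (lam * slope₁ v (M, y) *
      (f (v (m, y)) - (f (v (M, y)) + deriv f (v (M, y)) * (v (m, y) - v (M, y))))) y := by
  have hF := h.contDiff_F.continuous
  have h1 := (((h.flow.hasDerivAt_slope₂ hF M y).sub (h.flow.hasDerivAt_slope₂ hF m y)).mul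
    (h.flow.hasDerivAt_slope₁ M y)).sub
    (((hasDerivAt_snd h.flow.contDiff M y).sub (hasDerivAt_snd h.flow.contDiff m y)).mul
      (h.flow.hasDerivAt_fderiv_slope₂ h.contDiff_F M y))
  have hα := h.α_pos
  have huM : v (M, y) ∈ Icc (-α) M :=
    ⟨by linarith [h.top_nonneg hy hy1], h.flow.le_init h.F_nonneg M y⟩
  have hvM : v (m, y) ∈ Icc (-α) M := ⟨hv, (h.flow.le_init h.F_nonneg m y).trans hm⟩
  refine h1.congr_deriv ?_
  simp only [Pi.sub_apply]
  rw [h.F_eq _ huM, h.F_eq _ hvM, h.deriv_F_eq _ huM, slope₂, slope₂]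
  ring

theorem slope₁_nonneg (h : IsProfile f lam F v M α) {y : ℝ} (hy : 0 ≤ y) (hy1 : y ≤ 1) :
    0 ≤ slope₁ v (M, y) := by
  have hc : Continuous fun y => slope₁ v (M, y) :=
    continuous_iff_continuousAt.2 fun y => (h.flow.hasDerivAt_slope₁ M y).continuousAt
  rcases hy1.lt_or_eq with h1 | h1
  · exact (h.slope₁_pos y ⟨hy, h1⟩).le
  · rw [h1]
    refine ge_of_tendsto (hc.continuousWithinAt (s := Iio 1) (x := 1)) ?_
    filter_upwards [Ioo_mem_nhdsLT (zero_lt_one' ℝ)] with t ht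
    exact (h.slope₁_pos t ⟨ht.1.le, ht.2⟩).le

theorem monotoneOn_wronskian (h : IsProfile f lam F v M α) {m Y : ℝ} (hm : m ≤ M)
    (hY1 : Y ≤ 1) (hv : -α ≤ v (m, Y)) : MonotoneOn (wronskian v M m) (Icc 0 Y) := by
  have hvy : ∀ y ∈ Icc 0 Y, -α ≤ v (m, y) := fun y hy =>
    hv.trans (h.flow.antitoneOn h.F_nonneg m hy.1 (hy.1.trans hy.2) hy.2)
  have hd : ∀ y ∈ Icc 0 Y, _ := fun y hy =>
    h.hasDerivAt_wronskian hm hy.1 (hy.2.trans hY1) (hvy y hy)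
  refine monotoneOn_of_deriv_nonneg (convex_Icc 0 Y)
    (fun y hy => (hd y hy).continuousAt.continuousWithinAt)
    (fun y hy => (hd y (interior_subset hy)).differentiableAt.differentiableWithinAt)
    fun y hy => ?_
  have hy := interior_subset hy
  rw [(hd y hy).deriv]
  have := h.convex.tangent_le h.differentiable_f (v (M, y)) (v (m, y))
  exact mul_nonneg (mul_nonneg h.lam_pos.le (h.slope₁_nonneg hy.1 (hy.2.trans hY1)))
    (by linarith)

theorem wronskian_zero (h : IsProfile f lam F v M α) (m : ℝ) : wronskian v M m 0 = 0 := by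
  simp [wronskian, h.flow.slope₂_zero, h.flow.fderiv_slope₂_zero]

theorem wronskian_nonneg (h : IsProfile f lam F v M α) {m Y : ℝ} (hm : m ≤ M) (hY : 0 ≤ Y)
    (hY1 : Y ≤ 1) (hv : -α ≤ v (m, Y)) : 0 ≤ wronskian v M m Y := by
  rw [← h.wronskian_zero m]
  exact h.monotoneOn_wronskian hm hY1 hv ⟨le_rfl, hY⟩ ⟨hY, le_rfl⟩ hY

theorem le_sub_of_lt_one (h : IsProfile f lam F v M α) {m y : ℝ} (hm : m ≤ M) (hy : 0 ≤ y)
    (hy1 : y < 1) (hv : -α ≤ v (m, y)) :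
    (M - m) * slope₁ v (M, y) ≤ v (M, y) - v (m, y) := by
  have hd : ∀ t ∈ Icc 0 y, HasDerivAt (fun t => (v (M, t) - v (m, t)) / slope₁ v (M, t))
      (wronskian v M m t / slope₁ v (M, t) ^ 2) t := fun t ht =>
    ((hasDerivAt_snd h.flow.contDiff M t).sub (hasDerivAt_snd h.flow.contDiff m t)).div
      (h.flow.hasDerivAt_slope₁ M t) (h.slope₁_pos t ⟨ht.1, ht.2.trans_lt hy1⟩).ne'
  have hmono : MonotoneOn (fun t => (v (M, t) - v (m, t)) / slope₁ v (M, t)) (Icc 0 y) := by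
    refine monotoneOn_of_deriv_nonneg (convex_Icc 0 y)
      (fun t ht => (hd t ht).continuousAt.continuousWithinAt)
      (fun t ht => (hd t (interior_subset ht)).differentiableAt.differentiableWithinAt)
      fun t ht => ?_
    have ht := interior_subset ht
    rw [(hd t ht).deriv]
    refine div_nonneg (h.wronskian_nonneg hm ht.1 (ht.2.trans hy1.le) ?_) (sq_nonneg _)
    exact hv.trans (h.flow.antitoneOn h.F_nonneg m ht.1 hy ht.2)
  have h2 := hmono ⟨le_rfl, hy⟩ ⟨hy, le_rfl⟩ hy
  simp only [h.flow.init, h.flow.slope₁_zero, div_one] at h2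
  rwa [le_div_iff₀ (h.slope₁_pos y ⟨hy, hy1⟩)] at h2

theorem le_sub (h : IsProfile f lam F v M α) {m y : ℝ} (hm : m ≤ M) (hy : 0 ≤ y)
    (hy1 : y ≤ 1) (hv : -α ≤ v (m, y)) :
    (M - m) * slope₁ v (M, y) ≤ v (M, y) - v (m, y) := by
  rcases hy1.lt_or_eq with h1 | rfl
  · exact h.le_sub_of_lt_one hm hy h1 hv
  · have hc : Continuous fun y => v (M, y) - v (m, y) - (M - m) * slope₁ v (M, y) := by
      refine continuous_iff_continuousAt.2 fun y => ?_
      exact ((hasDerivAt_snd h.flow.contDiff M y).continuousAt.sub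
        (hasDerivAt_snd h.flow.contDiff m y).continuousAt).sub
        ((h.flow.hasDerivAt_slope₁ M y).continuousAt.const_mul _)
    have := ge_of_tendsto (b := 0) (hc.continuousWithinAt (s := Iio 1) (x := 1)) (by
      filter_upwards [Ioo_mem_nhdsLT (zero_lt_one' ℝ)] with t ht
      have := h.le_sub_of_lt_one hm ht.1.le ht.2
        (hv.trans (h.flow.antitoneOn h.F_nonneg m ht.1.le (mem_Ici.2 zero_le_one) ht.2.le))
      linarith)
    linarith

/-- A convex function touching its tangent line to the left has vanishing second derivative. -/
theorem deriv_deriv_eq_zero (h : IsProfile f lam F v M α) {s t : ℝ} (hst : s < t)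
    (heq : f s = f t + deriv f t * (s - t)) : deriv (deriv f) t = 0 := by
  have hc : ∀ x ∈ Ioc s t, deriv f x = deriv f t := fun x hx => by
    have hm : deriv f x ≤ deriv f t :=
      h.convex.monotoneOn_deriv (fun x _ => h.differentiable_f x) (mem_univ x) (mem_univ t) hx.2
    have h1 := h.convex.tangent_le h.differentiable_f x s
    have h2 := h.convex.tangent_le h.differentiable_f t x
    have h3 : 0 < x - s := sub_pos.2 hx.1
    nlinarith
  have hd : DifferentiableAt ℝ (deriv f) t :=
    ((contDiff_infty_iff_deriv.1 h.contDiff_f).2.differentiable (by simp)) t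
  have h4 : HasDerivWithinAt (deriv f) 0 (Iic t) t := by
    refine (hasDerivWithinAt_const t (Iic t) (deriv f t)).congr_of_eventuallyEq ?_ rfl
    filter_upwards [Ioc_mem_nhdsLE hst] with x hx using hc x hx
  exact (uniqueDiffOn_Iic t t self_mem_Iic).eq_deriv _ hd.hasDerivAt.hasDerivWithinAt h4

/-- Every profile starting below the stable one is negative at the end of the interval. -/
theorem edge_neg (h : IsProfile f lam F v M α) {m : ℝ} (hm : m < M) : v (m, 1) < 0 := by
  by_contra! hv
  have hα := h.α_pos
  have hv' : -α ≤ v (m, 1) := by linarith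
  have hvy : ∀ y ∈ Icc (0 : ℝ) 1, 0 ≤ v (m, y) := fun y hy =>
    hv.trans (h.flow.antitoneOn h.F_nonneg m hy.1 (mem_Ici.2 zero_le_one) hy.2)
  have h1 := h.le_sub hm.le zero_le_one le_rfl hv'
  rw [h.top] at h1
  have hz1 := h.slope₁_nonneg zero_le_one le_rfl
  have h2 : 0 ≤ (M - m) * slope₁ v (M, 1) := mul_nonneg (sub_pos.2 hm).le hz1
  have hv1 : v (m, 1) = 0 := by linarith
  have hz1' : slope₁ v (M, 1) = 0 := by
    have : (M - m) * slope₁ v (M, 1) = 0 := by linarith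
    exact (mul_eq_zero.1 this).resolve_left (sub_pos.2 hm).ne'
  have hW1 : wronskian v M m 1 = 0 := by simp [wronskian, hz1', hv1, h.top]
  have hW : ∀ y ∈ Icc (0 : ℝ) 1, wronskian v M m y = 0 := fun y hy => by
    have hmono := h.monotoneOn_wronskian hm.le le_rfl hv'
    have h3 := hmono ⟨le_rfl, zero_le_one⟩ hy hy.1
    have h4 := hmono hy ⟨zero_le_one, le_rfl⟩ hy.2
    rw [hW1] at h4; rw [h.wronskian_zero] at h3
    exact le_antisymm h4 h3
  have hd : ∀ y ∈ Ico (0 : ℝ) 1, v (m, y) < v (M, y) := fun y hy => by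
    have h3 := h.le_sub hm.le hy.1 hy.2.le (by linarith [hvy y ⟨hy.1, hy.2.le⟩])
    have := mul_pos (sub_pos.2 hm) (h.slope₁_pos y hy)
    linarith
  have hf2 : ∀ y ∈ Ioo (0 : ℝ) 1, deriv (deriv f) (v (M, y)) = 0 := fun y hy => by
    refine h.deriv_deriv_eq_zero (hd y ⟨hy.1.le, hy.2⟩) ?_
    have h3 := h.hasDerivAt_wronskian hm.le hy.1.le hy.2.le (by linarith [hvy y ⟨hy.1.le, hy.2.le⟩])
    have h4 : HasDerivAt (wronskian v M m) 0 y :=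
      (hasDerivAt_const y 0).congr_of_eventuallyEq (by
        filter_upwards [Ioo_mem_nhds hy.1 hy.2] with t ht using hW t ⟨ht.1.le, ht.2.le⟩)
    have h5 := h3.unique h4
    have h6 := mul_pos h.lam_pos (h.slope₁_pos y ⟨hy.1.le, hy.2⟩)
    linarith [(mul_eq_zero.1 h5).resolve_left h6.ne']
  have hu : ∀ y, HasDerivAt (fun y => v (M, y)) (slope₂ v (M, y)) y :=
    hasDerivAt_snd h.flow.contDiff M
  have hvd : ∀ y, HasDerivAt (fun y => v (m, y)) (slope₂ v (m, y)) y :=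
    hasDerivAt_snd h.flow.contDiff m
  have hdf : ∀ t, HasDerivAt f (deriv f t) t := fun t => (h.differentiable_f t).hasDerivAt
  have hddf : ∀ t, HasDerivAt (deriv f) (deriv (deriv f) t) t := fun t =>
    ((contDiff_infty_iff_deriv.1 h.contDiff_f).2.differentiable (by simp) t).hasDerivAt
  have hT : ∀ y ∈ Icc (0 : ℝ) 1,
      f (v (M, y)) - deriv f (v (M, y)) * v (M, y) = f 0 := fun y hy => by
    have hTd : ∀ y, HasDerivAt (fun y => f (v (M, y)) - deriv f (v (M, y)) * v (M, y))
        (-(deriv (deriv f) (v (M, y)) * slope₂ v (M, y) * v (M, y))) y := fun y =>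
      (((hdf _).comp y (hu y)).sub (((hddf _).comp y (hu y)).mul (hu y))).congr_deriv
        (by simp only [Function.comp]; ring)
    have hT0 : ∀ x ∈ Icc (0:ℝ) 1, ∀ y ∈ Icc (0:ℝ) 1, x ≤ y →
        f (v (M, x)) - deriv f (v (M, x)) * v (M, x) =
        f (v (M, y)) - deriv f (v (M, y)) * v (M, y) := by
      intro x hx y hy hxy
      have ha : AntitoneOn (fun y => f (v (M, y)) - deriv f (v (M, y)) * v (M, y)) (Icc 0 1) :=
        antitoneOn_of_deriv_nonpos (convex_Icc 0 1)
          (fun y _ => (hTd y).continuousAt.continuousWithinAt)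
          (fun y _ => (hTd y).differentiableAt.differentiableWithinAt) (fun y hy => by
            rw [interior_Icc] at hy
            rw [(hTd y).deriv, hf2 y hy]; simp)
      have hb : MonotoneOn (fun y => f (v (M, y)) - deriv f (v (M, y)) * v (M, y)) (Icc 0 1) :=
        monotoneOn_of_deriv_nonneg (convex_Icc 0 1)
          (fun y _ => (hTd y).continuousAt.continuousWithinAt)
          (fun y _ => (hTd y).differentiableAt.differentiableWithinAt) (fun y hy => by
            rw [interior_Icc] at hy
            rw [(hTd y).deriv, hf2 y hy]; simp)
      exact le_antisymm (hb hx hy hxy) (ha hx hy hxy)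
    have := hT0 y hy 1 ⟨zero_le_one, le_rfl⟩ hy.2
    rw [this, h.top]; ring
  have hYd : ∀ y ∈ Icc (0 : ℝ) 1, HasDerivAt (fun y => slope₂ v (M, y) * (v (M, y) - v (m, y)) -
      v (M, y) * (slope₂ v (M, y) - slope₂ v (m, y)))
      (-(F (v (M, y)) * (v (M, y) - v (m, y))) +
        v (M, y) * (F (v (M, y)) - F (v (m, y)))) y := fun y _ => by
    have hF := h.contDiff_F.continuous
    refine (((h.flow.hasDerivAt_slope₂ hF M y).mul ((hu y).sub (hvd y))).sub ((hu y).mul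
      ((h.flow.hasDerivAt_slope₂ hF M y).sub (h.flow.hasDerivAt_slope₂ hF m y)))).congr_deriv ?_
    simp only [Pi.sub_apply]
    ring
  have hanti : StrictAntiOn (fun y => slope₂ v (M, y) * (v (M, y) - v (m, y)) -
      v (M, y) * (slope₂ v (M, y) - slope₂ v (m, y))) (Icc 0 1) := by
    refine strictAntiOn_of_deriv_neg (convex_Icc 0 1)
      (fun y hy => (hYd y hy).continuousAt.continuousWithinAt) fun y hy => ?_
    rw [interior_Icc] at hy
    have hy' : y ∈ Icc (0 : ℝ) 1 := Ioo_subset_Icc_self hy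
    rw [(hYd y hy').deriv]
    have hu0 := h.top_nonneg hy'.1 hy'.2
    have hv0 := hvy y hy'
    rw [h.F_eq _ ⟨by linarith, h.flow.le_init h.F_nonneg M y⟩,
      h.F_eq _ ⟨by linarith, (h.flow.le_init h.F_nonneg m y).trans hm.le⟩]
    have h3 := h.hasDerivAt_wronskian hm.le hy.1.le hy.2.le (by linarith)
    have h4 : HasDerivAt (wronskian v M m) 0 y :=
      (hasDerivAt_const y 0).congr_of_eventuallyEq (by
        filter_upwards [Ioo_mem_nhds hy.1 hy.2] with t ht using hW t ⟨ht.1.le, ht.2.le⟩)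
    have h5 := h3.unique h4
    have h6 := mul_pos h.lam_pos (h.slope₁_pos y ⟨hy.1.le, hy.2⟩)
    have h7 := (mul_eq_zero.1 h5).resolve_left h6.ne'
    have h8 : f (v (m, y)) = f (v (M, y)) + deriv f (v (M, y)) * (v (m, y) - v (M, y)) := by
      linarith
    have h9 : 0 < lam * ((v (M, y) - v (m, y)) *
        (f (v (M, y)) - deriv f (v (M, y)) * v (M, y))) := by
      rw [hT y hy']
      exact mul_pos h.lam_pos (mul_pos (sub_pos.2 (hd y ⟨hy.1.le, hy.2⟩)) (h.f_pos 0 (by linarith)))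
    rw [h8]
    linarith
  have := hanti ⟨le_rfl, zero_le_one⟩ ⟨zero_le_one, le_rfl⟩ zero_lt_one
  simp [h.flow.slope₂_zero, h.top, hv1] at this

end IsProfile

theorem exists_truncated_nonlinearity {f : ℝ → ℝ} (hf : ContDiff ℝ (⊤ : ℕ∞) f) (hmono : Monotone f)
    {lam α M : ℝ} (hlam : 0 < lam) (hα : 0 < α) (hfα : 0 < f (-(2 * α))) :
    ∃ F : ℝ → ℝ, ContDiff ℝ (⊤ : ℕ∞) F ∧ HasCompactSupport F ∧ (∀ t, 0 ≤ F t) ∧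
      ∀ t ∈ Icc (-α) M, F =ᶠ[𝓝 t] fun t => lam * f t := by
  set F : ℝ → ℝ := fun t => lam * f t *
    (Real.smoothTransition ((t + 2 * α) / (α / 2)) * Real.smoothTransition (M + 2 - t)) with hF
  have hz : ∀ t, t ∉ Icc (-(2 * α)) (M + 2) → F t = 0 := fun t ht => by
    rw [mem_Icc, not_and_or, not_le, not_le] at ht
    rcases ht with ht | ht
    · have : Real.smoothTransition ((t + 2 * α) / (α / 2)) = 0 :=
        Real.smoothTransition.zero_of_nonpos
          (div_nonpos_of_nonpos_of_nonneg (by linarith) (by linarith))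
      simp [hF, this]
    · have : Real.smoothTransition (M + 2 - t) = 0 :=
        Real.smoothTransition.zero_of_nonpos (by linarith)
      simp [hF, this]
  refine ⟨F, ?_, HasCompactSupport.intro isCompact_Icc hz, fun t => ?_, fun t ht => ?_⟩
  · exact (contDiff_const.mul hf).mul ((Real.smoothTransition.contDiff.comp
      ((contDiff_id.add contDiff_const).div_const _)).mul
      (Real.smoothTransition.contDiff.comp (contDiff_const.sub contDiff_id)))
  · by_cases ht : t ∈ Icc (-(2 * α)) (M + 2)
    · exact mul_nonneg (mul_nonneg hlam.le (hfα.le.trans (hmono ht.1)))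
        (mul_nonneg (Real.smoothTransition.nonneg _) (Real.smoothTransition.nonneg _))
    · exact (hz t ht).ge
  · filter_upwards [Ioo_mem_nhds (a := -(3 / 2 * α)) (b := M + 1) (by linarith [ht.1])
      (by linarith [ht.2])] with s hs
    rw [hF]
    simp only
    rw [Real.smoothTransition.one_of_one_le, Real.smoothTransition.one_of_one_le]
    · ring
    · linarith [hs.2]
    · rw [one_le_div (by linarith)]; linarith [hs.1]

theorem IsFlow.eq_of_solves {F : ℝ → ℝ} {v : ℝ × ℝ → ℝ} (h : IsFlow F v)
    (hF : ContDiff ℝ (⊤ : ℕ∞) F) {K : NNReal} (hK : LipschitzWith K F) {u u₁ : ℝ → ℝ} {M y₀ : ℝ}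
    {a b : ℝ} (hu : ∀ y ∈ Ioo a b, HasDerivAt u (u₁ y) y)
    (hu₁ : ∀ y ∈ Ioo a b, HasDerivAt u₁ (-F (u y)) y) (hy₀ : y₀ ∈ Ioo a b) (hM : u y₀ = M)
    (hu₀ : u₁ y₀ = 0) {y : ℝ} (hy : y ∈ Ioo a b) : u y = v (M, y - y₀) := by
  have hlip : LipschitzWith (max 1 K) fun p : ℝ × ℝ => (p.2, -F p.1) := by
    have h1 : LipschitzWith (K * 1) fun p : ℝ × ℝ => -F p.1 :=
      (hK.comp LipschitzWith.prod_fst).neg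
    simpa using LipschitzWith.prod_snd.prodMk h1
  have := ODE_solution_unique_of_mem_Ioo (v := fun _ p => (p.2, -F p.1)) (s := fun _ => univ)
    (K := max 1 K) (f := fun y => (u y, u₁ y))
    (g := fun y => (v (M, y - y₀), slope₂ v (M, y - y₀))) (fun t _ => hlip.lipschitzOnWith) hy₀
    (fun t ht => ⟨(hu t ht).prodMk (hu₁ t ht), mem_univ _⟩)
    (fun t _ => ⟨?_, mem_univ _⟩) (by simp [h.init, h.slope₂_zero, hM, hu₀]) hy
  · exact congrArg Prod.fst this
  · refine HasDerivAt.prodMk ?_ ?_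
    · exact (hasDerivAt_snd h.contDiff M (t - y₀)).comp_sub_const t y₀
    · exact (h.hasDerivAt_slope₂ hF.continuous M (t - y₀)).comp_sub_const t y₀

theorem IsFlow.zero_unique {F : ℝ → ℝ} {v : ℝ × ℝ → ℝ} (h : IsFlow F v) (hF : Continuous F)
    (hF0 : ∀ t, 0 ≤ F t) {m : ℝ} (hpos : ∀ t, 0 ≤ t → t ≤ m → 0 < F t) {a b : ℝ} (ha : 0 < a)
    (hb : 0 < b) (hva : v (m, a) = 0) (hvb : v (m, b) = 0) : a = b := by
  wlog hab : a ≤ b generalizing a b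
  · exact (this hb ha hvb hva (le_of_not_ge hab)).symm
  by_contra hne
  have hlt : a < b := lt_of_le_of_ne hab hne
  have hs : StrictAntiOn (fun y => v (m, y)) (Icc a b) := by
    refine strictAntiOn_of_deriv_neg (convex_Icc a b)
      (fun y _ => (hasDerivAt_snd h.contDiff m y).continuousAt.continuousWithinAt) fun y hy => ?_
    have hy := interior_subset hy
    rw [(hasDerivAt_snd h.contDiff m y).deriv]
    refine h.slope₂_neg hF hF0 hpos (ha.trans_le hy.1) ?_
    rw [← hvb]
    exact h.antitoneOn hF0 m (mem_Ici.2 (ha.le.trans hy.1)) (mem_Ici.2 hb.le) hy.2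
  have := hs ⟨le_rfl, hab⟩ ⟨hab, le_rfl⟩ hlt
  simp only [hva, hvb] at this
  exact lt_irrefl _ this

theorem exists_profile {f : ℝ → ℝ} (hf : ContDiff ℝ (⊤ : ℕ∞) f) (hmono : Monotone f)
    (hconv : ConvexOn ℝ Set.univ f) (hf0 : 0 < f 0) {lam : ℝ} (hlam : 0 < lam)
    {u₀ : ℝ → ℝ} (hu₀C : ContDiffOn ℝ 2 u₀ (Icc (-1) 1))
    (hu₀eq : ∀ y ∈ Ioo (-1:ℝ) 1, deriv (deriv u₀) y = -(lam * f (u₀ y)))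
    (hu₀pos : ∀ y ∈ Ioo (-1:ℝ) 1, 0 < u₀ y) (hu₀m1 : u₀ (-1) = 0) (hu₀1 : u₀ 1 = 0)
    (hu₀stable : ∀ ξ : ℝ → ℝ, ContDiff ℝ (⊤ : ℕ∞) ξ → HasCompactSupport ξ →
      tsupport ξ ⊆ Ioo (-1) 1 → ξ ≠ 0 →
      0 < (∫ y in Ioo (-1:ℝ) 1, (deriv ξ y) ^ 2)
          - lam * ∫ y in Ioo (-1:ℝ) 1, deriv f (u₀ y) * (ξ y) ^ 2) :
    ∃ F v M α, IsProfile f lam F v M α := by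
  obtain ⟨α, hα, hfα⟩ : ∃ α > 0, 0 < f (-(2 * α)) := by
    have hc : ContinuousAt (fun α => f (-(2 * α))) 0 :=
      (hf.continuous.comp (by fun_prop : Continuous fun α : ℝ => -(2 * α))).continuousAt
    have := hc.eventually_const_lt (u := 0) (by simpa using hf0)
    obtain ⟨α, h1, h2⟩ := ((this.filter_mono nhdsWithin_le_nhds).and
      (self_mem_nhdsWithin (s := Ioi 0))).exists
    exact ⟨α, h2, h1⟩
  obtain ⟨y₀, hy₀, hmax⟩ := (isCompact_Icc (a := (-1 : ℝ)) (b := 1)).exists_isMaxOn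
    ⟨0, by norm_num⟩ hu₀C.continuousOn
  have hM0 : 0 < u₀ y₀ := (hu₀pos 0 (by norm_num)).trans_le
    (hmax (by norm_num : (0:ℝ) ∈ Icc (-1) 1))
  have hy₀' : y₀ ∈ Ioo (-1 : ℝ) 1 := by
    refine ⟨lt_of_le_of_ne hy₀.1 fun h => ?_, lt_of_le_of_ne hy₀.2 fun h => ?_⟩
    · rw [← h, hu₀m1] at hM0; exact lt_irrefl _ hM0
    · rw [h, hu₀1] at hM0; exact lt_irrefl _ hM0
  set M := u₀ y₀ with hM
  obtain ⟨F, hFc, hFs, hF0, hFe⟩ := exists_truncated_nonlinearity (M := M) hf hmono hlam hα hfα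
  obtain ⟨K, hK⟩ := hFc.lipschitzWith_of_hasCompactSupport hFs (by simp)
  obtain ⟨v, hvc, hv0, hve, hvd⟩ := exists_smooth_flow hFc hK
  have hflow : IsFlow F v := ⟨hvc, hv0, hve, hvd⟩
  have hFeq : ∀ t ∈ Icc (-α) M, F t = lam * f t := fun t ht => (hFe t ht).eq_of_nhds
  have hfpos : ∀ t, -α ≤ t → 0 < f t := fun t ht => hfα.trans_le (hmono (by linarith))
  have hcA : ∀ y ∈ Ioo (-1 : ℝ) 1, ContDiffAt ℝ 2 u₀ y := fun y hy =>
    hu₀C.contDiffAt (Icc_mem_nhds hy.1 hy.2)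
  have hu1 : ∀ y ∈ Ioo (-1 : ℝ) 1, HasDerivAt u₀ (deriv u₀ y) y := fun y hy =>
    ((hcA y hy).differentiableAt (by norm_num)).hasDerivAt
  have hu2 : ∀ y ∈ Ioo (-1 : ℝ) 1, HasDerivAt (deriv u₀) (-F (u₀ y)) y := fun y hy => by
    have h1 : DifferentiableAt ℝ (deriv u₀) y :=
      (((hcA y hy).fderiv_right (m := 1) (by norm_num)).clm_apply contDiffAt_const).differentiableAt
        (by norm_num)
    rw [hFeq _ ⟨by linarith [hu₀pos y hy], hmax (Ioo_subset_Icc_self hy)⟩, ← hu₀eq y hy]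
    exact h1.hasDerivAt
  have hd0 : deriv u₀ y₀ = 0 := by
    refine IsLocalMax.deriv_eq_zero ?_
    filter_upwards [Icc_mem_nhds hy₀'.1 hy₀'.2] with y hy using hmax hy
  have hEq : EqOn u₀ (fun y => v (M, y - y₀)) (Icc (-1) 1) := by
    have h1 : EqOn u₀ (fun y => v (M, y - y₀)) (Ioo (-1) 1) := fun y hy =>
      hflow.eq_of_solves hFc hK hu1 hu2 hy₀' rfl hd0 hy
    have h2 := h1.of_subset_closure hu₀C.continuousOn
      (hvc.continuous.comp (by fun_prop : Continuous fun y : ℝ => (M, y - y₀))).continuousOn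
      Ioo_subset_Icc_self (by rw [closure_Ioo (by norm_num)])
    exact h2
  have hy00 : y₀ = 0 := by
    have h1 : v (M, 1 - y₀) = 0 := by rw [← hu₀1]; exact (hEq (by norm_num)).symm
    have h2 : v (M, 1 + y₀) = 0 := by
      rw [← hve, ← hu₀m1, show -(1 + y₀) = -1 - y₀ by ring]; exact (hEq (by norm_num)).symm
    have := hflow.zero_unique hFc.continuous hF0 (m := M) (fun t h1 h2 => by
      rw [hFeq t ⟨by linarith, h2⟩]; exact mul_pos hlam (hfpos t (by linarith)))
      (by linarith [hy₀'.2]) (by linarith [hy₀'.1]) h1 h2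
    linarith
  have hu : ∀ y ∈ Icc (-1 : ℝ) 1, v (M, y) = u₀ y := fun y hy => by
    have := hEq hy
    simp only [hy00, sub_zero] at this
    exact this.symm
  have hdF : ∀ t ∈ Icc (-α) M, deriv F t = lam * deriv f t := fun t ht => by
    rw [(hFe t ht).deriv_eq, deriv_const_mul _ ((hf.differentiable (by simp)) t)]
  have huI : ∀ y ∈ Ioo (-1 : ℝ) 1, v (M, y) ∈ Icc (-α) M := fun y hy => by
    rw [hu y (Ioo_subset_Icc_self hy)]
    exact ⟨by linarith [hu₀pos y hy], hmax (Ioo_subset_Icc_self hy)⟩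
  have hz : ContDiff ℝ (⊤ : ℕ∞) fun y => slope₁ v (M, y) :=
    (contDiff_fderiv_apply hvc ((1, 0) : ℝ × ℝ)).comp
      (contDiff_const.prodMk contDiff_id)
  refine ⟨F, v, M, α, hflow, hFc, hF0, hf, hconv, hmono, hlam, hα, hM0, hfpos, hFeq, hdF,
    (hu 1 (by norm_num)).trans hu₀1, fun y hy => ?_⟩
  refine pos_of_stable (q := fun y => deriv F (v (M, y)))
    ((hFc.continuous_deriv (by simp)).comp (hvc.continuous.comp (by fun_prop))) (fun y hy => ?_)
    (fun ξ h1 h2 h3 h4 => ?_) hz (fun y => hflow.hasDerivAt_slope₁ M y)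
    (fun y => hflow.hasDerivAt_fderiv_slope₂ hFc M y) (hflow.slope₁_zero M)
    (fun y => hflow.slope₁_neg M y) hy.1 hy.2
  · rw [hdF _ (huI y hy)]
    exact mul_nonneg hlam.le hmono.deriv_nonneg
  · have := hu₀stable ξ h1 h2 h3 h4
    rw [← integral_const_mul] at this
    convert this using 2
    refine setIntegral_congr_fun measurableSet_Ioo fun y hy => ?_
    rw [hdF _ (huI y hy), hu y (Ioo_subset_Icc_self hy), mul_assoc]

namespace IsProfile

variable {f : ℝ → ℝ} {lam : ℝ} {F : ℝ → ℝ} {v : ℝ × ℝ → ℝ} {M α : ℝ}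

theorem exists_edge (h : IsProfile f lam F v M α) {M' : ℝ} (hM' : M' < M) :
    ∃ a b : ℝ, 0 < a ∧ a ≤ α ∧ 0 < b ∧ b < 1 ∧ ∀ m ≤ M', ∀ y, b ≤ |y| → v (m, y) < -a := by
  have hvc := h.flow.contDiff.continuous
  obtain ⟨a, ha0, ha1, haα, ha⟩ : ∃ a > 0, a ≤ 1 / 2 ∧ a ≤ α ∧
      ∀ m ∈ Icc (-1) M', v (m, 1) < -a := by
    have hα := h.α_pos
    rcases (Icc (-1) M').eq_empty_or_nonempty with he | hne
    · exact ⟨min (1 / 2) α, by positivity, min_le_left _ _, min_le_right _ _, by simp [he]⟩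
    · obtain ⟨m₀, hm₀, hmax⟩ := isCompact_Icc.exists_isMaxOn hne
        (hvc.comp (by fun_prop : Continuous fun m : ℝ => (m, (1 : ℝ)))).continuousOn
      have hneg := h.edge_neg (hm₀.2.trans_lt hM')
      refine ⟨min (min (1 / 2) α) (-v (m₀, 1) / 2), by
        refine lt_min (by positivity) (by linarith), (min_le_left _ _).trans (min_le_left _ _),
        (min_le_left _ _).trans (min_le_right _ _), fun m hm => ?_⟩
      have h1 : v (m, 1) ≤ v (m₀, 1) := hmax hm
      have := min_le_right (min (1 / 2) α) (-v (m₀, 1) / 2)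
      linarith
  have hev : ∀ᶠ y in 𝓝 (1 : ℝ), ∀ m ∈ Icc (-1) M', v (m, y) < -a :=
    isCompact_Icc.eventually_forall_of_forall_eventually fun m hm =>
      (hvc.comp continuous_swap).continuousAt.eventually_lt_const (by simpa using ha m hm)
  obtain ⟨b, hb, hb0, hb1⟩ := ((hev.filter_mono nhdsWithin_le_nhds).and
    (Ioo_mem_nhdsLT (zero_lt_one' ℝ))).exists
  refine ⟨a, b, ha0, haα, hb0, hb1, fun m hm y hy => ?_⟩
  rcases lt_or_ge m (-1) with h1 | h1
  · have := h.flow.le_init h.F_nonneg m y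
    linarith
  · rw [← h.flow.apply_abs]
    exact (h.flow.antitoneOn h.F_nonneg m hb0.le (hb0.le.trans hy) hy).trans_lt (hb m ⟨h1, hm⟩)

theorem exists_barrier (h : IsProfile f lam F v M α) {M' : ℝ} (hM' : M' < M) :
    ∃ (a b r c c₀ L B : ℝ) (φ : ℝ → ℝ), 0 < a ∧ a ≤ α ∧ 0 < b ∧ b < 1 ∧ 0 < r ∧ 0 < c ∧ 0 < c₀ ∧
      0 < L ∧ ContDiff ℝ (⊤ : ℕ∞) φ ∧ (∀ y, |φ y| ≤ B) ∧ (∀ y, |deriv φ y| ≤ B) ∧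
      (∀ y, |deriv (deriv φ) y| ≤ B) ∧ (∀ y, c₀ ≤ φ y) ∧
      (∀ y, c ≤ L * φ y - deriv (deriv φ) y) ∧
      (∀ m ≤ M', ∀ y, b ≤ |y| → v (m, y) < -a) ∧
      ∀ m ≤ M', ∀ y, -a ≤ v (m, y) → ∀ t ≤ v (m, y) + r,
        lam * deriv f t * φ y + c ≤ -deriv (deriv φ) y := by
  obtain ⟨a, b, ha0, haα, hb0, hb1, hedge⟩ := h.exists_edge hM'
  set z : ℝ → ℝ := fun y => slope₁ v (M, y) with hz
  have hzc : ContDiff ℝ (⊤ : ℕ∞) z :=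
    (contDiff_fderiv_apply h.flow.contDiff ((1, 0) : ℝ × ℝ)).comp
      (contDiff_const.prodMk contDiff_id)
  have hzabs : ∀ y, z |y| = z y := fun y => by
    rcases abs_choice y with hy | hy <;> rw [hy]
    exact h.flow.slope₁_neg M y
  set b' := (1 + b) / 2 with hb'
  obtain ⟨y₁, hy₁, hmin⟩ := (isCompact_Icc (a := 0) (b := b')).exists_isMinOn
    ⟨0, le_rfl, by rw [hb']; linarith⟩ hzc.continuous.continuousOn
  set ζ := z y₁ with hζ
  have hζ0 : 0 < ζ := h.slope₁_pos y₁ ⟨hy₁.1, by linarith [hy₁.2]⟩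
  have hζle : ∀ y, |y| ≤ b' → ζ ≤ z y := fun y hy => by
    rw [← hzabs]; exact hmin ⟨abs_nonneg y, hy⟩
  set σ := ζ / 4 with hσ
  set φ₁ : ℝ → ℝ := fun y => z y - σ * (1 + y ^ 2) with hφ₁
  have hφ₁c : ContDiff ℝ (⊤ : ℕ∞) φ₁ :=
    hzc.sub (contDiff_const.mul (contDiff_const.add (contDiff_id.pow 2)))
  set ρ : ℝ → ℝ := fun y => Real.smoothTransition ((b' ^ 2 - y ^ 2) / (b' ^ 2 - b ^ 2)) with hρ
  have hρc : ContDiff ℝ (⊤ : ℕ∞) ρ := Real.smoothTransition.contDiff.comp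
    ((contDiff_const.sub (contDiff_id.pow 2)).div_const _)
  have hbb : 0 < b' ^ 2 - b ^ 2 := by
    have : b < b' := by rw [hb']; linarith
    nlinarith
  have hρ1 : ∀ y, |y| ≤ b → ρ y = 1 := fun y hy => by
    refine Real.smoothTransition.one_of_one_le ?_
    rw [one_le_div hbb]
    have : y ^ 2 ≤ b ^ 2 := by rw [← sq_abs]; exact pow_le_pow_left₀ (abs_nonneg y) hy 2
    linarith
  have hρ0 : ∀ y, b' ≤ |y| → ρ y = 0 := fun y hy => by
    refine Real.smoothTransition.zero_of_nonpos (div_nonpos_of_nonpos_of_nonneg ?_ hbb.le)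
    have : b' ^ 2 ≤ y ^ 2 := by rw [← sq_abs y]; exact pow_le_pow_left₀ (by linarith) hy 2
    linarith
  set ψ : ℝ → ℝ := fun y => (φ₁ y - 1) * ρ y with hψ
  have hψc : ContDiff ℝ (⊤ : ℕ∞) ψ := (hφ₁c.sub contDiff_const).mul hρc
  have hψs : HasCompactSupport ψ := HasCompactSupport.intro (isCompact_Icc (a := -b') (b := b'))
    fun y hy => by
      have : b' ≤ |y| := by
        by_contra! hlt
        exact hy (abs_le.1 hlt.le)
      simp [hψ, hρ0 y this]
  have hψ1c : ContDiff ℝ (⊤ : ℕ∞) (deriv ψ) := (contDiff_infty_iff_deriv.1 hψc).2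
  have hψ2c : ContDiff ℝ (⊤ : ℕ∞) (deriv (deriv ψ)) := (contDiff_infty_iff_deriv.1 hψ1c).2
  obtain ⟨B₀, hB₀⟩ := hψs.exists_bound_of_continuous hψc.continuous
  obtain ⟨B₁, hB₁⟩ := hψs.deriv.exists_bound_of_continuous hψ1c.continuous
  obtain ⟨B₂, hB₂⟩ := hψs.deriv.deriv.exists_bound_of_continuous hψ2c.continuous
  set φ : ℝ → ℝ := fun y => 1 + ψ y with hφ
  have hφ' : deriv φ = deriv ψ := by
    funext y; exact deriv_const_add 1
  set B := 1 + |B₀| + |B₁| + |B₂| with hB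
  have hB0 : 0 < B := by positivity
  have hφ₁pos : ∀ y, |y| ≤ b' → ζ / 2 ≤ φ₁ y := fun y hy => by
    have h1 := hζle y hy
    have h2 : y ^ 2 ≤ 1 := by rw [← sq_abs]; exact pow_le_one₀ (abs_nonneg y) (by linarith)
    have h3 := mul_le_mul_of_nonneg_left h2 (by linarith : 0 ≤ σ)
    simp only [hφ₁]; linarith
  set c₀ := min (ζ / 2) 1 with hc₀
  have hc₀0 : 0 < c₀ := lt_min (by linarith) one_pos
  have hφc₀ : ∀ y, c₀ ≤ φ y := fun y => by
    rcases le_total |y| b' with hy | hy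
    · have h1 : φ y = φ₁ y * ρ y + 1 * (1 - ρ y) := by simp only [hφ, hψ]; ring
      have h2 : 0 ≤ ρ y := Real.smoothTransition.nonneg _
      have h3 : 0 ≤ 1 - ρ y := sub_nonneg.2 (Real.smoothTransition.le_one _)
      rw [h1]
      have h4 := mul_le_mul_of_nonneg_right ((min_le_left _ _).trans (hφ₁pos y hy) : c₀ ≤ φ₁ y) h2
      have h5 := mul_le_mul_of_nonneg_right (min_le_right (ζ / 2) 1 : c₀ ≤ 1) h3
      linarith
    · have : φ y = 1 := by simp [hφ, hψ, hρ0 y hy]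
      rw [this]; exact min_le_right _ _
  have hφ2 : ∀ y, |deriv (deriv φ) y| ≤ B := fun y => by
    rw [hφ']
    have := hB₂ y
    rw [Real.norm_eq_abs] at this
    have := le_abs_self B₂
    rw [hB]; linarith [abs_nonneg B₀, abs_nonneg B₁]
  refine ⟨a, b, (M - M') * ζ, 2 * σ, c₀, (2 * σ + B) / c₀, B, φ, ha0, haα, hb0, hb1,
    mul_pos (sub_pos.2 hM') hζ0, by linarith, hc₀0, by positivity, contDiff_const.add hψc,
    fun y => ?_, fun y => ?_, hφ2, hφc₀, fun y => ?_, hedge, fun m hm y hv t ht => ?_⟩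
  · have h1 := hB₀ y
    rw [Real.norm_eq_abs] at h1
    have h2 := abs_add_le 1 (ψ y)
    rw [abs_one] at h2
    have := le_abs_self B₀
    rw [hB]; simp only [hφ]; linarith [abs_nonneg B₂, abs_nonneg B₁]
  · rw [hφ']
    have := hB₁ y
    rw [Real.norm_eq_abs] at this
    have := le_abs_self B₁
    rw [hB]; linarith [abs_nonneg B₀, abs_nonneg B₂]
  · have h1 := mul_le_mul_of_nonneg_left (hφc₀ y) (by positivity : 0 ≤ (2 * σ + B) / c₀)
    rw [div_mul_cancel₀ _ hc₀0.ne'] at h1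
    have := (abs_le.1 (hφ2 y)).2
    linarith
  · have hyb : |y| < b := by
      by_contra! hle
      exact absurd (hedge m hm y hle) (not_lt.2 hv)
    have hyb' : |y| ≤ b' := by rw [hb']; linarith
    have hev : ∀ y, |y| < b → φ =ᶠ[𝓝 y] φ₁ := fun y hy => by
      filter_upwards [continuous_abs.continuousAt.eventually_lt_const hy] with s hs
      simp only [hφ, hψ, hρ1 s hs.le]; ring
    have hd1 : ∀ y, HasDerivAt φ₁ (fderiv ℝ (slope₂ v) (M, y) (1, 0) - σ * (2 * y)) y := fun y =>
      ((h.flow.hasDerivAt_slope₁ M y).sub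
        ((((hasDerivAt_id y).pow 2).const_add 1).const_mul σ)).congr_deriv (by simp)
    have hd2 : HasDerivAt (fun y => fderiv ℝ (slope₂ v) (M, y) (1, 0) - σ * (2 * y))
        (-(deriv F (v (M, y)) * z y) - σ * 2) y :=
      ((h.flow.hasDerivAt_fderiv_slope₂ h.contDiff_F M y).sub
        (((hasDerivAt_id y).const_mul 2).const_mul σ)).congr_deriv (by ring)
    have hdd : deriv (deriv φ) y = -(deriv F (v (M, y)) * z y) - σ * 2 := by
      have : deriv φ =ᶠ[𝓝 y] fun y => fderiv ℝ (slope₂ v) (M, y) (1, 0) - σ * (2 * y) := by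
        filter_upwards [continuous_abs.continuousAt.eventually_lt_const hyb] with s hs
        rw [(hev s hs).deriv_eq, (hd1 s).deriv]
      rw [this.deriv_eq, hd2.deriv]
    have hα := h.α_pos
    have htop : 0 ≤ v (M, y) := by
      rw [← h.flow.apply_abs]
      exact h.top_nonneg (abs_nonneg y) (by linarith)
    have hsub : (M - m) * z y ≤ v (M, y) - v (m, y) := by
      have := h.le_sub (hm.trans hM'.le) (abs_nonneg y) (by linarith)
        (by rw [h.flow.apply_abs]; linarith)
      rwa [h.flow.apply_abs, h.flow.apply_abs, show slope₁ v (M, |y|) = z y from hzabs y] at this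
    have htu : t ≤ v (M, y) := by
      have h1 := hζle y hyb'
      have h2 : (M - M') * ζ ≤ (M - m) * z y :=
        mul_le_mul (by linarith) h1 hζ0.le (by linarith)
      linarith
    have hq : lam * deriv f t ≤ deriv F (v (M, y)) := by
      rw [h.deriv_F_eq _ ⟨by linarith, h.flow.le_init h.F_nonneg M y⟩]
      exact mul_le_mul_of_nonneg_left (h.convex.monotoneOn_deriv
        (fun x _ => h.differentiable_f x) (mem_univ t) (mem_univ _) htu) h.lam_pos.le
    have hq0 : 0 ≤ lam * deriv f t := mul_nonneg h.lam_pos.le h.mono.deriv_nonneg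
    rw [hdd, (hev y hyb).eq_of_nhds]
    have h1 := hφ₁pos y hyb'
    have h2 : φ₁ y ≤ z y := by
      have : 0 ≤ σ * (1 + y ^ 2) := by positivity
      simp only [hφ₁]; linarith
    have h3 : lam * deriv f t * φ₁ y ≤ deriv F (v (M, y)) * z y :=
      mul_le_mul hq h2 (by linarith) (hq0.trans hq)
    linarith

end IsProfile

section Averaging

variable {E V : Type*} [NormedAddCommGroup E] [NormedSpace ℝ E] [MeasurableSpace E]
  [NormedAddCommGroup V] [NormedSpace ℝ V]

/-- The average of `g` over dilations and translations, with weight `W`. -/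
def dilAvg (μ : Measure (ℝ × E)) (W : ℝ × E → V) (g : E → ℝ) (p : E) : V :=
  ∫ a, g (p + a.1 • a.2) • W a ∂μ

variable {μ : Measure (ℝ × E)} {W : ℝ × E → V} {g : E → ℝ}

theorem norm_dilAvg_le (hW : Integrable W μ) {M : ℝ} (hM : ∀ p, |g p| ≤ M) (p : E) :
    ‖dilAvg μ W g p‖ ≤ M * ∫ a, ‖W a‖ ∂μ := by
  rw [← integral_const_mul]
  refine norm_integral_le_of_norm_le (hW.norm.const_mul M) (ae_of_all _ fun a => ?_)
  rw [norm_smul]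
  exact mul_le_mul_of_nonneg_right (hM _) (norm_nonneg _)

theorem dilAvg_const_mul (c : ℝ) (p : E) :
    dilAvg μ W (fun p => c * g p) p = c • dilAvg μ W g p := by
  simp_rw [dilAvg, mul_smul, integral_smul]

variable [BorelSpace E] [FiniteDimensional ℝ E]

theorem integrable_dilAvg (hW : Integrable W μ) (hg : Continuous g) {M : ℝ}
    (hM : ∀ p, |g p| ≤ M) (p : E) : Integrable (fun a => g (p + a.1 • a.2) • W a) μ :=
  hW.bdd_smul M (φ := fun a => g (p + a.1 • a.2))
    (by fun_prop : Continuous fun a : ℝ × E => g (p + a.1 • a.2)).aestronglyMeasurable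
    (ae_of_all _ fun a => hM _)

theorem dilAvg_sub (hW : Integrable W μ) (hg : Continuous g) {M : ℝ} (hM : ∀ p, |g p| ≤ M)
    {h : E → ℝ} (hh : Continuous h) {M' : ℝ} (hM' : ∀ p, |h p| ≤ M') (p : E) :
    dilAvg μ W (fun p => g p - h p) p = dilAvg μ W g p - dilAvg μ W h p := by
  rw [dilAvg, dilAvg, dilAvg, ← integral_sub (integrable_dilAvg hW hg hM p)
    (integrable_dilAvg hW hh hM' p)]
  simp_rw [sub_smul]

theorem continuous_dilAvg (hW : Integrable W μ) (hg : Continuous g) {M : ℝ}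
    (hM : ∀ p, |g p| ≤ M) : Continuous (dilAvg μ W g) := by
  refine continuous_of_dominated (bound := fun a => M * ‖W a‖)
    (fun p => (integrable_dilAvg hW hg hM p).aestronglyMeasurable)
    (fun p => ae_of_all _ fun a => ?_) (hW.norm.const_mul M) (ae_of_all _ fun a => ?_)
  · rw [norm_smul]
    exact mul_le_mul_of_nonneg_right (hM _) (norm_nonneg _)
  · fun_prop

theorem differentiableAt_dilAvg (hW : Integrable W μ) (hg : ContDiff ℝ 1 g) {M : ℝ}
    (hM : ∀ p, |g p| ≤ M) (hM' : ∀ p, ‖fderiv ℝ g p‖ ≤ M) (p : E) :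
    DifferentiableAt ℝ (dilAvg μ W g) p ∧
      ∀ v, fderiv ℝ (dilAvg μ W g) p v = dilAvg μ W (fun q => fderiv ℝ g q v) p := by
  have hc := hg.continuous_fderiv (by norm_num)
  have hb : ∀ p : E, ∀ a : ℝ × E, ‖(fderiv ℝ g (p + a.1 • a.2)).smulRight (W a)‖ ≤ M * ‖W a‖ := by
    intro p a
    rw [ContinuousLinearMap.norm_smulRight_apply]
    exact mul_le_mul_of_nonneg_right (hM' _) (norm_nonneg _)
  have hm : AEStronglyMeasurable (fun a => (fderiv ℝ g (p + a.1 • a.2)).smulRight (W a)) μ :=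
    (ContinuousLinearMap.smulRightL ℝ E V).aestronglyMeasurable_comp₂
      (by fun_prop : Continuous fun a : ℝ × E => fderiv ℝ g (p + a.1 • a.2)).aestronglyMeasurable
      hW.aestronglyMeasurable
  have h := hasFDerivAt_integral_of_dominated_of_fderiv_le (μ := μ)
    (F := fun p a => g (p + a.1 • a.2) • W a)
    (F' := fun p a => (fderiv ℝ g (p + a.1 • a.2)).smulRight (W a)) (x₀ := p) (s := univ)
    (bound := fun a => M * ‖W a‖) univ_mem
    (Eventually.of_forall fun p => (integrable_dilAvg hW hg.continuous hM p).aestronglyMeasurable)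
    (integrable_dilAvg hW hg.continuous hM p) hm (ae_of_all _ fun a p _ => hb p a)
    (hW.norm.const_mul M) (ae_of_all _ fun a p _ =>
      (((hg.differentiable (by norm_num) (p + a.1 • a.2)).hasFDerivAt.comp p
        ((hasFDerivAt_id p).add_const (a.1 • a.2))).smul_const (W a)))
  refine ⟨h.differentiableAt, fun v => ?_⟩
  have hi : Integrable (fun a => (fderiv ℝ g (p + a.1 • a.2)).smulRight (W a)) μ :=
    (hW.norm.const_mul M).mono' hm (ae_of_all _ (hb p))
  have h' : HasFDerivAt (dilAvg μ W g) _ p := h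
  rw [h'.fderiv, ContinuousLinearMap.integral_apply hi]
  rfl

theorem contDiff_dilAvg (hW : Integrable W μ) (n : ℕ) : ∀ {g : E → ℝ}, ContDiff ℝ n g →
    HasCompactSupport g → ContDiff ℝ n (dilAvg μ W g) := by
  induction n with
  | zero =>
    intro g hg hc
    have hg' := hg.continuous
    obtain ⟨M, hM⟩ := hc.exists_bound_of_continuous hg'
    exact contDiff_zero.2 (continuous_dilAvg hW hg' hM)
  | succ n ih =>
    intro g hg hc
    have hg1 : ContDiff ℝ 1 g := hg.of_le (by push_cast; exact le_add_self)
    obtain ⟨M, hM⟩ := hc.exists_bound_of_continuous hg1.continuous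
    obtain ⟨M', hM'⟩ := (hc.fderiv ℝ).exists_bound_of_continuous
      (hg1.continuous_fderiv (by norm_num))
    have hd := differentiableAt_dilAvg hW hg1 (M := max M M')
      (fun p => (hM p).trans (le_max_left _ _))
      fun p => (hM' p).trans (le_max_right _ _)
    push_cast at hg ⊢
    rw [contDiff_succ_iff_fderiv_apply] at hg ⊢
    refine ⟨fun p => (hd p).1, by simp, fun v => ?_⟩
    rw [funext fun p => (hd p).2 v]
    exact ih (hg.2.2 v) (hc.fderiv_apply ℝ v)

end Averaging

section Domain

variable {N : ℕ}

/-- The squared Euclidean norm on `ℝ^{N+1}`. -/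
def sqSum (z : Pt N) : ℝ := (∑ j, z.1 j ^ 2) + z.2 ^ 2

/-- The Euclidean inner product with `z`, as a linear functional. -/
def innerFunctional (z : Pt N) : Pt N →L[ℝ] ℝ :=
  (∑ j, z.1 j • (ContinuousLinearMap.proj (R := ℝ) (φ := fun _ : Fin N => ℝ) j).comp
    (ContinuousLinearMap.fst ℝ (Fin N → ℝ) ℝ)) + z.2 • ContinuousLinearMap.snd ℝ (Fin N → ℝ) ℝ

theorem innerFunctional_apply (z v : Pt N) :
    innerFunctional z v = (∑ j, z.1 j * v.1 j) + z.2 * v.2 := by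
  simp [innerFunctional]

theorem continuous_innerFunctional : Continuous (innerFunctional (N := N)) := by
  unfold innerFunctional
  fun_prop

theorem norm_innerFunctional_le (z : Pt N) : ‖innerFunctional z‖ ≤ (N + 1) * ‖z‖ := by
  refine ContinuousLinearMap.opNorm_le_bound _ (by positivity) fun v => ?_
  rw [innerFunctional_apply]
  have h1 : ∀ j, ‖z.1 j * v.1 j‖ ≤ ‖z‖ * ‖v‖ := fun j => by
    rw [norm_mul]
    exact mul_le_mul ((norm_le_pi_norm _ _).trans (norm_fst_le z))
      ((norm_le_pi_norm _ _).trans (norm_fst_le v)) (norm_nonneg _) (norm_nonneg _)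
  have h2 : ‖z.2 * v.2‖ ≤ ‖z‖ * ‖v‖ := by
    rw [norm_mul]
    exact mul_le_mul (norm_snd_le z) (norm_snd_le v) (norm_nonneg _) (norm_nonneg _)
  calc _ ≤ ‖∑ j, z.1 j * v.1 j‖ + ‖z.2 * v.2‖ := norm_add_le _ _
    _ ≤ (∑ j : Fin N, ‖z‖ * ‖v‖) + ‖z‖ * ‖v‖ :=
      add_le_add (norm_sum_le_of_le _ fun j _ => h1 j) h2
    _ = (N + 1) * ‖z‖ * ‖v‖ := by simp; ring

theorem sq_norm_le_sqSum (z : Pt N) : ‖z‖ ^ 2 ≤ sqSum z := by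
  have h0 : ∀ j, z.1 j ^ 2 ≤ ∑ j, z.1 j ^ 2 := fun j =>
    Finset.single_le_sum (f := fun j => z.1 j ^ 2) (fun i _ => sq_nonneg _) (Finset.mem_univ j)
  have hs : 0 ≤ sqSum z := by unfold sqSum; positivity
  refine (Real.le_sqrt (norm_nonneg z) hs).1 ?_
  rw [Prod.norm_def, max_le_iff, pi_norm_le_iff_of_nonneg (Real.sqrt_nonneg _)]
  refine ⟨fun j => Real.abs_le_sqrt ?_, Real.abs_le_sqrt ?_⟩
  · have := h0 j
    have := sq_nonneg z.2
    unfold sqSum; linarith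
  · have : 0 ≤ ∑ j, z.1 j ^ 2 := by positivity
    unfold sqSum; linarith

theorem integrable_exp_sqSum {b : ℝ} (hb : 0 < b) :
    Integrable fun z : Pt N => Real.exp (-b * sqSum z) := by
  have h := (Integrable.fintype_prod (μ := fun _ : Fin N => (volume : Measure ℝ))
    (f := fun _ x => Real.exp (-b * x ^ 2)) fun _ => integrable_exp_neg_mul_sq hb).mul_prod
    (integrable_exp_neg_mul_sq hb)
  refine h.congr (ae_of_all _ fun z => ?_)
  simp only [sqSum, mul_add, Real.exp_add, Finset.mul_sum, Real.exp_sum]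

theorem contDiff_sqSum : ContDiff ℝ (⊤ : ℕ∞) (sqSum (N := N)) := by
  unfold sqSum
  fun_prop

theorem hasFDerivAt_sqSum (z : Pt N) : HasFDerivAt sqSum ((2 : ℝ) • innerFunctional z) z := by
  have h : HasFDerivAt (sqSum (N := N)) _ z :=
    ((contDiff_sqSum.differentiable (by simp)) z).hasFDerivAt
  have h1 : ∀ j : Fin N, HasFDerivAt (fun z : Pt N => z.1 j ^ 2) ((2 * z.1 j) •
      (ContinuousLinearMap.proj (R := ℝ) (φ := fun _ : Fin N => ℝ) j).comp
        (ContinuousLinearMap.fst ℝ (Fin N → ℝ) ℝ)) z := fun j => by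
    have := ((ContinuousLinearMap.proj (R := ℝ) (φ := fun _ : Fin N => ℝ) j).comp
        (ContinuousLinearMap.fst ℝ (Fin N → ℝ) ℝ)).hasFDerivAt.pow 2 (x := z)
    simpa using this
  have h2 : HasFDerivAt (fun z : Pt N => z.2 ^ 2) ((2 * z.2) •
      (ContinuousLinearMap.snd ℝ (Fin N → ℝ) ℝ)) z := by
    have := (ContinuousLinearMap.snd ℝ (Fin N → ℝ) ℝ).hasFDerivAt.pow 2 (x := z)
    simpa using this
  refine ((HasFDerivAt.fun_sum fun j (_ : j ∈ Finset.univ) => h1 j).add h2).congr_fderiv ?_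
  simp [innerFunctional, Finset.smul_sum, smul_smul]

/-- The standard Gaussian density on `ℝ^{N+1}`. -/
def gauss (z : Pt N) : ℝ :=
  Real.exp (-(1 / 2) * sqSum z) / ∫ z : Pt N, Real.exp (-(1 / 2) * sqSum z)

theorem integral_exp_sqSum_pos : 0 < ∫ z : Pt N, Real.exp (-(1 / 2) * sqSum z) :=
  integral_exp_pos (integrable_exp_sqSum (by norm_num))

theorem gauss_pos (z : Pt N) : 0 < gauss z := div_pos (Real.exp_pos _) integral_exp_sqSum_pos

theorem integrable_gauss : Integrable (gauss (N := N)) :=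
  (integrable_exp_sqSum (by norm_num)).div_const _

theorem integral_gauss : ∫ z : Pt N, gauss z = 1 := by
  unfold gauss
  rw [integral_div, div_self integral_exp_sqSum_pos.ne']

theorem contDiff_gauss : ContDiff ℝ (⊤ : ℕ∞) (gauss (N := N)) := by
  have := contDiff_sqSum (N := N)
  unfold gauss
  fun_prop

theorem hasFDerivAt_gauss (z : Pt N) :
    HasFDerivAt gauss (-(gauss z • innerFunctional z)) z := by
  have h := ((hasFDerivAt_sqSum z).const_mul (-(1 / 2))).exp.mul_const
    (∫ z : Pt N, Real.exp (-(1 / 2) * sqSum z))⁻¹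
  refine h.congr_fderiv ?_
  rw [gauss, div_eq_mul_inv]
  ext <;> simp <;> ring

theorem integrable_norm_mul_gauss : Integrable fun z : Pt N => ‖z‖ * gauss z := by
  have h := ((integrable_exp_sqSum (N := N) (b := 1 / 4) (by norm_num)).const_mul 2).div_const
    (∫ z : Pt N, Real.exp (-(1 / 2) * sqSum z))
  refine h.mono' (continuous_norm.mul contDiff_gauss.continuous).aestronglyMeasurable
    (ae_of_all _ fun z => ?_)
  rw [Real.norm_of_nonneg (mul_nonneg (norm_nonneg _) (gauss_pos z).le), gauss, ← mul_div_assoc]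
  refine div_le_div_of_nonneg_right ?_ integral_exp_sqSum_pos.le
  have h1 := sq_norm_le_sqSum z
  have h2 : Real.exp (-(1 / 2) * sqSum z) =
      Real.exp (-(1 / 4) * sqSum z) * Real.exp (-(1 / 4) * sqSum z) := by
    rw [← Real.exp_add]; ring_nf
  have h3 : ‖z‖ * Real.exp (-(1 / 4) * sqSum z) ≤ 2 := by
    rw [neg_mul, Real.exp_neg, ← div_eq_mul_inv, div_le_iff₀ (Real.exp_pos _)]
    have := Real.add_one_le_exp (1 / 4 * sqSum z)
    nlinarith [sq_nonneg (‖z‖ - 2)]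
  rw [h2, ← mul_assoc]
  exact mul_le_mul_of_nonneg_right h3 (Real.exp_pos _).le

theorem integrable_gauss_smul_innerFunctional :
    Integrable fun z : Pt N => gauss z • innerFunctional z := by
  refine (integrable_norm_mul_gauss.const_mul (N + 1 : ℝ)).mono'
    (contDiff_gauss.continuous.smul continuous_innerFunctional).aestronglyMeasurable
    (ae_of_all _ fun z => ?_)
  rw [norm_smul, Real.norm_of_nonneg (gauss_pos z).le]
  have := mul_le_mul_of_nonneg_left (norm_innerFunctional_le z) (gauss_pos z).le
  linarith

/-- The product of Lebesgue measure on `(0,∞)` and on `ℝ^{N+1}`. -/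
def halfMeasure (N : ℕ) : Measure (ℝ × Pt N) :=
  (volume.restrict (Ioi (0 : ℝ))).prod (volume : Measure (Pt N))

/-- The weight defining the resolvent `(L - Δ)⁻¹` as a dilation average. -/
def resolventKernel (L : ℝ) (a : ℝ × Pt N) : ℝ := a.1 * Real.exp (-(L / 2) * a.1 ^ 2) * gauss a.2

/-- The weight defining the gradient of the resolvent. -/
def gradKernel (L : ℝ) (a : ℝ × Pt N) : Pt N →L[ℝ] ℝ :=
  Real.exp (-(L / 2) * a.1 ^ 2) • gauss a.2 • innerFunctional a.2

theorem integrable_resolventKernel {L : ℝ} (hL : 0 < L) :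
    Integrable (resolventKernel L) (halfMeasure N) :=
  Integrable.mul_prod (integrable_mul_exp_neg_mul_sq (by positivity)).integrableOn integrable_gauss

theorem integrable_gradKernel {L : ℝ} (hL : 0 < L) :
    Integrable (gradKernel L) (halfMeasure N) :=
  Integrable.smul_prod (integrable_exp_neg_mul_sq (b := L / 2) (by positivity)).integrableOn
    integrable_gauss_smul_innerFunctional

/-- The resolvent `(L - Δ)⁻¹`. -/
def heatResolvent (L : ℝ) (g : Pt N → ℝ) : Pt N → ℝ := dilAvg (halfMeasure N) (resolventKernel L) g

/-- The gradient of the resolvent `(L - Δ)⁻¹`. -/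
def gradResolvent (L : ℝ) (g : Pt N → ℝ) : Pt N → Pt N →L[ℝ] ℝ :=
  dilAvg (halfMeasure N) (gradKernel L) g

instance isAddHaarMeasure_volume_pt : (volume : Measure (Pt N)).IsAddHaarMeasure :=
  inferInstanceAs (((volume : Measure (Fin N → ℝ)).prod (volume : Measure ℝ)).IsAddHaarMeasure)

theorem continuous_fderiv_apply_of_contDiff {g : Pt N → ℝ} (hg : ContDiff ℝ 1 g) (v : Pt N) :
    Continuous fun q => fderiv ℝ g q v :=
  (hg.continuous_fderiv (by norm_num)).clm_apply continuous_const

theorem abs_fderiv_apply_le {g : Pt N → ℝ} {M : ℝ} (hM' : ∀ p, ‖fderiv ℝ g p‖ ≤ M) (v p : Pt N) :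
    |fderiv ℝ g p v| ≤ M * ‖v‖ :=
  ((fderiv ℝ g p).le_opNorm v).trans (mul_le_mul_of_nonneg_right (hM' p) (norm_nonneg _))

theorem gradResolvent_apply {L : ℝ} (hL : 0 < L) {g : Pt N → ℝ} (hg : Continuous g) {M : ℝ}
    (hM : ∀ p, |g p| ≤ M) (p v : Pt N) :
    gradResolvent L g p v = ∫ a, g (p + a.1 • a.2) * (gradKernel L a v) ∂(halfMeasure N) := by
  rw [gradResolvent, dilAvg,
    ContinuousLinearMap.integral_apply (integrable_dilAvg (integrable_gradKernel hL) hg hM p)]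
  rfl

theorem resolvent_fderiv {L : ℝ} (hL : 0 < L) {g : Pt N → ℝ} (hg : ContDiff ℝ 1 g) {M : ℝ}
    (hM : ∀ p, |g p| ≤ M) (hM' : ∀ p, ‖fderiv ℝ g p‖ ≤ M) (p v : Pt N) :
    heatResolvent L (fun q => fderiv ℝ g q v) p = gradResolvent L g p v := by
  have hdc := continuous_fderiv_apply_of_contDiff hg v
  have i1 := integrable_dilAvg (integrable_resolventKernel (N := N) hL) hdc
    (abs_fderiv_apply_le hM' v) p
  have i2 : Integrable (fun a : ℝ × Pt N => g (p + a.1 • a.2) * gradKernel L a v) (halfMeasure N) :=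
    (integrable_dilAvg (integrable_gradKernel hL) hg.continuous hM p).apply_continuousLinearMap v
  rw [gradResolvent_apply hL hg.continuous hM, heatResolvent, dilAvg]
  rw [halfMeasure] at i1 i2 ⊢
  rw [integral_prod _ i1, integral_prod _ i2]
  refine integral_congr_ae (ae_of_all _ fun s => ?_)
  have hd : ∀ z, HasFDerivAt (fun z : Pt N => g (p + s • z))
      (s • fderiv ℝ g (p + s • z)) z := fun z => by
    have := (hg.differentiable (by norm_num) (p + s • z)).hasFDerivAt.comp z
      (((hasFDerivAt_id z).const_smul s).const_add p)
    refine this.congr_fderiv ?_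
    ext <;> simp
  have hd' : ∀ z, fderiv ℝ (fun z : Pt N => g (p + s • z)) z v = s * fderiv ℝ g (p + s • z) v :=
    fun z => by rw [(hd z).fderiv]; rfl
  have hg' : ∀ z : Pt N, fderiv ℝ gauss z v = -(gauss z * innerFunctional z v) := fun z => by
    rw [(hasFDerivAt_gauss z).fderiv]; rfl
  have c1 : Continuous fun z : Pt N => g (p + s • z) := hg.continuous.comp (by fun_prop)
  have c2 : Continuous fun z : Pt N => s * fderiv ℝ g (p + s • z) v :=
    continuous_const.mul (hdc.comp (by fun_prop))
  have ibp := integral_mul_fderiv_eq_neg_fderiv_mul_of_integrable (μ := (volume : Measure (Pt N)))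
    (f := gauss) (g := fun z => g (p + s • z)) (v := v) ?_ ?_ ?_
    (fun z _ => (hasFDerivAt_gauss z).differentiableAt) (fun z _ => (hd z).differentiableAt)
  · simp only [hd', hg'] at ibp
    calc _ = Real.exp (-(L / 2) * s ^ 2) *
          ∫ z, gauss z * (s * fderiv ℝ g (p + s • z) v) := by
          rw [← integral_const_mul]
          refine integral_congr_ae (ae_of_all _ fun z => ?_)
          simp only [resolventKernel, smul_eq_mul]
          ring
      _ = _ := by
          rw [ibp, ← integral_neg, ← integral_const_mul]
          refine integral_congr_ae (ae_of_all _ fun z => ?_)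
          simp only [gradKernel, smul_apply, smul_eq_mul]
          ring
  · simp only [hg']
    exact (integrable_gauss_smul_innerFunctional.apply_continuousLinearMap v).neg.mul_bdd (c := M)
      c1.aestronglyMeasurable (ae_of_all _ fun z => hM _)
  · simp only [hd']
    refine integrable_gauss.mul_bdd (c := |s| * (M * ‖v‖)) c2.aestronglyMeasurable
      (ae_of_all _ fun z => ?_)
    rw [norm_mul]
    exact mul_le_mul_of_nonneg_left (abs_fderiv_apply_le hM' v _) (norm_nonneg _)
  · exact integrable_gauss.mul_bdd (c := M) c1.aestronglyMeasurable (ae_of_all _ fun z => hM _)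

/-- The coordinate trace `∑ᵥ T v v` of a family of linear functionals. -/
def coordTrace (T : Pt N → Pt N →L[ℝ] ℝ) : ℝ :=
  (∑ j : Fin N, T (Pi.single j 1, 0) (Pi.single j 1, 0)) + T (0, 1) (0, 1)

theorem sum_innerFunctional_mul (T : Pt N →L[ℝ] ℝ) (z : Pt N) :
    (∑ j : Fin N, T (Pi.single j 1, 0) * innerFunctional z (Pi.single j 1, 0)) +
      T (0, 1) * innerFunctional z (0, 1) = T z := by
  have hz : z = (∑ j : Fin N, z.1 j • ((Pi.single j 1, 0) : Pt N)) + z.2 • ((0, 1) : Pt N) := by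
    ext j
    · simp [Prod.fst_sum, Finset.sum_apply, Pi.single_apply]
    · simp [Prod.snd_sum]
  conv_rhs => rw [hz]
  rw [map_add, map_sum, map_smul]
  congr 1
  · refine Finset.sum_congr rfl fun j _ => ?_
    rw [map_smul, innerFunctional_apply]
    simp [Pi.single_apply, mul_comm]
  · rw [innerFunctional_apply]; simp [mul_comm]

theorem coordTrace_gradResolvent {L : ℝ} (hL : 0 < L) {g : Pt N → ℝ} (hg : ContDiff ℝ 1 g) {M : ℝ}
    (hM : ∀ p, |g p| ≤ M) (hM' : ∀ p, ‖fderiv ℝ g p‖ ≤ M) (p : Pt N) :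
    coordTrace (fun v => gradResolvent L (fun q => fderiv ℝ g q v) p) =
      L * heatResolvent L g p - g p := by
  have hdc := continuous_fderiv_apply_of_contDiff hg
  have i1 := (integrable_dilAvg (integrable_resolventKernel (N := N) hL)
    hg.continuous hM p).const_mul L
  have i2 : ∀ v : Pt N, Integrable (fun a : ℝ × Pt N => fderiv ℝ g (p + a.1 • a.2) v *
      gradKernel L a v) (halfMeasure N) := fun v =>
    (integrable_dilAvg (integrable_gradKernel hL) (hdc v)
      (abs_fderiv_apply_le hM' v) p).apply_continuousLinearMap v
  have e1 : ∀ a : ℝ × Pt N, (∑ j : Fin N, fderiv ℝ g (p + a.1 • a.2) (Pi.single j 1, 0) *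
      gradKernel L a (Pi.single j 1, 0)) + fderiv ℝ g (p + a.1 • a.2) (0, 1) *
      gradKernel L a (0, 1) = Real.exp (-(L / 2) * a.1 ^ 2) * gauss a.2 *
        fderiv ℝ g (p + a.1 • a.2) a.2 := fun a => by
    rw [← sum_innerFunctional_mul _ a.2, mul_add, Finset.mul_sum]
    simp only [gradKernel, smul_apply, smul_eq_mul]
    congr 1
    · exact Finset.sum_congr rfl fun j _ => by ring
    · ring
  have i3 : Integrable (fun a : ℝ × Pt N => Real.exp (-(L / 2) * a.1 ^ 2) * gauss a.2 *
        fderiv ℝ g (p + a.1 • a.2) a.2) (halfMeasure N) := by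
    simp_rw [← e1]
    exact (integrable_finsetSum _ fun j _ => i2 _).add (i2 _)
  have i4 : Integrable (fun a : ℝ × Pt N => Real.exp (-(L / 2) * a.1 ^ 2) * gauss a.2 *
      fderiv ℝ g (p + a.1 • a.2) a.2 - L * (g (p + a.1 • a.2) • resolventKernel L a))
      (halfMeasure N) := i3.sub i1
  have key : ∫ a, (Real.exp (-(L / 2) * a.1 ^ 2) * gauss a.2 * fderiv ℝ g (p + a.1 • a.2) a.2 -
      L * (g (p + a.1 • a.2) • resolventKernel L a)) ∂(halfMeasure N) = -g p := by
    rw [halfMeasure] at i4 ⊢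
    rw [integral_prod_symm _ i4]
    have hz : ∀ᵐ z : Pt N, ∫ s in Ioi (0 : ℝ), (Real.exp (-(L / 2) * s ^ 2) * gauss z *
        fderiv ℝ g (p + s • z) z - L * (g (p + s • z) • resolventKernel L (s, z))) =
        -g p * gauss z := by
      filter_upwards [i4.prod_left_ae] with z hz
      have hexp : ∀ s : ℝ, HasDerivAt (fun s => Real.exp (-(L / 2) * s ^ 2))
          (-(L * s) * Real.exp (-(L / 2) * s ^ 2)) s := fun s => by
        refine (((hasDerivAt_pow 2 s).const_mul (-(L / 2))).exp).congr_deriv ?_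
        simp; ring
      have hgs : ∀ s : ℝ, HasDerivAt (fun s : ℝ => g (p + s • z)) (fderiv ℝ g (p + s • z) z) s :=
        fun s => by
          have := (hg.differentiable (by norm_num) (p + s • z)).hasFDerivAt.comp_hasDerivAt s
            (((hasDerivAt_id s).smul_const z).const_add p)
          exact this.congr_deriv (by simp)
      have hd : ∀ s : ℝ, HasDerivAt
          (fun s => gauss z * (Real.exp (-(L / 2) * s ^ 2) * g (p + s • z)))
          (Real.exp (-(L / 2) * s ^ 2) * gauss z *
            fderiv ℝ g (p + s • z) z - L * (g (p + s • z) • resolventKernel L (s, z))) s :=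
        fun s => by
        refine (((hexp s).mul (hgs s)).const_mul (gauss z)).congr_deriv ?_
        simp only [resolventKernel, smul_eq_mul]
        ring
      have hlim : Tendsto (fun s => gauss z * (Real.exp (-(L / 2) * s ^ 2) * g (p + s • z))) atTop
          (𝓝 0) := by
        have h1 : Tendsto (fun s : ℝ => Real.exp (-(L / 2) * s ^ 2)) atTop (𝓝 0) :=
          Real.tendsto_exp_atBot.comp
            ((tendsto_pow_atTop two_ne_zero).const_mul_atTop_of_neg (by linarith))
        have h2 := (h1.zero_mul_isBoundedUnder_le (g := fun s : ℝ => g (p + s • z))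
          (isBoundedUnder_of ⟨M, fun s => hM _⟩)).const_mul (gauss z)
        simpa using h2
      rw [integral_Ioi_of_hasDerivAt_of_tendsto (hd 0).continuousAt.continuousWithinAt
        (fun s _ => hd s) hz hlim]
      simp; ring
    refine (integral_congr_ae hz).trans ?_
    rw [integral_const_mul, integral_gauss, mul_one]
  rw [integral_sub i3 i1, integral_const_mul] at key
  have e2 : coordTrace (fun v => gradResolvent L (fun q => fderiv ℝ g q v) p) =
      ∫ a, Real.exp (-(L / 2) * a.1 ^ 2) * gauss a.2 * fderiv ℝ g (p + a.1 • a.2) a.2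
        ∂(halfMeasure N) := by
    simp_rw [coordTrace, gradResolvent_apply hL (hdc _) (abs_fderiv_apply_le hM' _), ← e1]
    rw [integral_add (integrable_finsetSum _ fun j _ => i2 _) (i2 _),
      integral_finsetSum _ fun j _ => i2 _]
  rw [e2, heatResolvent, dilAvg]
  linarith

theorem resolventKernel_nonneg_ae (L : ℝ) : ∀ᵐ a ∂(halfMeasure N), 0 ≤ resolventKernel L a := by
  have h : halfMeasure N = (volume.prod volume).restrict (Ioi (0 : ℝ) ×ˢ univ) := by
    rw [halfMeasure, ← Measure.prod_restrict, Measure.restrict_univ]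
  rw [h]
  filter_upwards [ae_restrict_mem (measurableSet_Ioi.prod .univ)] with a ha
  have := gauss_pos a.2
  have : 0 < a.1 := ha.1
  unfold resolventKernel
  positivity

theorem abs_heatResolvent_le {L : ℝ} (hL : 0 < L) {g h : Pt N → ℝ} (hh : Continuous h) {M : ℝ}
    (hM : ∀ p, |h p| ≤ M) (hgh : ∀ p, |g p| ≤ h p) (p : Pt N) :
    |heatResolvent L g p| ≤ heatResolvent L h p := by
  rw [← Real.norm_eq_abs, heatResolvent, dilAvg]
  refine norm_integral_le_of_norm_le (integrable_dilAvg (integrable_resolventKernel hL) hh hM p) ?_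
  filter_upwards [resolventKernel_nonneg_ae L] with a ha
  rw [smul_eq_mul, smul_eq_mul, norm_mul, Real.norm_of_nonneg ha]
  exact mul_le_mul_of_nonneg_right (hgh _) ha

theorem hasFDerivAt_heatResolvent {L : ℝ} (hL : 0 < L) {g : Pt N → ℝ} (hg : ContDiff ℝ 1 g) {M : ℝ}
    (hM : ∀ p, |g p| ≤ M) (hM' : ∀ p, ‖fderiv ℝ g p‖ ≤ M) (p : Pt N) :
    HasFDerivAt (heatResolvent L g) (gradResolvent L g p) p := by
  have h := differentiableAt_dilAvg (integrable_resolventKernel hL) hg hM hM' p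
  refine h.1.hasFDerivAt.congr_fderiv (ContinuousLinearMap.ext fun v => ?_)
  rw [h.2 v]
  exact resolvent_fderiv hL hg hM hM' p v

theorem heatResolvent_comp_snd {L : ℝ} (hL : 0 < L) {φ : ℝ → ℝ} (hφ : ContDiff ℝ 2 φ) {M : ℝ}
    (h0 : ∀ y, |φ y| ≤ M) (h1 : ∀ y, |deriv φ y| ≤ M) (h2 : ∀ y, |deriv (deriv φ) y| ≤ M)
    (p : Pt N) :
    heatResolvent L (fun q => L * φ q.2 - deriv (deriv φ) q.2) p = φ p.2 := by
  have hφ1 : ContDiff ℝ 1 (deriv φ) := ((contDiff_succ_iff_deriv (n := 1)).1 hφ).2.2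
  have hd : ∀ {χ : ℝ → ℝ} (_ : ContDiff ℝ 1 χ) (q : Pt N), HasFDerivAt (fun q : Pt N => χ q.2)
      (deriv χ q.2 • ContinuousLinearMap.snd ℝ (Fin N → ℝ) ℝ) q := fun hχ q =>
    ((hχ.differentiable (by norm_num) q.2).hasDerivAt.comp_hasFDerivAt q hasFDerivAt_snd)
  have hb : ∀ {χ : ℝ → ℝ} (_ : ContDiff ℝ 1 χ) (_ : ∀ y, |deriv χ y| ≤ M) (q : Pt N),
      ‖fderiv ℝ (fun q : Pt N => χ q.2) q‖ ≤ M := fun hχ hb q => by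
    rw [(hd hχ q).fderiv, norm_smul]
    have : ‖ContinuousLinearMap.snd ℝ (Fin N → ℝ) ℝ‖ ≤ 1 := ContinuousLinearMap.norm_snd_le ..
    calc _ ≤ M * 1 := mul_le_mul (hb _) this (norm_nonneg _) ((abs_nonneg _).trans (hb 0))
      _ = M := mul_one M
  have hφ' : ContDiff ℝ 1 φ := hφ.of_le (by norm_num)
  have e1 := coordTrace_gradResolvent hL (hφ'.comp contDiff_snd) (fun q : Pt N => h0 q.2)
    (hb hφ' h1) p
  have e2 := resolvent_fderiv hL (hφ1.comp contDiff_snd) (fun q : Pt N => h1 q.2)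
    (hb hφ1 h2) p (0, 1)
  have f1 : ∀ v : Pt N, (fun q => fderiv ℝ (φ ∘ Prod.snd) q v) = fun q => v.2 * deriv φ q.2 := by
    intro v; ext q
    have := (hd hφ' q).fderiv
    rw [show (φ ∘ Prod.snd) = fun q : Pt N => φ q.2 from rfl, this]
    simp [mul_comm]
  have f2 : (fun q => fderiv ℝ (deriv φ ∘ Prod.snd) q ((0, 1) : Pt N)) =
      fun q => deriv (deriv φ) q.2 := by
    ext q
    have := (hd hφ1 q).fderiv
    rw [show (deriv φ ∘ Prod.snd) = fun q : Pt N => deriv φ q.2 from rfl, this]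
    simp
  simp only [coordTrace, f1] at e1
  rw [f2] at e2
  have z : gradResolvent L (fun _ : Pt N => (0 : ℝ)) p = 0 := by
    simp [gradResolvent, dilAvg]
  simp only [zero_mul, one_mul, z] at e1
  simp only [zero_apply, Finset.sum_const_zero, zero_add] at e1
  have hc : Continuous fun q : Pt N => deriv (deriv φ) q.2 :=
    (hφ1.continuous_deriv (by norm_num)).comp continuous_snd
  have hc0 : Continuous fun q : Pt N => L * φ q.2 :=
    continuous_const.mul (hφ.continuous.comp continuous_snd)
  have e3 := dilAvg_sub (integrable_resolventKernel (N := N) hL) hc0 (M := L * M)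
    (fun q => by rw [abs_mul, abs_of_pos hL]; exact mul_le_mul_of_nonneg_left (h0 _) hL.le) hc
    (fun q => h2 q.2) p
  have e4 := dilAvg_const_mul (μ := halfMeasure N) (W := resolventKernel L)
    (g := fun q : Pt N => φ q.2) L p
  rw [heatResolvent, e3, e4]
  have e5 : gradResolvent L (fun q : Pt N => deriv φ q.2) p (0, 1) =
    dilAvg (halfMeasure N) (resolventKernel L) (fun q : Pt N => deriv (deriv φ) q.2) p := e2.symm
  have e6 : gradResolvent L (fun q : Pt N => deriv φ q.2) p (0, 1) =
    L * dilAvg (halfMeasure N) (resolventKernel L) (fun q : Pt N => φ q.2) p - φ p.2 := e1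
  rw [← e5, e6, smul_eq_mul]
  ring

theorem heatResolvent_const {L : ℝ} (hL : 0 < L) (c : ℝ) (p : Pt N) :
    heatResolvent L (fun _ => c) p = c / L := by
  have := heatResolvent_comp_snd hL (φ := fun _ => c / L) contDiff_const (M := |c / L|)
    (fun _ => le_rfl) (by simp) (by simp) p
  simpa [mul_div_cancel₀ _ hL.ne'] using this

theorem lap_heatResolvent {L : ℝ} (hL : 0 < L) {g : Pt N → ℝ} (hg : ContDiff ℝ 1 g)
    (hc : HasCompactSupport g) (p : Pt N) :
    lap (heatResolvent L g) p = L * heatResolvent L g p - g p := by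
  obtain ⟨M, hM⟩ := hc.exists_bound_of_continuous hg.continuous
  obtain ⟨M', hM'⟩ := (hc.fderiv ℝ).exists_bound_of_continuous
    (hg.continuous_fderiv (by norm_num))
  have hM : ∀ p, |g p| ≤ max M M' := fun p => (hM p).trans (le_max_left _ _)
  have hM' : ∀ p, ‖fderiv ℝ g p‖ ≤ max M M' := fun p => (hM' p).trans (le_max_right _ _)
  rw [← coordTrace_gradResolvent hL hg hM hM' p]
  have hd := differentiableAt_dilAvg (integrable_gradKernel hL) hg hM hM' p
  have h2 : ∀ v, D2 (heatResolvent L g) v p = gradResolvent L (fun q => fderiv ℝ g q v) p v := by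
    intro v
    have : (fun q => fderiv ℝ (heatResolvent L g) q v) = fun q => gradResolvent L g q v :=
      funext fun q => by rw [(hasFDerivAt_heatResolvent hL hg hM hM' q).fderiv]
    rw [D2, this]
    have h3 : HasFDerivAt (fun q => gradResolvent L g q v) _ p :=
      hd.1.hasFDerivAt.clm_apply (hasFDerivAt_const v p)
    rw [h3.fderiv]
    simp only [gradResolvent, ← hd.2 v]
    simp
  simp only [lap, coordTrace, h2]

/-- A linear symmetry of `ℝ^{N+1}` preserving volume and the Euclidean norm. -/
structure IsSymmetry (σ : Pt N ≃L[ℝ] Pt N) : Prop where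
  measurePreserving : MeasurePreserving σ
  sqSum_apply : ∀ z, sqSum (σ z) = sqSum z

theorem IsSymmetry.heatResolvent_comp {σ : Pt N ≃L[ℝ] Pt N} (hσ : IsSymmetry σ) (L : ℝ)
    {g : Pt N → ℝ} (hg : ∀ p, g (σ p) = g p) (p : Pt N) :
    heatResolvent L g (σ p) = heatResolvent L g p := by
  have hm : MeasurePreserving (Prod.map id σ : ℝ × Pt N → ℝ × Pt N) (halfMeasure N)
      (halfMeasure N) := (MeasurePreserving.id _).prod hσ.measurePreserving
  have he : MeasurableEmbedding (Prod.map id σ : ℝ × Pt N → ℝ × Pt N) :=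
    ((Homeomorph.refl ℝ).prodCongr σ.toHomeomorph).measurableEmbedding
  rw [heatResolvent, dilAvg, dilAvg, ← hm.integral_comp he]
  refine integral_congr_ae (ae_of_all _ fun a => ?_)
  simp only [Prod.map_fst, Prod.map_snd, id, resolventKernel, gauss, hσ.sqSum_apply]
  rw [← map_smul, ← map_add, hg]

theorem norm_dilAvg_sub_le {V : Type*} [NormedAddCommGroup V] [NormedSpace ℝ V]
    {μ : Measure (ℝ × Pt N)} {W : ℝ × Pt N → V} (hW : Integrable W μ) {g h : Pt N → ℝ}
    (hg : Continuous g) (hh : Continuous h) (hgc : HasCompactSupport g) (hhc : HasCompactSupport h)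
    {δ : ℝ} (hδ : ∀ p, |g p - h p| ≤ δ) (p : Pt N) :
    ‖dilAvg μ W g p - dilAvg μ W h p‖ ≤ δ * ∫ a, ‖W a‖ ∂μ := by
  obtain ⟨M, hM⟩ := hgc.exists_bound_of_continuous hg
  obtain ⟨M', hM'⟩ := hhc.exists_bound_of_continuous hh
  rw [← dilAvg_sub hW hg hM hh hM']
  exact norm_dilAvg_le hW hδ p

/-- The Picard iterates for the semilinear equation `L w - Δ w = G(·, w)`. -/
def picardIter (L : ℝ) (G : Pt N → ℝ → ℝ) : ℕ → Pt N → ℝ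
  | 0 => fun _ => 0
  | n + 1 => heatResolvent L fun p => G p (picardIter L G n p)

theorem hasCompactSupport_of_zero_off {G : Pt N → ℝ → ℝ} {Kc : Set (Pt N)} (hKc : IsCompact Kc)
    (hG : ∀ p ∉ Kc, ∀ t, G p t = 0) (w : Pt N → ℝ) : HasCompactSupport fun p => G p (w p) :=
  HasCompactSupport.intro hKc fun p hp => hG p hp _

theorem contDiff_picardIter {L : ℝ} (hL : 0 < L) {G : Pt N → ℝ → ℝ}
    (hG : ContDiff ℝ (⊤ : ℕ∞) fun q : Pt N × ℝ => G q.1 q.2)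
    {Kc : Set (Pt N)} (hKc : IsCompact Kc) (hGK : ∀ p ∉ Kc, ∀ t, G p t = 0) (n : ℕ) :
    ContDiff ℝ (⊤ : ℕ∞) (picardIter L G n) := by
  induction n with
  | zero => exact contDiff_const
  | succ n ih =>
    rw [contDiff_infty]
    intro m
    exact contDiff_dilAvg (integrable_resolventKernel hL) m
      (contDiff_infty.1 (hG.comp (contDiff_id.prodMk ih)) m)
      (hasCompactSupport_of_zero_off hKc hGK _)

theorem picardIter_symm {L : ℝ} {G : Pt N → ℝ → ℝ} {σ : Pt N ≃L[ℝ] Pt N} (hσ : IsSymmetry σ)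
    (hG : ∀ p t, G (σ p) t = G p t) (n : ℕ) (p : Pt N) :
    picardIter L G n (σ p) = picardIter L G n p := by
  induction n generalizing p with
  | zero => rfl
  | succ n ih => exact hσ.heatResolvent_comp L (fun p => by rw [ih, hG]) p

theorem picardIter_bounds {L c c₀ M : ℝ} (hL : 0 < L) (hc : 0 < c) (hc₀ : 0 < c₀) {φ : ℝ → ℝ}
    (hφ : ContDiff ℝ 2 φ) (h0 : ∀ y, |φ y| ≤ M) (h1 : ∀ y, |deriv φ y| ≤ M)
    (h2 : ∀ y, |deriv (deriv φ) y| ≤ M) (hφ₀ : ∀ y, c₀ ≤ φ y)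
    (hψ : ∀ y, c ≤ L * φ y - deriv (deriv φ) y)
    {G : Pt N → ℝ → ℝ} (hG : ContDiff ℝ (⊤ : ℕ∞) fun q : Pt N × ℝ => G q.1 q.2)
    {Kc : Set (Pt N)} (hKc : IsCompact Kc) (hGK : ∀ p ∉ Kc, ∀ t, G p t = 0)
    {r e : ℝ} (he : 0 ≤ e) (her : e * (M ^ 2 / (c₀ * c)) ≤ r)
    (hlip : ∀ p t₁ t₂, |t₁| ≤ r → |t₂| ≤ r → φ p.2 * |G p t₁ - G p t₂| ≤
      (L * φ p.2 - deriv (deriv φ) p.2 - c) * |t₁ - t₂|)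
    (hG0 : ∀ p, |G p 0| ≤ e) (n : ℕ) :
    0 ≤ 1 - c / (L * M) ∧ (∀ p, |picardIter L G n p| ≤
      e / (L * c₀) * (∑ i ∈ Finset.range n, (1 - c / (L * M)) ^ i) *
      φ p.2) ∧ (∀ p, |picardIter L G n p| ≤ e * (M ^ 2 / (c₀ * c))) ∧
    ∀ p, |picardIter L G (n + 1) p - picardIter L G n p| ≤
      e / (L * c₀) * (1 - c / (L * M)) ^ n * φ p.2 := by
  have hφpos : ∀ y, 0 < φ y := fun y => hc₀.trans_le (hφ₀ y)
  have hφM : ∀ y, φ y ≤ M := fun y => (le_abs_self _).trans (h0 y)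
  have hM : 0 < M := (hφpos 0).trans_le (hφM 0)
  have hφc := hφ.continuous
  have hφ1 : ContDiff ℝ 1 (deriv φ) := ((contDiff_succ_iff_deriv (n := 1)).1 hφ).2.2
  have hφc2 : Continuous (deriv (deriv φ)) := hφ1.continuous_deriv (by norm_num)
  have hψb : ∀ y, |L * φ y - deriv (deriv φ) y| ≤ L * M + M := fun y => by
    refine (abs_sub _ _).trans (add_le_add ?_ (h2 y))
    rw [abs_mul, abs_of_pos hL]
    exact mul_le_mul_of_nonneg_left (h0 y) hL.le
  have hR : ∀ p : Pt N, heatResolvent L (fun q => L * φ q.2 - deriv (deriv φ) q.2 - c) p =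
      φ p.2 - c / L := fun p => by
    rw [← heatResolvent_comp_snd hL hφ h0 h1 h2 p, ← heatResolvent_const hL c p]
    exact dilAvg_sub (integrable_resolventKernel hL) (by fun_prop) (M := L * M + M)
      (fun q : Pt N => hψb q.2) continuous_const (M' := |c|) (fun _ => le_rfl) p
  set τ := 1 - c / (L * M) with hτ
  have hcφ : ∀ p : Pt N, φ p.2 - c / L ≤ τ * φ p.2 := fun p => by
    have : c / (L * M) * φ p.2 ≤ c / (L * M) * M :=
      mul_le_mul_of_nonneg_left (hφM _) (by positivity)
    have e1 : c / (L * M) * M = c / L := by field_simp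
    rw [hτ]; linarith
  have hτ1 : τ < 1 := by have : 0 < c / (L * M) := by positivity
                         linarith
  have hτ0 : 0 ≤ τ := by
    have h3 : c / L ≤ φ 0 := by
      have := abs_heatResolvent_le hL (g := fun _ : Pt N => (0 : ℝ))
        (h := fun q : Pt N => L * φ q.2 - deriv (deriv φ) q.2 - c) (by fun_prop)
        (M := L * M + M + |c|) (fun q => (abs_sub _ _).trans (by have := hψb q.2; linarith))
        (fun q => by have := hψ q.2; simp; linarith) (0 : Pt N)
      rw [hR] at this
      have h4 := (abs_nonneg _).trans this
      simpa using h4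
    have := (h3.trans (hφM 0))
    rw [hτ, sub_nonneg, div_le_one (by positivity)]
    rw [div_le_iff₀ hL] at this
    linarith
  refine ⟨hτ0, ?_⟩
  set A := e / (L * c₀) with hA
  have hA0 : 0 ≤ A := by positivity
  have hsum : ∀ n, ∑ i ∈ Finset.range n, τ ^ i ≤ L * M / c := fun n => by
    have h5 := (summable_geometric_of_lt_one hτ0 hτ1).sum_le_tsum (Finset.range n)
      (fun i _ => pow_nonneg hτ0 i)
    rw [tsum_geometric_of_lt_one hτ0 hτ1] at h5
    refine h5.trans_eq ?_
    rw [hτ, sub_sub_cancel, inv_div]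
  have hfirst : ∀ n, (∀ p : Pt N,
      |picardIter L G n p| ≤ A * (∑ i ∈ Finset.range n, τ ^ i) * φ p.2) →
      ∀ p, |picardIter L G n p| ≤ e * (M ^ 2 / (c₀ * c)) := fun n hn p => by
    refine (hn p).trans ?_
    calc A * (∑ i ∈ Finset.range n, τ ^ i) * φ p.2 ≤ A * (L * M / c) * M := by
          gcongr
          · exact (hφpos _).le
          · exact hsum n
          · exact hφM _
      _ = e * (M ^ 2 / (c₀ * c)) := by rw [hA]; field_simp
  induction n with
  | zero =>
    have hz : ∀ p : Pt N, |picardIter L G 0 p| ≤ A * (∑ i ∈ Finset.range 0, τ ^ i) * φ p.2 := by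
      intro p; simp [picardIter]
    refine ⟨hz, hfirst 0 hz, fun p => ?_⟩
    have h6 : |heatResolvent L (fun p => G p 0) p| ≤ e / L := by
      rw [← heatResolvent_const hL e p]
      exact abs_heatResolvent_le hL continuous_const (M := |e|) (fun _ => le_rfl) hG0 p
    have h7 : |picardIter L G (0 + 1) p - picardIter L G 0 p| ≤ e / L := by
      simpa [picardIter] using h6
    refine h7.trans ?_
    calc e / L = A * c₀ := by rw [hA]; field_simp
      _ ≤ A * τ ^ 0 * φ p.2 := by
        rw [pow_zero, mul_one]; exact mul_le_mul_of_nonneg_left (hφ₀ _) hA0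
  | succ n ih =>
    obtain ⟨ih1, ih2, ih3⟩ := ih
    have hz : ∀ p : Pt N, |picardIter L G (n + 1) p| ≤
        A * (∑ i ∈ Finset.range (n + 1), τ ^ i) * φ p.2 := fun p => by
      have := abs_sub_abs_le_abs_sub (picardIter L G (n + 1) p) (picardIter L G n p)
      rw [Finset.sum_range_succ]
      have := ih1 p; have := ih3 p
      linarith
    have hz2 := hfirst _ hz
    refine ⟨hz, hz2, fun p => ?_⟩
    have hcw : ∀ n, Continuous fun p => G p (picardIter L G n p) := fun n =>
      (hG.comp (contDiff_id.prodMk (contDiff_picardIter hL hG hKc hGK n))).continuous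
    have hsw : ∀ n, HasCompactSupport fun p => G p (picardIter L G n p) := fun n =>
      hasCompactSupport_of_zero_off hKc hGK _
    obtain ⟨M1, hM1⟩ := (hsw (n + 1)).exists_bound_of_continuous (hcw (n + 1))
    obtain ⟨M2, hM2⟩ := (hsw n).exists_bound_of_continuous (hcw n)
    have h8 : picardIter L G (n + 1 + 1) p - picardIter L G (n + 1) p =
        heatResolvent L (fun p => G p (picardIter L G (n + 1) p) - G p (picardIter L G n p)) p :=
      (dilAvg_sub (integrable_resolventKernel hL) (hcw (n + 1)) hM1 (hcw n) hM2 p).symm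
    have h9 : ∀ p, |G p (picardIter L G (n + 1) p) - G p (picardIter L G n p)| ≤
        A * τ ^ n * (L * φ p.2 - deriv (deriv φ) p.2 - c) := fun p => by
      have h10 := hlip p _ _ ((hz2 p).trans her) ((ih2 p).trans her)
      have h11 := mul_le_mul_of_nonneg_left (ih3 p)
        (by have := hψ p.2; linarith : 0 ≤ L * φ p.2 - deriv (deriv φ) p.2 - c)
      refine le_of_mul_le_mul_left (a := φ p.2) ?_ (hφpos _)
      linarith
    rw [h8]
    have h12 := abs_heatResolvent_le hL
      (h := fun q : Pt N => A * τ ^ n * (L * φ q.2 - deriv (deriv φ) q.2 - c)) (by fun_prop)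
      (M := A * τ ^ n * (L * M + M + |c|)) (fun q => by
        rw [abs_mul, abs_of_nonneg (by positivity)]
        refine mul_le_mul_of_nonneg_left ((abs_sub _ _).trans ?_) (by positivity)
        have := hψb q.2; linarith) h9 p
    refine h12.trans ?_
    have h13 := dilAvg_const_mul (μ := halfMeasure N) (W := resolventKernel L)
      (g := fun q : Pt N => L * φ q.2 - deriv (deriv φ) q.2 - c) (A * τ ^ n) p
    have h14 : heatResolvent L (fun q : Pt N => A * τ ^ n * (L * φ q.2 - deriv (deriv φ) q.2 - c)) p
      = A * τ ^ n * (φ p.2 - c / L) := by rw [← hR p]; exact h13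
    rw [h14, pow_succ, ← mul_assoc A, mul_assoc (A * τ ^ n)]
    exact mul_le_mul_of_nonneg_left (hcφ p) (by positivity)

theorem exists_semilinear_solution {L c c₀ M r : ℝ} (hL : 0 < L) (hc : 0 < c) (hc₀ : 0 < c₀)
    (hr : 0 < r) {φ : ℝ → ℝ} (hφ : ContDiff ℝ 2 φ) (h0 : ∀ y, |φ y| ≤ M)
    (h1 : ∀ y, |deriv φ y| ≤ M) (h2 : ∀ y, |deriv (deriv φ) y| ≤ M) (hφ₀ : ∀ y, c₀ ≤ φ y)
    (hψ : ∀ y, c ≤ L * φ y - deriv (deriv φ) y) :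
    ∃ C > 0, ∃ e₀ > 0, ∀ (G : Pt N → ℝ → ℝ) (Kc : Set (Pt N)) (e : ℝ),
      ContDiff ℝ (⊤ : ℕ∞) (fun q : Pt N × ℝ => G q.1 q.2) → IsCompact Kc →
      (∀ p ∉ Kc, ∀ t, G p t = 0) →
      (∀ p t₁ t₂, |t₁| ≤ r → |t₂| ≤ r → φ p.2 * |G p t₁ - G p t₂| ≤
        (L * φ p.2 - deriv (deriv φ) p.2 - c) * |t₁ - t₂|) →
      0 ≤ e → e ≤ e₀ → (∀ p, |G p 0| ≤ e) →
      ∃ w : Pt N → ℝ, ContDiff ℝ (⊤ : ℕ∞) w ∧ (∀ p, |w p| ≤ C * e) ∧ (∀ p, |w p| ≤ r) ∧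
        (∀ p, ‖fderiv ℝ w p‖ ≤ C * e) ∧ (∀ p, lap w p = L * w p - G p (w p)) ∧
        ∀ σ : Pt N ≃L[ℝ] Pt N, IsSymmetry σ → (∀ p t, G (σ p) t = G p t) → ∀ p, w (σ p) = w p := by
  have hφM : ∀ y, φ y ≤ M := fun y => (le_abs_self _).trans (h0 y)
  have hφpos : ∀ y, 0 < φ y := fun y => hc₀.trans_le (hφ₀ y)
  have hM : 0 < M := (hφpos 0).trans_le (hφM 0)
  set C₁ := M ^ 2 / (c₀ * c) with hC₁
  have hC₁0 : 0 < C₁ := by positivity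
  set J := ∫ a, ‖gradKernel L a‖ ∂(halfMeasure N) with hJ
  have hJ0 : 0 ≤ J := integral_nonneg fun a => norm_nonneg _
  set Λ := (L * M + M) / c₀ with hΛ
  have hΛ0 : 0 ≤ Λ := by positivity
  refine ⟨C₁ + (1 + Λ * C₁) * J, by positivity, r / C₁, by positivity, ?_⟩
  intro G Kc e hG hKc hGK hlip he hee hG0
  have her : e * C₁ ≤ r := by rwa [le_div_iff₀ hC₁0] at hee
  have hb := picardIter_bounds hL hc hc₀ hφ h0 h1 h2 hφ₀ hψ hG hKc hGK he her hlip hG0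
  set τ := 1 - c / (L * M) with hτ
  set A := e / (L * c₀) with hA
  set W := picardIter L G with hW
  have hlip' : ∀ p t₁ t₂, |t₁| ≤ r → |t₂| ≤ r → |G p t₁ - G p t₂| ≤ Λ * |t₁ - t₂| := by
    intro p t₁ t₂ ht₁ ht₂
    have h3 := hlip p t₁ t₂ ht₁ ht₂
    have h4 : (L * φ p.2 - deriv (deriv φ) p.2 - c) ≤ L * M + M := by
      have := mul_le_mul_of_nonneg_left (hφM p.2) hL.le
      have := (abs_le.1 (h2 p.2)).1
      linarith
    have h5 := mul_le_mul_of_nonneg_right h4 (abs_nonneg (t₁ - t₂))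
    have h6 := mul_le_mul_of_nonneg_right (hφ₀ p.2) (abs_nonneg (G p t₁ - G p t₂))
    rw [hΛ, div_mul_eq_mul_div, le_div_iff₀ hc₀]
    linarith
  have hτ1 : τ < 1 := by have : 0 < c / (L * M) := by positivity
                         linarith
  obtain ⟨hτ0, -, -⟩ := hb 0
  have hA0 : 0 ≤ A := by positivity
  have hstep : ∀ p n, dist (W n p) (W (n + 1) p) ≤ A * M * τ ^ n := fun p n => by
    rw [dist_comm, Real.dist_eq]
    refine ((hb n).2.2.2 p).trans ?_
    calc A * τ ^ n * φ p.2 ≤ A * τ ^ n * M := by gcongr; exact hφM _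
      _ = A * M * τ ^ n := by ring
  have hWb : ∀ n p, |W n p| ≤ e * C₁ := fun n => (hb n).2.2.1
  choose w hw using fun p => cauchySeq_tendsto_of_complete
    (cauchySeq_of_le_geometric τ (A * M) hτ1 (hstep p))
  have hrate : ∀ n p, |W n p - w p| ≤ A * M / (1 - τ) * τ ^ n := fun n p => by
    have := dist_le_of_le_geometric_of_tendsto τ (A * M) hτ1 (hstep p) (hw p) n
    rw [Real.dist_eq] at this
    exact this.trans_eq (by ring)
  set δ : ℕ → ℝ := fun n => A * M / (1 - τ) * τ ^ n with hδ
  have hδ0 : Tendsto δ atTop (𝓝 0) := by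
    simpa using (tendsto_pow_atTop_nhds_zero_of_lt_one hτ0 hτ1).const_mul (A * M / (1 - τ))
  have hWd := fun n => contDiff_picardIter hL hG hKc hGK n
  have hunif : TendstoUniformly W w atTop := by
    rw [Metric.tendstoUniformly_iff]
    intro ε hε
    filter_upwards [hδ0.eventually_lt_const hε] with n hn p
    rw [dist_comm, Real.dist_eq]
    exact (hrate n p).trans_lt hn
  have hwc : Continuous w := hunif.continuous (Eventually.frequently
    (Eventually.of_forall fun n => (hWd n).continuous))
  have hwb : ∀ p, |w p| ≤ e * C₁ := fun p =>
    le_of_tendsto (hw p).abs (Eventually.of_forall fun n => hWb n p)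
  have hwr : ∀ p, |w p| ≤ r := fun p => (hwb p).trans her
  have hcw : ∀ n, Continuous fun p => G p (W n p) := fun n =>
    (hG.comp (contDiff_id.prodMk (hWd n))).continuous
  have hcl : Continuous fun p => G p (w p) := hG.continuous.comp (continuous_id.prodMk hwc)
  have hsup : ∀ w : Pt N → ℝ, HasCompactSupport fun p => G p (w p) := fun w =>
    hasCompactSupport_of_zero_off hKc hGK w
  have hGd : ∀ n p, |G p (W n p) - G p (w p)| ≤ Λ * δ n := fun n p =>
    (hlip' p _ _ ((hWb n p).trans her) (hwr p)).trans
      (mul_le_mul_of_nonneg_left (hrate n p) hΛ0)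
  have hfix : w = heatResolvent L fun p => G p (w p) := by
    funext p
    refine tendsto_nhds_unique ((tendsto_add_atTop_iff_nat 1).2 (hw p)) ?_
    rw [tendsto_iff_norm_sub_tendsto_zero]
    refine squeeze_zero (fun _ => norm_nonneg _) (fun n => norm_dilAvg_sub_le
      (integrable_resolventKernel hL) (hcw n) hcl (hsup _) (hsup _) (hGd n) p) ?_
    simpa using (hδ0.const_mul Λ).mul_const (∫ a, ‖resolventKernel L a‖ ∂(halfMeasure N))
  have hder : ∀ p, HasFDerivAt w (gradResolvent L (fun p => G p (w p)) p) p := by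
    refine hasFDerivAt_of_tendstoUniformly (l := atTop) (f := fun n => W (n + 1))
      (f' := fun n => gradResolvent L fun p => G p (W n p)) ?_ ?_ ?_
    · rw [Metric.tendstoUniformly_iff]
      intro ε hε
      have h8 : Tendsto (fun n => Λ * δ n * J) atTop (𝓝 0) := by
        simpa using (hδ0.const_mul Λ).mul_const J
      filter_upwards [h8.eventually_lt_const hε] with n hn p
      rw [dist_comm, dist_eq_norm]
      exact (norm_dilAvg_sub_le (integrable_gradKernel hL) (hcw n) hcl (hsup _) (hsup _)
        (hGd n) p).trans_lt hn
    · intro n p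
      have hg1 : ContDiff ℝ 1 fun p => G p (W n p) :=
        (hG.comp (contDiff_id.prodMk (hWd n))).of_le (by exact_mod_cast le_top)
      obtain ⟨B, hB⟩ := (hsup (W n)).exists_bound_of_continuous (hcw n)
      obtain ⟨B', hB'⟩ := ((hsup (W n)).fderiv ℝ).exists_bound_of_continuous
        (hg1.continuous_fderiv (by norm_num))
      exact hasFDerivAt_heatResolvent hL hg1 (M := max B B')
        (fun p => (hB p).trans (le_max_left _ _))
        (fun p => (hB' p).trans (le_max_right _ _)) p
    · exact fun p => (tendsto_add_atTop_iff_nat 1).2 (hw p)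
  have hfd : fderiv ℝ w = gradResolvent L fun p => G p (w p) := funext fun p => (hder p).fderiv
  have hsm : ∀ n : ℕ, ContDiff ℝ n w := fun n => by
    induction n with
    | zero => exact contDiff_zero.2 hwc
    | succ n ih =>
      rw [Nat.cast_add, Nat.cast_one, contDiff_succ_iff_fderiv]
      refine ⟨fun p => (hder p).differentiableAt, fun h => absurd h (by simp), ?_⟩
      rw [hfd]
      exact contDiff_dilAvg (integrable_gradKernel hL) n
        ((hG.of_le (by exact_mod_cast le_top)).comp (contDiff_id.prodMk ih)) (hsup w)
  have hwsm : ContDiff ℝ (⊤ : ℕ∞) w := contDiff_infty.2 hsm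
  refine ⟨w, hwsm, fun p => ?_, hwr, fun p => ?_, fun p => ?_, fun σ hσ hGσ p => ?_⟩
  · refine (hwb p).trans ?_
    have : 0 ≤ (1 + Λ * C₁) * J * e := by positivity
    linarith
  · have h9 : ∀ p, |G p (w p)| ≤ (1 + Λ * C₁) * e := fun p => by
      have h10 := hlip' p (w p) 0 (hwr p) (by simpa using hr.le)
      have h11 := mul_le_mul_of_nonneg_left (hwb p) hΛ0
      have h12 := abs_sub_abs_le_abs_sub (G p (w p)) (G p 0)
      have := hG0 p
      rw [sub_zero] at h10
      linarith
    rw [hfd]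
    refine (norm_dilAvg_le (integrable_gradKernel hL) h9 p).trans ?_
    have : 0 ≤ C₁ * e := by positivity
    rw [← hJ]
    linarith
  · have hg1 : ContDiff ℝ 1 fun p => G p (w p) :=
      (hG.comp (contDiff_id.prodMk hwsm)).of_le (by exact_mod_cast le_top)
    have h13 := lap_heatResolvent hL hg1 (hsup w) p
    rwa [← hfix] at h13
  · exact tendsto_nhds_unique (hw (σ p))
      ((hw p).congr fun n => (picardIter_symm hσ hGσ n p).symm)

theorem integral_fderiv_apply_eq_zero {g : Pt N → ℝ} (hg : ContDiff ℝ 1 g)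
    (hc : HasCompactSupport g) (a : Pt N) : ∫ p, fderiv ℝ g p a = 0 := by
  have hi : Integrable fun p => fderiv ℝ g p a :=
    ((hg.continuous_fderiv (by simp)).clm_apply continuous_const).integrable_of_hasCompactSupport
      (hc.fderiv_apply (𝕜 := ℝ) a)
  have := integral_mul_fderiv_eq_neg_fderiv_mul_of_integrable (μ := (volume : Measure (Pt N)))
    (f := fun _ => (1 : ℝ)) (g := g) (v := a) (by simp) (by simpa using hi)
    (by simpa using hg.continuous.integrable_of_hasCompactSupport hc)
    (fun p _ => differentiableAt_const _)
    (fun p _ => hg.differentiable (by simp) p)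
  simpa using this

/-- A positive strict supersolution of the linearised equation depending on `y` only
forces stability (Picone's identity). -/
theorem stable_of_barrier {Ω : Set (Pt N)} {gp : Pt N → ℝ} (hgp : Continuous gp) {φ : ℝ → ℝ}
    (hφ : ContDiff ℝ (⊤ : ℕ∞) φ) (hφ0 : ∀ y, 0 < φ y) {c : ℝ} (hc : 0 < c)
    (h : ∀ p ∈ Ω, gp p * φ p.2 + c ≤ -deriv (deriv φ) p.2) : Stable Ω gp := by
  intro ξ hξ hξc hξΩ hξ0
  have hφ' : ContDiff ℝ (⊤ : ℕ∞) (deriv φ) := (contDiff_infty_iff_deriv.1 hφ).2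
  set ψ : ℝ → ℝ := fun y => deriv φ y / φ y with hψ
  have hψc : ContDiff ℝ (⊤ : ℕ∞) ψ := hφ'.div hφ fun y => (hφ0 y).ne'
  have hψd : ∀ y, HasDerivAt ψ ((deriv (deriv φ) y * φ y - deriv φ y * deriv φ y) / φ y ^ 2) y :=
    fun y => (hφ'.differentiable (by simp) y).hasDerivAt.div
      (hφ.differentiable (by simp) y).hasDerivAt (hφ0 y).ne'
  set η : Pt N → ℝ := fun p => ψ p.2 * ξ p ^ 2 with hη
  have hηc : ContDiff ℝ (⊤ : ℕ∞) η := (hψc.comp contDiff_snd).mul (hξ.pow 2)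
  have hηs : HasCompactSupport η :=
    hξc.mono fun p hp hp0 => hp (by simp only [hη]; simp [hp0])
  have hηd : ∀ p, fderiv ℝ η p (0, 1) =
      (deriv (deriv φ) p.2 * φ p.2 - deriv φ p.2 * deriv φ p.2) / φ p.2 ^ 2 * ξ p ^ 2 +
        ψ p.2 * (2 * ξ p * fderiv ℝ ξ p (0, 1)) := by
    intro p
    have h0 : HasFDerivAt (Prod.snd : Pt N → ℝ) (ContinuousLinearMap.snd ℝ (Fin N → ℝ) ℝ) p :=
      hasFDerivAt_snd
    have h1 : HasFDerivAt (fun p : Pt N => ψ p.2) _ p := (hψd p.2).comp_hasFDerivAt p h0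
    have h2 : HasFDerivAt η _ p := h1.mul ((hξ.differentiable (by simp) p).hasFDerivAt.pow 2)
    rw [h2.fderiv]
    simp only [add_apply, smul_apply, smul_eq_mul, ContinuousLinearMap.coe_snd']
    push_cast
    ring
  have hξsupp : ∀ p ∉ Ω, ξ p = 0 := fun p hp => image_eq_zero_of_notMem_tsupport fun h => hp (hξΩ h)
  have hξfd : ∀ p ∉ Ω, fderiv ℝ ξ p = 0 := fun p hp =>
    image_eq_zero_of_notMem_tsupport fun h => hp (hξΩ (tsupport_fderiv_subset ℝ h))
  have e1 : ∫ p in Ω, gradSq ξ p = ∫ p, gradSq ξ p :=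
    setIntegral_eq_integral_of_forall_compl_eq_zero fun p hp => by simp [gradSq, hξfd p hp]
  have e2 : ∫ p in Ω, gp p * ξ p ^ 2 = ∫ p, gp p * ξ p ^ 2 :=
    setIntegral_eq_integral_of_forall_compl_eq_zero fun p hp => by simp [hξsupp p hp]
  have hfc : ∀ a, Continuous fun p => fderiv ℝ ξ p a := fun a =>
    (hξ.continuous_fderiv (by simp)).clm_apply continuous_const
  have hgc : Continuous (gradSq ξ) := by
    unfold gradSq
    exact (continuous_finsetSum _ fun j _ => (hfc _).pow 2).add ((hfc _).pow 2)
  have i1 : Integrable (gradSq ξ) := by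
    refine hgc.integrable_of_hasCompactSupport ((hξc.fderiv (𝕜 := ℝ)).mono fun p hp hp0 => hp ?_)
    simp [gradSq, hp0]
  have i2 : Integrable fun p => gp p * ξ p ^ 2 :=
    (hgp.mul (hξ.continuous.pow 2)).integrable_of_hasCompactSupport
      (hξc.mono fun p hp hp0 => hp (by simp [hp0]))
  have i3 : Integrable fun p => fderiv ℝ η p (0, 1) :=
    ((hηc.continuous_fderiv (by simp)).clm_apply continuous_const).integrable_of_hasCompactSupport
      (hηs.fderiv_apply (𝕜 := ℝ) _)
  have c4 : Continuous fun p => c / φ p.2 * ξ p ^ 2 :=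
    (continuous_const.div (hφ.continuous.comp continuous_snd) fun p => (hφ0 _).ne').mul
      (hξ.continuous.pow 2)
  have s4 : HasCompactSupport fun p => c / φ p.2 * ξ p ^ 2 :=
    hξc.mono fun p hp hp0 => hp (by simp [hp0])
  have i4 : Integrable fun p => c / φ p.2 * ξ p ^ 2 := c4.integrable_of_hasCompactSupport s4
  obtain ⟨p₀, hp₀⟩ : ∃ p, ξ p ≠ 0 := by
    by_contra! h0
    exact hξ0 (funext h0)
  have hpos : 0 < ∫ p, c / φ p.2 * ξ p ^ 2 :=
    c4.integral_pos_of_hasCompactSupport_nonneg_nonzero s4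
      (fun p => mul_nonneg (div_pos hc (hφ0 _)).le (sq_nonneg _)) (x := p₀)
      (mul_pos (div_pos hc (hφ0 _)) (by positivity)).ne'
  have hle : ∫ p, (c / φ p.2 * ξ p ^ 2 + fderiv ℝ η p (0, 1)) ≤
      ∫ p, (gradSq ξ p - gp p * ξ p ^ 2) := by
    refine integral_mono (i4.add i3) (i1.sub i2) fun p => ?_
    by_cases hp : p ∈ Ω
    · have hg : fderiv ℝ ξ p (0, 1) ^ 2 ≤ gradSq ξ p :=
        le_add_of_nonneg_left (Finset.sum_nonneg fun j _ => sq_nonneg _)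
      have hb := h p hp
      have hq : c / φ p.2 * ξ p ^ 2 ≤ (-deriv (deriv φ) p.2 / φ p.2 - gp p) * ξ p ^ 2 := by
        refine mul_le_mul_of_nonneg_right ?_ (sq_nonneg _)
        rw [le_sub_iff_add_le, div_add' _ _ _ (hφ0 _).ne', div_le_div_iff_of_pos_right (hφ0 _)]
        linarith
      have hid : fderiv ℝ η p (0, 1) = fderiv ℝ ξ p (0, 1) ^ 2 -
          -deriv (deriv φ) p.2 / φ p.2 * ξ p ^ 2 - (fderiv ℝ ξ p (0, 1) - ψ p.2 * ξ p) ^ 2 := by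
        have := (hφ0 p.2).ne'
        rw [hηd p, hψ]
        field_simp
        ring
      have := sq_nonneg (fderiv ℝ ξ p (0, 1) - ψ p.2 * ξ p)
      simp only
      rw [hid]
      linarith
    · rw [hηd p]
      simp [gradSq, hξfd p hp, hξsupp p hp]
  rw [integral_add i4 i3, integral_fderiv_apply_eq_zero (hηc.of_le (by exact_mod_cast le_top)) hηs,
    integral_sub i1 i2] at hle
  rw [e1, e2]
  linarith

theorem fderiv_comp_clm {W : Pt N → ℝ} (hW : ContDiff ℝ (⊤ : ℕ∞) W) (A : Pt N →L[ℝ] Pt N)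
    (p a : Pt N) : fderiv ℝ (fun q => W (A q)) p a = fderiv ℝ W (A p) (A a) := by
  have : HasFDerivAt (fun q => W (A q)) _ p :=
    (hW.differentiable (by simp) (A p)).hasFDerivAt.comp p A.hasFDerivAt
  rw [this.fderiv]
  rfl

theorem D2_comp_clm {W : Pt N → ℝ} (hW : ContDiff ℝ (⊤ : ℕ∞) W) (A : Pt N →L[ℝ] Pt N)
    (v p : Pt N) : D2 (fun q => W (A q)) v p = D2 W (A v) (A p) := by
  unfold D2
  rw [funext fun q => fderiv_comp_clm hW A q v]
  exact fderiv_comp_clm (contDiff_fderiv_apply hW (A v)) A p v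

theorem D2_smul {W : Pt N → ℝ} (hW : ContDiff ℝ (⊤ : ℕ∞) W) (c : ℝ) (v p : Pt N) :
    D2 W (c • v) p = c ^ 2 * D2 W v p := by
  have h1 : (fun q => fderiv ℝ W q (c • v)) = fun q => c * fderiv ℝ W q v :=
    funext fun q => by rw [map_smul, smul_eq_mul]
  unfold D2
  rw [h1, fderiv_const_mul ((contDiff_fderiv_apply hW v).differentiable (by simp) p), map_smul,
    smul_apply]
  simp only [smul_eq_mul]
  ring

theorem D2_add {u w : Pt N → ℝ} (hu : ContDiff ℝ (⊤ : ℕ∞) u) (hw : ContDiff ℝ (⊤ : ℕ∞) w)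
    (v p : Pt N) : D2 (fun q => u q + w q) v p = D2 u v p + D2 w v p := by
  have h1 : (fun q => fderiv ℝ (fun q => u q + w q) q v) =
      fun q => fderiv ℝ u q v + fderiv ℝ w q v := funext fun q => by
    rw [fderiv_fun_add (hu.differentiable (by simp) q) (hw.differentiable (by simp) q), add_apply]
  unfold D2
  rw [h1, fderiv_fun_add ((contDiff_fderiv_apply hu v).differentiable (by simp) p)
    ((contDiff_fderiv_apply hw v).differentiable (by simp) p), add_apply]

theorem lap_add {u w : Pt N → ℝ} (hu : ContDiff ℝ (⊤ : ℕ∞) u) (hw : ContDiff ℝ (⊤ : ℕ∞) w)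
    (p : Pt N) : lap (fun q => u q + w q) p = lap u p + lap w p := by
  simp only [lap, D2_add hu hw, Finset.sum_add_distrib]
  ring

theorem contDiff_D2 {W : Pt N → ℝ} (hW : ContDiff ℝ (⊤ : ℕ∞) W) (v : Pt N) :
    ContDiff ℝ (⊤ : ℕ∞) (D2 W v) :=
  contDiff_fderiv_apply (contDiff_fderiv_apply hW v) v

theorem contDiff_lap {W : Pt N → ℝ} (hW : ContDiff ℝ (⊤ : ℕ∞) W) :
    ContDiff ℝ (⊤ : ℕ∞) (lap W) :=
  (ContDiff.sum fun _ _ => contDiff_D2 hW _).add (contDiff_D2 hW _)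

/-- The Laplacian commutes with diagonal sign changes. -/
theorem lap_comp_signs {W : Pt N → ℝ} (hW : ContDiff ℝ (⊤ : ℕ∞) W) (A : Pt N →L[ℝ] Pt N)
    (h1 : ∀ j : Fin N, ∃ c : ℝ, c ^ 2 = 1 ∧
      A (Pi.single j 1, 0) = c • ((Pi.single j 1, 0) : Pt N))
    (h2 : ∃ c : ℝ, c ^ 2 = 1 ∧ A (0, 1) = c • ((0, 1) : Pt N)) (p : Pt N) :
    lap (fun q => W (A q)) p = lap W (A p) := by
  unfold lap
  congr 1
  · refine Finset.sum_congr rfl fun j _ => ?_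
    obtain ⟨c, hc, hA⟩ := h1 j
    rw [D2_comp_clm hW, hA, D2_smul hW, hc, one_mul]
  · obtain ⟨c, hc, hA⟩ := h2
    rw [D2_comp_clm hW, hA, D2_smul hW, hc, one_mul]

/-- The dilation `(x, y) ↦ (ε x, y)`. -/
def dil (ε : ℝ) : Pt N →L[ℝ] Pt N :=
  (ε • ContinuousLinearMap.fst ℝ (Fin N → ℝ) ℝ).prod (ContinuousLinearMap.snd ℝ (Fin N → ℝ) ℝ)

theorem dil_apply (ε : ℝ) (p : Pt N) : dil ε p = (ε • p.1, p.2) := rfl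

theorem dil_dil_inv {ε : ℝ} (hε : ε ≠ 0) (p : Pt N) : dil ε (dil ε⁻¹ p) = p := by
  simp [dil_apply, smul_smul, hε]

theorem dil_inv_dil {ε : ℝ} (hε : ε ≠ 0) (p : Pt N) : dil ε⁻¹ (dil ε p) = p := by
  simp [dil_apply, smul_smul, hε]

theorem isCompact_dil_preimage {ε : ℝ} (hε : ε ≠ 0) {K : Set (Pt N)} (hK : IsCompact K) :
    IsCompact {p | dil ε p ∈ K} := by
  convert hK.image (dil ε⁻¹ : Pt N →L[ℝ] Pt N).continuous using 1
  ext p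
  constructor
  · exact fun hp => ⟨dil ε p, hp, dil_inv_dil hε p⟩
  · rintro ⟨q, hq, rfl⟩
    rwa [mem_ofPred_eq, dil_dil_inv hε]

theorem lap_comp_dil {W : Pt N → ℝ} (hW : ContDiff ℝ (⊤ : ℕ∞) W) (ε : ℝ) (p : Pt N) :
    lap (fun q => W (dil ε q)) p =
      ε ^ 2 * (∑ j : Fin N, D2 W (Pi.single j 1, 0) (dil ε p)) + D2 W (0, 1) (dil ε p) := by
  have h1 : ∀ j : Fin N, dil ε ((Pi.single j 1, 0) : Pt N) = ε • ((Pi.single j 1, 0) : Pt N) :=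
    fun j => by simp [dil_apply]
  have h2 : dil ε ((0, 1) : Pt N) = (0, 1) := by simp [dil_apply]
  simp only [lap, D2_comp_clm hW, h1, h2, D2_smul hW, Finset.mul_sum]

theorem exists_cutoff {a : ℝ} (ha : 0 < a) : ∃ θ : ℝ → ℝ, ContDiff ℝ (⊤ : ℕ∞) θ ∧
    (∀ t, 0 ≤ θ t) ∧ (∀ t, θ t ≤ 1) ∧ (∀ t, -(a / 4) ≤ t → θ t = 1) ∧
    ∀ t, t ≤ -(a / 2) → θ t = 0 := by
  refine ⟨fun t => Real.smoothTransition ((t + a / 2) / (a / 4)),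
    Real.smoothTransition.contDiff.comp (by fun_prop),
    fun t => Real.smoothTransition.nonneg _, fun t => Real.smoothTransition.le_one _,
    fun t ht => Real.smoothTransition.one_of_one_le ?_,
    fun t ht => Real.smoothTransition.zero_of_nonpos ?_⟩
  · rw [le_div_iff₀ (by positivity)]; linarith
  · exact div_nonpos_of_nonpos_of_nonneg (by linarith) (by positivity)

theorem abs_sub_le_deriv_mul {f : ℝ → ℝ} (hd : Differentiable ℝ f) (hm : Monotone f)
    (hc : ConvexOn ℝ univ f) {s t S : ℝ} (hs : s ≤ S) (ht : t ≤ S) :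
    |f s - f t| ≤ deriv f S * |s - t| := by
  wlog hst : t ≤ s generalizing s t
  · rw [abs_sub_comm, abs_sub_comm s]
    exact this ht hs (le_of_not_ge hst)
  rw [abs_of_nonneg (sub_nonneg.2 (hm hst)), abs_of_nonneg (sub_nonneg.2 hst)]
  have h1 := hc.tangent_le hd s t
  have h2 : deriv f s ≤ deriv f S :=
    hc.monotoneOn_deriv (fun x _ => hd x) (mem_univ s) (mem_univ S) hs
  have := mul_le_mul_of_nonneg_right h2 (sub_nonneg.2 hst)
  linarith

/-- A slowly dilated approximate solution can be corrected to an exact one. -/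
theorem exists_correction {W : Pt N → ℝ} (hW : ContDiff ℝ (⊤ : ℕ∞) W) {f : ℝ → ℝ}
    (hf : ContDiff ℝ (⊤ : ℕ∞) f) (hmono : Monotone f) (hconv : ConvexOn ℝ univ f)
    {lam : ℝ} (hlam : 0 < lam) {a r c c₀ L B : ℝ} {φ : ℝ → ℝ} (ha : 0 < a) (hr : 0 < r) (hc : 0 < c)
    (hc₀ : 0 < c₀) (hL : 0 < L) (hφ : ContDiff ℝ (⊤ : ℕ∞) φ) (h0 : ∀ y, |φ y| ≤ B)
    (h1 : ∀ y, |deriv φ y| ≤ B) (h2 : ∀ y, |deriv (deriv φ) y| ≤ B) (hφ₀ : ∀ y, c₀ ≤ φ y)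
    (hψ : ∀ y, c ≤ L * φ y - deriv (deriv φ) y) (hK : IsCompact {p | -a ≤ W p})
    (heq : ∀ p, -a ≤ W p → D2 W (0, 1) p = -(lam * f (W p)))
    (hbar : ∀ p, -a ≤ W p → ∀ t ≤ W p + r, lam * deriv f t * φ p.2 + c ≤ -deriv (deriv φ) p.2) :
    ∃ C > 0, ∃ ε₀ > 0, ∀ ε, 0 < ε → ε ≤ ε₀ → ∃ w : Pt N → ℝ, ContDiff ℝ (⊤ : ℕ∞) w ∧
      (∀ p, |w p| ≤ C * ε ^ 2) ∧ (∀ p, |w p| ≤ r) ∧ (∀ p, ‖fderiv ℝ w p‖ ≤ C * ε ^ 2) ∧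
      (∀ p, -(a / 4) ≤ W (dil ε p) →
        lap (fun q => W (dil ε q) + w q) p = -(lam * f (W (dil ε p) + w p))) ∧
      ∀ σ : Pt N ≃L[ℝ] Pt N, IsSymmetry σ → (∀ p, W (dil ε (σ p)) = W (dil ε p)) →
        (∀ p, lap (fun q => W (dil ε q)) (σ p) = lap (fun q => W (dil ε q)) p) →
        ∀ p, w (σ p) = w p := by
  obtain ⟨C, hC, e₀, he₀, H⟩ := exists_semilinear_solution (N := N) hL hc hc₀ hr
    (hφ.of_le (WithTop.coe_le_coe.2 le_top)) h0 h1 h2 hφ₀ hψ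
  obtain ⟨θ, hθ, hθ0, hθ1, hθone, hθzero⟩ := exists_cutoff ha
  have hsum : Continuous fun p => ∑ j : Fin N, D2 W (Pi.single j 1, 0) p :=
    continuous_finsetSum _ fun j _ => (contDiff_D2 hW _).continuous
  obtain ⟨C₁, hC₁⟩ := hK.exists_bound_of_continuousOn hsum.continuousOn
  set C₂ := max C₁ 1 with hC₂
  have hC₂1 : 1 ≤ C₂ := le_max_right _ _
  have hC₂0 : 0 < C₂ := by linarith
  have hfd : Differentiable ℝ f := hf.differentiable (by simp)
  refine ⟨C * C₂, by positivity, min 1 (e₀ / C₂), by positivity, fun ε hε hεε => ?_⟩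
  have hε1 : ε ≤ 1 := hεε.trans (min_le_left _ _)
  have hεe : C₂ * ε ≤ e₀ := by
    have := hεε.trans (min_le_right _ _)
    rwa [le_div_iff₀ hC₂0, mul_comm] at this
  set U : Pt N → ℝ := fun q => W (dil ε q) with hU
  have hUc : ContDiff ℝ (⊤ : ℕ∞) U := hW.comp (dil ε).contDiff
  set G : Pt N → ℝ → ℝ := fun p t => θ (U p) * (lam * f (U p + t) + lap U p + L * t) with hG
  have hGc : ContDiff ℝ (⊤ : ℕ∞) fun q : Pt N × ℝ => G q.1 q.2 := by
    have hU1 : ContDiff ℝ (⊤ : ℕ∞) fun q : Pt N × ℝ => U q.1 := hUc.comp contDiff_fst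
    exact (hθ.comp hU1).mul (((contDiff_const.mul (hf.comp (hU1.add contDiff_snd))).add
      ((contDiff_lap hUc).comp contDiff_fst)).add (contDiff_const.mul contDiff_snd))
  have hG1 : ∀ p ∉ {p | dil ε p ∈ {p | -a ≤ W p}}, ∀ t, G p t = 0 := by
    intro p hp t
    simp only [mem_ofPred_eq, not_le] at hp
    simp only [hG]
    rw [hθzero _ (by linarith : W (dil ε p) ≤ -(a / 2)), zero_mul]
  have hG2 : ∀ p t₁ t₂, |t₁| ≤ r → |t₂| ≤ r → φ p.2 * |G p t₁ - G p t₂| ≤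
      (L * φ p.2 - deriv (deriv φ) p.2 - c) * |t₁ - t₂| := by
    intro p t₁ t₂ ht₁ ht₂
    have hφp := hc₀.trans_le (hφ₀ p.2)
    rcases le_or_gt (U p) (-(a / 2)) with hp | hp
    · simp only [hG, hθzero _ hp, zero_mul, sub_self, abs_zero, mul_zero]
      exact mul_nonneg (by linarith [hψ p.2]) (abs_nonneg _)
    · have hb := hbar (dil ε p) (by simp only [hU] at hp; linarith) (U p + r) le_rfl
      have hq := abs_sub_le_deriv_mul hfd hmono hconv
        (show U p + t₁ ≤ U p + r by linarith [(abs_le.1 ht₁).2])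
        (show U p + t₂ ≤ U p + r by linarith [(abs_le.1 ht₂).2])
      have e1 : U p + t₁ - (U p + t₂) = t₁ - t₂ := by ring
      rw [e1] at hq
      have e2 : G p t₁ - G p t₂ =
          θ (U p) * (lam * (f (U p + t₁) - f (U p + t₂)) + L * (t₁ - t₂)) := by
        simp only [hG]; ring
      have hA : |lam * (f (U p + t₁) - f (U p + t₂)) + L * (t₁ - t₂)| ≤
          (lam * deriv f (U p + r) + L) * |t₁ - t₂| := by
        refine (abs_add_le _ _).trans ?_
        rw [abs_mul, abs_mul, abs_of_pos hlam, abs_of_pos hL]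
        have := mul_le_mul_of_nonneg_left hq hlam.le
        linarith
      rw [e2, abs_mul, abs_of_nonneg (hθ0 _)]
      have h3 := mul_le_mul_of_nonneg_right (hθ1 (U p)) (abs_nonneg
        (lam * (f (U p + t₁) - f (U p + t₂)) + L * (t₁ - t₂)))
      have h4 := mul_le_mul_of_nonneg_left (h3.trans ((one_mul _).trans_le hA)) hφp.le
      refine h4.trans ?_
      rw [← mul_assoc]
      refine mul_le_mul_of_nonneg_right ?_ (abs_nonneg _)
      have : (dil ε p).2 = p.2 := rfl
      rw [this] at hb
      linarith
  have hG3 : ∀ p, |G p 0| ≤ C₂ * ε ^ 2 := by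
    intro p
    rcases le_or_gt (U p) (-(a / 2)) with hp | hp
    · simp only [hG, hθzero _ hp, zero_mul, abs_zero]
      positivity
    · have hpa : -a ≤ W (dil ε p) := by simp only [hU] at hp; linarith
      have e1 : G p 0 = θ (U p) * (ε ^ 2 * ∑ j : Fin N, D2 W (Pi.single j 1, 0) (dil ε p)) := by
        simp only [hG, hU, lap_comp_dil hW, heq _ hpa, add_zero, mul_zero]
        ring
      have h3 := hC₁ _ hpa
      rw [Real.norm_eq_abs] at h3
      rw [e1, abs_mul, abs_mul, abs_of_nonneg (hθ0 _), abs_of_nonneg (sq_nonneg ε)]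
      calc _ ≤ 1 * (ε ^ 2 * C₂) := by
            gcongr
            · exact hθ1 _
            · exact h3.trans (le_max_left _ _)
        _ = C₂ * ε ^ 2 := by ring
  obtain ⟨w, hw, hwe, hwr, hwd, hweq, hws⟩ := H G {p | dil ε p ∈ {p | -a ≤ W p}} (C₂ * ε ^ 2) hGc
    (isCompact_dil_preimage hε.ne' hK) hG1 hG2 (by positivity) (by nlinarith) hG3
  refine ⟨w, hw, fun p => ?_, hwr, fun p => ?_, fun p hp => ?_, fun σ hσ h1 h2 => ?_⟩
  · rw [mul_assoc]; exact hwe p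
  · rw [mul_assoc]; exact hwd p
  · rw [lap_add hUc hw, hweq, hG]
    simp only
    rw [hθone _ hp]
    ring
  · refine hws σ hσ fun p t => ?_
    simp only [hG]
    rw [h2 p, show U (σ p) = U p from h1 p]

/-- A nonnegative polynomial vanishing exactly at `1, …, k + 1`. -/
def ridge (k : ℕ) (l : ℝ) : ℝ := (∏ i ∈ Finset.range (k + 1), (l - (i + 1))) ^ 2

theorem contDiff_ridge (k : ℕ) : ContDiff ℝ (⊤ : ℕ∞) (ridge k) :=
  (contDiff_prod fun _ _ => contDiff_id.sub contDiff_const).pow 2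

theorem ridge_nonneg (k : ℕ) (l : ℝ) : 0 ≤ ridge k l := sq_nonneg _

theorem ridge_natCast {k i : ℕ} (hi : i ≤ k) : ridge k (i + 1) = 0 := by
  rw [ridge, Finset.prod_eq_zero (i := i) (by simpa using Nat.lt_succ_of_le hi) (by simp)]
  simp

theorem ridge_pos {k : ℕ} {l : ℝ} (hl : ∀ i : ℕ, l ≠ i + 1) : 0 < ridge k l := by
  have : ∏ i ∈ Finset.range (k + 1), (l - ((i : ℝ) + 1)) ≠ 0 :=
    Finset.prod_ne_zero_iff.2 fun i _ => sub_ne_zero.2 (hl i)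
  rw [ridge]
  positivity

theorem sub_pos_of_mem_range {k i : ℕ} {l : ℝ} (hl : (k : ℝ) + 1 < l)
    (hi : i ∈ Finset.range (k + 1)) : 0 < l - ((i : ℝ) + 1) := by
  have : (i : ℝ) ≤ k := by exact_mod_cast Nat.lt_succ_iff.1 (Finset.mem_range.1 hi)
  linarith

theorem deriv_ridge_pos {k : ℕ} {l : ℝ} (hl : (k : ℝ) + 1 < l) : 0 < deriv (ridge k) l := by
  have h1 : HasDerivAt (fun l : ℝ => ∏ i ∈ Finset.range (k + 1), (l - ((i : ℝ) + 1))) _ l :=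
    HasDerivAt.fun_finsetProd fun i _ => (hasDerivAt_id l).sub_const ((i : ℝ) + 1)
  have h2 : HasDerivAt (ridge k) _ l := h1.pow 2
  rw [h2.deriv]
  have h3 : 0 < ∏ i ∈ Finset.range (k + 1), (l - ((i : ℝ) + 1)) :=
    Finset.prod_pos fun i hi => sub_pos_of_mem_range hl hi
  have h4 : 0 < ∑ i ∈ Finset.range (k + 1),
      (∏ j ∈ (Finset.range (k + 1)).erase i, (l - ((j : ℝ) + 1))) • (1 : ℝ) :=
    Finset.sum_pos (fun i _ => smul_pos (Finset.prod_pos fun j hj =>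
      sub_pos_of_mem_range hl (Finset.mem_of_mem_erase hj)) one_pos) ⟨0, by simp⟩
  positivity

theorem le_ridge {k : ℕ} {l : ℝ} (hl : (k : ℝ) + 2 ≤ l) : (l - (k + 1)) ^ 2 ≤ ridge k l := by
  rw [ridge, Finset.prod_range_succ]
  have h1 : 1 ≤ ∏ i ∈ Finset.range k, (l - ((i : ℝ) + 1)) := by
    refine Finset.one_le_prod fun i hi => ?_
    have : (i : ℝ) + 1 ≤ k := by exact_mod_cast Finset.mem_range.1 hi
    linarith
  have h2 : 0 ≤ l - ((k : ℝ) + 1) := by linarith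
  gcongr
  nlinarith

theorem exists_level_profile (k : ℕ) {M δ : ℝ} (hM : 0 < M) (hδ : 0 < δ) :
    ∃ (g : ℝ → ℝ) (M' : ℝ), ContDiff ℝ (⊤ : ℕ∞) g ∧ M' < M ∧ 0 < M' ∧ (∀ l, g l ≤ M') ∧
      M - δ < g 0 ∧ 0 < g 0 ∧ (∀ l, 0 ≤ l → g l = 0 → deriv g l < 0) ∧
      (∀ R, ∃ Λ, ∀ l, Λ ≤ l → g l < R) ∧
      ∀ i : ℕ, i ≤ k → g (i + 1) = M' ∧ g (i + 1 - 1 / 2) < M' ∧ g (i + 1 + 1 / 2) < M' := by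
  set κ := min δ M / 4 with hκ
  have hκ0 : 0 < κ := by positivity
  have hκδ : 4 * κ ≤ δ := by rw [hκ]; linarith [min_le_left δ M]
  have hκM : 4 * κ ≤ M := by rw [hκ]; linarith [min_le_right δ M]
  obtain ⟨B, hB⟩ := (isCompact_Icc (a := (0 : ℝ)) (b := k + 1)).exists_bound_of_continuousOn
    (contDiff_ridge k).continuous.continuousOn
  have hB0 : 0 ≤ B := (norm_nonneg _).trans (hB 0 ⟨le_rfl, by positivity⟩)
  set σ := κ / (B + 1) with hσ
  have hσ0 : 0 < σ := by positivity
  have hσB : ∀ l ∈ Icc (0 : ℝ) (k + 1), σ * ridge k l ≤ κ := fun l hl => by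
    have h1 := (le_abs_self _).trans (hB l hl)
    rw [hσ, div_mul_eq_mul_div, div_le_iff₀ (by positivity)]
    exact mul_le_mul_of_nonneg_left (by linarith) hκ0.le
  have hne : ∀ (i j : ℕ) , (i : ℝ) + 1 - 1 / 2 ≠ j + 1 ∧ (i : ℝ) + 1 + 1 / 2 ≠ j + 1 := by
    intro i j
    constructor <;> intro h
    · have h2 : (2 * (i : ℤ) + 1 : ℝ) = 2 * (j : ℤ) + 2 := by push_cast; linarith
      have : (2 * (i : ℤ) + 1) = 2 * (j : ℤ) + 2 := by exact_mod_cast h2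
      omega
    · have h2 : (2 * (i : ℤ) + 3 : ℝ) = 2 * (j : ℤ) + 2 := by push_cast; linarith
      have : (2 * (i : ℤ) + 3) = 2 * (j : ℤ) + 2 := by exact_mod_cast h2
      omega
  refine ⟨fun l => M - κ - σ * ridge k l, M - κ,
    contDiff_const.sub (contDiff_const.mul (contDiff_ridge k)), by linarith, by linarith,
    fun l => ?_, ?_, ?_, fun l hl h0 => ?_, fun R => ?_, fun i hi => ⟨?_, ?_, ?_⟩⟩
  · linarith [mul_nonneg hσ0.le (ridge_nonneg k l)]
  · linarith [hσB 0 ⟨le_rfl, by positivity⟩]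
  · linarith [hσB 0 ⟨le_rfl, by positivity⟩]
  · have hl' : (k : ℝ) + 1 < l := by
      by_contra! hlk
      linarith [hσB l ⟨hl, hlk⟩]
    have hd : HasDerivAt (fun l => M - κ - σ * ridge k l) (-(σ * deriv (ridge k) l)) l :=
      ((((contDiff_ridge k).differentiable (by simp)) l).hasDerivAt.const_mul σ).const_sub _
    rw [hd.deriv, neg_lt_zero]
    exact mul_pos hσ0 (deriv_ridge_pos hl')
  · refine ⟨k + 2 + |M - R| / σ, fun l hl => ?_⟩
    have h0 : 0 ≤ |M - R| / σ := by positivity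
    have h1 := le_ridge (k := k) (l := l) (by linarith)
    have h2 : 1 + |M - R| / σ ≤ l - (k + 1) := by linarith
    have h3 : 1 + |M - R| / σ ≤ ridge k l := by nlinarith
    have h4 : σ + |M - R| ≤ σ * ridge k l := by
      have := mul_le_mul_of_nonneg_left h3 hσ0.le
      rwa [mul_add, mul_one, mul_div_cancel₀ _ hσ0.ne'] at this
    linarith [le_abs_self (M - R)]
  · simp [ridge_natCast hi]
  · have := mul_pos hσ0 (ridge_pos (k := k) fun j => (hne i j).1)
    linarith
  · have := mul_pos hσ0 (ridge_pos (k := k) fun j => (hne i j).2)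
    linarith

namespace IsFlow

variable {F : ℝ → ℝ} {v : ℝ × ℝ → ℝ}

theorem slope₂_odd (h : IsFlow F v) (m y : ℝ) : slope₂ v (m, -y) = -slope₂ v (m, y) := by
  have h1 : HasDerivAt (fun y => v (m, -y)) _ y :=
    (hasDerivAt_snd h.contDiff m (-y)).scomp y (hasDerivAt_neg y)
  simp only [h.even] at h1
  have := h1.unique (hasDerivAt_snd h.contDiff m y)
  simp only [smul_eq_mul] at this
  simp only [slope₂]
  linarith

theorem mul_slope₂_abs (h : IsFlow F v) (m y : ℝ) :
    |y| * slope₂ v (m, |y|) = y * slope₂ v (m, y) := by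
  rcases abs_choice y with hy | hy <;> rw [hy]
  rw [h.slope₂_odd]
  ring

end IsFlow

namespace IsProfile

variable {f : ℝ → ℝ} {lam : ℝ} {F : ℝ → ℝ} {v : ℝ × ℝ → ℝ} {M α : ℝ}

theorem slope₂_neg (h : IsProfile f lam F v M α) {m y : ℝ} (hm : m ≤ M) (hy : 0 < y)
    (hv : -α ≤ v (m, y)) : slope₂ v (m, y) < 0 := by
  refine h.flow.slope₂_neg h.contDiff_F.continuous h.F_nonneg (fun t h1 h2 => ?_) hy hv
  rw [h.F_eq t ⟨h1, h2.trans hm⟩]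
  exact mul_pos h.lam_pos (h.f_pos t h1)

/-- The transversality behind star-shapedness: on the zero level, slow modulation of the
initial value cannot compensate for the decay in `y`. -/
theorem exists_slow_modulation (h : IsProfile f lam F v M α) {g : ℝ → ℝ} {M' : ℝ}
    (hg : ContDiff ℝ (⊤ : ℕ∞) g) (hM' : M' < M) (hgM : ∀ l, g l ≤ M') (hg0 : 0 < g 0)
    (hgd : ∀ l, 0 ≤ l → g l = 0 → deriv g l < 0) (hgt : ∀ R, ∃ Λ, ∀ l, Λ ≤ l → g l < R) :
    ∃ s > 0, ∀ l y ρ, 0 ≤ l → 0 ≤ ρ → ρ ≤ 2 → (ρ = 0 → l = 0) → v (g l, y) = 0 →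
      slope₁ v (g l, y) * deriv g l * s * ρ + y * slope₂ v (g l, y) < 0 := by
  obtain ⟨a, b, ha, -, -, hb1, hedge⟩ := h.exists_edge hM'
  obtain ⟨Λ, hΛ⟩ := hgt 0
  have hα := h.α_pos
  have hvc := h.flow.contDiff.continuous
  have hpair : Continuous fun q : ℝ × ℝ => (g q.1, q.2) :=
    (hg.continuous.comp continuous_fst).prodMk continuous_snd
  set P : ℝ × ℝ → ℝ := fun q => slope₁ v (g q.1, q.2) * deriv g q.1 with hP
  set Q : ℝ × ℝ → ℝ := fun q => q.2 * slope₂ v (g q.1, q.2) with hQ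
  have hPc : Continuous P :=
    ((contDiff_fderiv_apply h.flow.contDiff ((1, 0) : ℝ × ℝ)).continuous.comp hpair).mul
      ((hg.continuous_deriv (by simp)).comp continuous_fst)
  have hQc : Continuous Q := continuous_snd.mul
    ((contDiff_fderiv_apply h.flow.contDiff ((0, 1) : ℝ × ℝ)).continuous.comp hpair)
  set Z : Set (ℝ × ℝ) := (Icc 0 Λ ×ˢ Icc (-1) 1) ∩ {q | v (g q.1, q.2) = 0} with hZ
  have hZc : IsCompact Z := (isCompact_Icc.prod isCompact_Icc).inter_right
    (isClosed_eq (hvc.comp hpair) continuous_const)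
  have hmem : ∀ l y, 0 ≤ l → v (g l, y) = 0 → (l, y) ∈ Z := by
    intro l y hl hv
    have h1 : l ≤ Λ := by
      by_contra! hlt
      linarith [hΛ l hlt.le, h.flow.le_init h.F_nonneg (g l) y]
    have h2 : |y| ≤ 1 := by
      by_contra! hlt
      linarith [hedge _ (hgM l) y (by linarith)]
    exact ⟨⟨⟨hl, h1⟩, abs_le.1 h2⟩, hv⟩
  have hQneg : ∀ q ∈ Z, q.2 ≠ 0 → Q q < 0 := by
    rintro ⟨l, y⟩ ⟨-, hv⟩ hy
    simp only [mem_ofPred_eq] at hv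
    simp only [hQ]
    rw [← h.flow.mul_slope₂_abs]
    refine mul_neg_of_pos_of_neg (abs_pos.2 hy)
      (h.slope₂_neg ((hgM l).trans hM'.le) (abs_pos.2 hy) ?_)
    rw [h.flow.apply_abs, hv]
    linarith
  have hPneg : ∀ q ∈ Z, q.2 = 0 → P q < 0 := by
    rintro ⟨l, y⟩ ⟨⟨hl, -⟩, hv⟩ (rfl : y = 0)
    simp only [mem_ofPred_eq, h.flow.init] at hv
    simp only [hP]
    rw [h.flow.slope₁_zero, one_mul]
    exact hgd l hl.1 hv
  obtain ⟨B, hB⟩ := hZc.exists_bound_of_continuousOn hPc.continuousOn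
  obtain ⟨κ, hκ, hmax⟩ : ∃ κ > 0, ∀ q ∈ Z, κ ≤ max (-P q) (-Q q) := by
    rcases Z.eq_empty_or_nonempty with he | hne
    · exact ⟨1, one_pos, by simp [he]⟩
    · obtain ⟨q₀, hq₀, hmin⟩ := hZc.exists_isMinOn hne (hPc.neg.max hQc.neg).continuousOn
      refine ⟨_, ?_, fun q hq => hmin hq⟩
      by_cases hq : q₀.2 = 0
      · exact lt_max_of_lt_left (neg_pos.2 (hPneg _ hq₀ hq))
      · exact lt_max_of_lt_right (neg_pos.2 (hQneg _ hq₀ hq))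
  refine ⟨κ / (2 * (|B| + 1) * 2), by positivity, fun l y ρ hl hρ0 hρ2 hρl hv => ?_⟩
  set s := κ / (2 * (|B| + 1) * 2) with hs
  have hs0 : 0 < s := by positivity
  have hq := hmem l y hl hv
  have hPB : P (l, y) ≤ |B| + 1 := by
    linarith [(le_abs_self _).trans (hB _ hq), le_abs_self B]
  have hQ0 : Q (l, y) ≤ 0 := by
    by_cases hy : y = 0
    · simp [hQ, hy]
    · exact (hQneg _ hq hy).le
  have hgoal : P (l, y) * s * ρ + Q (l, y) < 0 := by
    rcases hρ0.eq_or_lt with hρ | hρ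
    · have hl0 := hρl hρ.symm
      have hy : y ≠ 0 := by
        rintro rfl
        rw [hl0, h.flow.init] at hv
        exact hg0.ne' hv
      rw [← hρ, mul_zero, zero_add]
      exact hQneg _ hq hy
    rcases lt_or_ge (P (l, y)) 0 with hPn | hPn
    · have : P (l, y) * s * ρ < 0 := mul_neg_of_neg_of_pos (mul_neg_of_neg_of_pos hPn hs0) hρ
      linarith
    · have h1 : κ ≤ -Q (l, y) := by
        rcases le_max_iff.1 (hmax _ hq) with h1 | h1 <;> linarith
      have h2 : P (l, y) * s * ρ ≤ (|B| + 1) * s * 2 := by gcongr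
      have h3 : (|B| + 1) * s * 2 = κ / 2 := by
        rw [hs]; field_simp
      linarith
  exact hgoal

end IsProfile

/-- An approximate solution in rescaled variables: superposing profiles whose height follows
`k + 1` concentric ridges and then decreases to `-∞`. -/
structure IsLandscape (f : ℝ → ℝ) (lam : ℝ) (k : ℕ) (t₀ : ℝ) (W : Pt N → ℝ) (a : ℝ) : Prop where
  contDiff : ContDiff ℝ (⊤ : ℕ∞) W
  symm_fst : ∀ (j : Fin N) (p : Pt N), W (Function.update p.1 j (-(p.1 j)), p.2) = W p
  symm_snd : ∀ p : Pt N, W (p.1, -p.2) = W p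
  a_pos : 0 < a
  compact : IsCompact {p | -a ≤ W p}
  eqn : ∀ p, -a ≤ W p → D2 W (0, 1) p = -(lam * f (W p))
  outside : ∀ p : Pt N, 1 ≤ |p.2| → W p < -a
  inside : ∀ y, |y| ≤ t₀ → 0 < W (0, y)
  star : ∃ c > 0, ∃ τ > 0, ∀ p, |W p| ≤ τ → fderiv ℝ W p p ≤ -c
  ridges : ∃ (ℓ : Pt N → ℝ) (M' μ : ℝ), Continuous ℓ ∧ 0 < M' ∧ μ < M' ∧ ∀ i : ℕ, i ≤ k →
    (∃ p, ℓ p = i + 1 ∧ W p = M') ∧ ∀ p, |ℓ p - (i + 1)| = 1 / 2 → W p ≤ μ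
  barrier : ∃ (r c c₀ L B : ℝ) (φ : ℝ → ℝ), 0 < r ∧ 0 < c ∧ 0 < c₀ ∧ 0 < L ∧
    ContDiff ℝ (⊤ : ℕ∞) φ ∧ (∀ y, |φ y| ≤ B) ∧ (∀ y, |deriv φ y| ≤ B) ∧
    (∀ y, |deriv (deriv φ) y| ≤ B) ∧ (∀ y, c₀ ≤ φ y) ∧ (∀ y, c ≤ L * φ y - deriv (deriv φ) y) ∧
    ∀ p, -a ≤ W p → ∀ t ≤ W p + r, lam * deriv f t * φ p.2 + c ≤ -deriv (deriv φ) p.2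

/-- The logarithmic radial coordinate. -/
def logRadius (s : ℝ) (X : Fin N → ℝ) : ℝ := s * Real.log (1 + ∑ j, X j ^ 2)

theorem sum_sq_nonneg (X : Fin N → ℝ) : 0 ≤ ∑ j, X j ^ 2 :=
  Finset.sum_nonneg fun _ _ => sq_nonneg _

theorem contDiff_logRadius (s : ℝ) : ContDiff ℝ (⊤ : ℕ∞) (logRadius (N := N) s) := by
  refine contDiff_const.mul (ContDiff.log ?_ fun X => ?_)
  · exact contDiff_const.add (ContDiff.sum fun j _ => (contDiff_apply ℝ ℝ j).pow 2)
  · have := sum_sq_nonneg X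
    positivity

theorem logRadius_nonneg {s : ℝ} (hs : 0 ≤ s) (X : Fin N → ℝ) : 0 ≤ logRadius s X :=
  mul_nonneg hs (Real.log_nonneg (by linarith [sum_sq_nonneg X]))

theorem logRadius_zero (s : ℝ) : logRadius s (0 : Fin N → ℝ) = 0 := by simp [logRadius]

theorem exists_logRadius_eq (hN : 1 ≤ N) {s l : ℝ} (hs : 0 < s) (hl : 0 ≤ l) :
    ∃ X : Fin N → ℝ, logRadius s X = l := by
  have h1 : 0 ≤ Real.exp (l / s) - 1 := by
    linarith [Real.add_one_le_exp (l / s), div_nonneg hl hs.le]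
  refine ⟨Pi.single ⟨0, hN⟩ (Real.sqrt (Real.exp (l / s) - 1)), ?_⟩
  have h2 : ∑ j, (Pi.single (⟨0, hN⟩ : Fin N) (Real.sqrt (Real.exp (l / s) - 1)) : Fin N → ℝ) j ^ 2
      = Real.exp (l / s) - 1 := by
    rw [Finset.sum_eq_single ⟨0, hN⟩]
    · rw [Pi.single_eq_same, Real.sq_sqrt h1]
    · intro j _ hj
      rw [Pi.single_eq_of_ne hj]
      simp
    · simp
  rw [logRadius, h2, add_sub_cancel, Real.log_exp, mul_div_cancel₀ _ hs.ne']

theorem sum_sq_le_exp_logRadius {s : ℝ} (hs : 0 < s) {X : Fin N → ℝ} {Λ : ℝ}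
    (h : logRadius s X ≤ Λ) : ∑ j, X j ^ 2 ≤ Real.exp (Λ / s) := by
  have h0 := sum_sq_nonneg X
  have h1 : Real.log (1 + ∑ j, X j ^ 2) ≤ Λ / s := by
    rw [le_div_iff₀ hs, mul_comm]
    exact h
  have := (Real.log_le_iff_le_exp (by linarith)).1 h1
  linarith

theorem logRadius_update (s : ℝ) (j : Fin N) (X : Fin N → ℝ) :
    logRadius s (Function.update X j (-(X j))) = logRadius s X := by
  have : ∀ i, (Function.update X j (-(X j)) i) ^ 2 = X i ^ 2 := fun i => by
    by_cases hi : i = j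
    · subst hi; simp
    · rw [Function.update_of_ne hi]
  simp only [logRadius, this]

theorem hasDerivAt_logRadius_smul (s : ℝ) (X : Fin N → ℝ) :
    HasDerivAt (fun t : ℝ => logRadius s (t • X))
      (s * (2 * (∑ j, X j ^ 2) / (1 + ∑ j, X j ^ 2))) 1 := by
  have h0 := sum_sq_nonneg X
  have h1 : ∀ t : ℝ, logRadius s (t • X) = s * Real.log (1 + t ^ 2 * ∑ j, X j ^ 2) := fun t => by
    simp only [logRadius, Pi.smul_apply, smul_eq_mul, mul_pow, Finset.mul_sum]
  simp only [h1]
  have h2 : HasDerivAt (fun t : ℝ => 1 + t ^ 2 * ∑ j, X j ^ 2) (2 * ∑ j, X j ^ 2) 1 :=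
    (((((hasDerivAt_id (1 : ℝ)).pow 2).mul_const (∑ j, X j ^ 2)).const_add 1)).congr_deriv (by simp)
  refine ((h2.log (by positivity)).const_mul s).congr_deriv ?_
  simp

theorem hasDerivAt_smul_self {W : Pt N → ℝ} {p : Pt N} (hW : DifferentiableAt ℝ W p) :
    HasDerivAt (fun t : ℝ => W (t • p)) (fderiv ℝ W p p) 1 := by
  have h1 : HasDerivAt (fun t : ℝ => t • p) p 1 :=
    ((hasDerivAt_id (1 : ℝ)).smul_const p).congr_deriv (one_smul _ _)
  have h2 : HasFDerivAt W (fderiv ℝ W p) ((1 : ℝ) • p) := by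
    rw [one_smul]
    exact hW.hasFDerivAt
  exact h2.comp_hasDerivAt (1 : ℝ) h1

/-- The superposition of profiles with heights `g (logRadius s X)`. -/
def modulated (v : ℝ × ℝ → ℝ) (g : ℝ → ℝ) (s : ℝ) (p : Pt N) : ℝ := v (g (logRadius s p.1), p.2)

section modulated

variable {v : ℝ × ℝ → ℝ} {g : ℝ → ℝ}

theorem contDiff_modulated (hv : ContDiff ℝ (⊤ : ℕ∞) v) (hg : ContDiff ℝ (⊤ : ℕ∞) g) (s : ℝ) :
    ContDiff ℝ (⊤ : ℕ∞) (modulated (N := N) v g s) :=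
  hv.comp ((hg.comp ((contDiff_logRadius s).comp contDiff_fst)).prodMk contDiff_snd)

theorem fderiv_modulated_self (hv : ContDiff ℝ (⊤ : ℕ∞) v) (hg : ContDiff ℝ (⊤ : ℕ∞) g) (s : ℝ)
    (p : Pt N) : fderiv ℝ (modulated v g s) p p =
      slope₁ v (g (logRadius s p.1), p.2) * deriv g (logRadius s p.1) * s *
        (2 * (∑ j, p.1 j ^ 2) / (1 + ∑ j, p.1 j ^ 2)) +
      p.2 * slope₂ v (g (logRadius s p.1), p.2) := by
  have hW := (contDiff_modulated (N := N) hv hg s).differentiable (by simp) p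
  have h2 := hasDerivAt_smul_self hW
  have h3 : HasDerivAt (fun t : ℝ => g (logRadius s (t • p.1))) _ 1 :=
    HasDerivAt.comp (1 : ℝ) (by rw [one_smul]; exact (hg.differentiable (by simp) _).hasDerivAt)
      (hasDerivAt_logRadius_smul s p.1)
  have h4 : HasDerivAt (fun t : ℝ => t * p.2) p.2 1 :=
    ((hasDerivAt_id (1 : ℝ)).mul_const p.2).congr_deriv (one_mul _)
  have h5 : HasDerivAt (fun t : ℝ => v (g (logRadius s (t • p.1)), t * p.2)) _ 1 :=
    HasFDerivAt.comp_hasDerivAt (1 : ℝ)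
      (by rw [one_smul, one_mul]; exact (hv.differentiable (by simp) _).hasFDerivAt) (h3.prodMk h4)
  have h6 := h2.unique h5
  have h7 : ∀ (T : ℝ × ℝ →L[ℝ] ℝ) (x y : ℝ), T (x, y) = x * T (1, 0) + y * T (0, 1) := by
    intro T x y
    have : ((x, y) : ℝ × ℝ) = x • (1, 0) + y • (0, 1) := by simp
    rw [this, map_add, map_smul, map_smul, smul_eq_mul, smul_eq_mul]
  rw [h6, h7, slope₁, slope₂]
  ring

theorem hasDerivAt_pt_snd {W : Pt N → ℝ} (hW : ContDiff ℝ (⊤ : ℕ∞) W) (X : Fin N → ℝ) (y : ℝ) :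
    HasDerivAt (fun y => W (X, y)) (fderiv ℝ W (X, y) (0, 1)) y :=
  ((hW.differentiable (by simp)) (X, y)).hasFDerivAt.comp_hasDerivAt y
    ((hasDerivAt_const y X).prodMk (hasDerivAt_id y))

theorem D2_modulated_snd {F : ℝ → ℝ} (hflow : IsFlow F v) (hF : Continuous F)
    (hg : ContDiff ℝ (⊤ : ℕ∞) g) (s : ℝ) (p : Pt N) :
    D2 (modulated v g s) (0, 1) p = -F (modulated v g s p) := by
  have hW := contDiff_modulated (N := N) hflow.contDiff hg s
  obtain ⟨X, y⟩ := p
  refine (hasDerivAt_pt_snd (contDiff_fderiv_apply hW (0, 1)) X y).unique ?_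
  have : (fun y => fderiv ℝ (modulated v g s) (X, y) (0, 1)) =
      fun y => slope₂ v (g (logRadius s X), y) := funext fun y =>
    (hasDerivAt_pt_snd hW X y).unique (hasDerivAt_snd hflow.contDiff (g (logRadius s X)) y)
  rw [this]
  exact hflow.hasDerivAt_slope₂ hF _ y

end modulated

/-- Transversality on a compact zero level persists on nearby levels. -/
theorem exists_uniform_transversality {W S : Pt N → ℝ} (hW : Continuous W) (hS : Continuous S)
    {a : ℝ} (ha : 0 < a) (hK : IsCompact {p | -a ≤ W p}) (h : ∀ p, W p = 0 → S p < 0) :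
    ∃ c > 0, ∃ τ > 0, ∀ p, |W p| ≤ τ → S p ≤ -c := by
  rcases Set.eq_empty_or_nonempty {p | -a ≤ W p} with he | hne
  · refine ⟨1, one_pos, a, ha, fun p hp => ?_⟩
    have : p ∈ {p | -a ≤ W p} := (abs_le.1 hp).1
    rw [he] at this
    exact this.elim
  obtain ⟨p₀, -, hmin⟩ := hK.exists_isMinOn hne (hW.abs.max hS.neg).continuousOn
  have hκ : 0 < max |W p₀| (-S p₀) := by
    by_cases h0 : W p₀ = 0
    · exact lt_max_of_lt_right (neg_pos.2 (h p₀ h0))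
    · exact lt_max_of_lt_left (abs_pos.2 h0)
  set κ := max |W p₀| (-S p₀)
  refine ⟨κ, hκ, min (κ / 2) a, by positivity, fun p hp => ?_⟩
  have h1 : |W p| ≤ κ / 2 := hp.trans (min_le_left _ _)
  have h2 : κ ≤ max |W p| (-S p) := hmin (abs_le.1 (hp.trans (min_le_right _ _))).1
  rcases le_max_iff.1 h2 with h3 | h3 <;> linarith

namespace IsProfile

variable {f : ℝ → ℝ} {lam : ℝ} {F : ℝ → ℝ} {v : ℝ × ℝ → ℝ} {M α : ℝ}

theorem top_pos (h : IsProfile f lam F v M α) {y : ℝ} (hy : 0 ≤ y) (hy1 : y < 1) :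
    0 < v (M, y) := by
  have hanti : StrictAntiOn (fun y => v (M, y)) (Icc y 1) := by
    refine strictAntiOn_of_deriv_neg (convex_Icc _ _)
      (h.flow.contDiff.continuous.comp (by fun_prop)).continuousOn fun x hx => ?_
    rw [interior_Icc] at hx
    rw [(hasDerivAt_snd h.flow.contDiff M x).deriv]
    refine h.slope₂_neg le_rfl (hy.trans_lt hx.1) ?_
    linarith [h.top_nonneg (hy.trans hx.1.le) hx.2.le, h.α_pos]
  have := hanti ⟨le_rfl, hy1.le⟩ ⟨hy1.le, le_rfl⟩ hy1
  simp only [h.top] at this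
  exact this

theorem exists_landscape (h : IsProfile f lam F v M α) (hN : 1 ≤ N) (k : ℕ) {t₀ : ℝ}
    (ht₀ : 0 ≤ t₀) (ht₁ : t₀ < 1) : ∃ (W : Pt N → ℝ) (a : ℝ), IsLandscape f lam k t₀ W a := by
  have hvc := h.flow.contDiff.continuous
  obtain ⟨δ, hδ, hδv⟩ : ∃ δ > 0, ∀ m, |m - M| < δ → 0 < v (m, t₀) := by
    have hc : ContinuousAt (fun m => v (m, t₀)) M := (hvc.comp (by fun_prop)).continuousAt
    obtain ⟨δ, hδ, hb⟩ := Metric.eventually_nhds_iff.1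
      (hc.eventually_const_lt (h.top_pos ht₀ ht₁))
    exact ⟨δ, hδ, fun m hm => hb (by rwa [Real.dist_eq])⟩
  obtain ⟨g, M', hg, hM'M, hM'0, hgM, hg0δ, hg0, hgd, hgt, hgi⟩ := exists_level_profile k h.M_pos hδ
  obtain ⟨s, hs, hsv⟩ := h.exists_slow_modulation hg hM'M hgM hg0 hgd hgt
  obtain ⟨a, b, r, c, c₀, L, B, φ, ha, haα, hb0, hb1, hr, hc, hc₀, hL, hφ, hφ0, hφ1, hφ2, hφc, hφL,
    hedge, hbar⟩ := h.exists_barrier hM'M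
  have hW := contDiff_modulated (N := N) h.flow.contDiff hg s
  have hK : IsCompact {p : Pt N | -a ≤ modulated v g s p} := by
    obtain ⟨Λ, hΛ⟩ := hgt (-a)
    refine Metric.isCompact_of_isClosed_isBounded (isClosed_le continuous_const hW.continuous) ?_
    refine (Metric.isBounded_closedBall (x := (0 : Pt N))
      (r := Real.sqrt (Real.exp (Λ / s) + 1))).subset fun p hp => ?_
    have hp : -a ≤ v (g (logRadius s p.1), p.2) := hp
    rw [mem_closedBall_zero_iff]
    refine Real.le_sqrt_of_sq_le ((sq_norm_le_sqSum p).trans ?_)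
    have h1 : logRadius s p.1 ≤ Λ := by
      by_contra! hlt
      linarith [hΛ _ hlt.le, h.flow.le_init h.F_nonneg (g (logRadius s p.1)) p.2]
    have h2 : |p.2| ≤ 1 := by
      by_contra! hlt
      linarith [hedge _ (hgM (logRadius s p.1)) p.2 (by linarith)]
    have h3 := sum_sq_le_exp_logRadius hs h1
    have h4 := (sq_le_one_iff_abs_le_one _).2 h2
    unfold sqSum
    linarith
  refine ⟨modulated v g s, a, hW, fun j p => ?_, fun p => ?_, ha, hK,
    fun p hp => ?_, fun p hp => ?_,
    fun y hy => ?_, ?_, ?_, ?_⟩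
  · simp only [modulated, logRadius_update]
  · exact h.flow.even _ _
  · rw [D2_modulated_snd h.flow h.contDiff_F.continuous hg, h.F_eq]
    exact ⟨by linarith, (h.flow.le_init h.F_nonneg _ _).trans ((hgM _).trans hM'M.le)⟩
  · exact hedge _ (hgM _) _ (by linarith)
  · simp only [modulated, logRadius_zero]
    rw [← h.flow.apply_abs]
    refine lt_of_lt_of_le (hδv (g 0) ?_) (h.flow.antitoneOn h.F_nonneg _ (abs_nonneg y) ht₀ hy)
    rw [abs_lt]
    constructor <;> linarith [hgM 0]
  · refine exists_uniform_transversality hW.continuous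
      ((hW.continuous_fderiv (by simp)).clm_apply continuous_id) ha hK fun p hp => ?_
    have h0 := sum_sq_nonneg p.1
    rw [fderiv_modulated_self h.flow.contDiff hg]
    refine hsv _ _ _ (logRadius_nonneg hs.le _) (by positivity) ?_ (fun hρ => ?_) hp
    · rw [div_le_iff₀ (by positivity)]
      linarith
    · have : ∑ j, p.1 j ^ 2 = 0 := by
        rcases div_eq_zero_iff.1 hρ with h1 | h1 <;> linarith
      rw [logRadius, this]
      simp
  · obtain ⟨μ, hμM, hμ⟩ : ∃ μ < M', ∀ i ∈ Finset.range (k + 1),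
        g ((i : ℝ) + 1 - 1 / 2) ≤ μ ∧ g ((i : ℝ) + 1 + 1 / 2) ≤ μ := by
      have hne : (Finset.range (k + 1)).Nonempty := ⟨0, by simp⟩
      refine ⟨(Finset.range (k + 1)).sup' hne
        fun i => max (g ((i : ℝ) + 1 - 1 / 2)) (g ((i : ℝ) + 1 + 1 / 2)), ?_, fun i hi => ?_⟩
      · refine (Finset.sup'_lt_iff hne).2 fun i hi => max_lt ?_ ?_
        · exact (hgi i (Nat.lt_succ_iff.1 (Finset.mem_range.1 hi))).2.1
        · exact (hgi i (Nat.lt_succ_iff.1 (Finset.mem_range.1 hi))).2.2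
      · exact max_le_iff.1 (Finset.le_sup' (fun i : ℕ =>
          max (g ((i : ℝ) + 1 - 1 / 2)) (g ((i : ℝ) + 1 + 1 / 2))) hi)
    refine ⟨fun p => logRadius s p.1, M', μ, (contDiff_logRadius s).continuous.comp continuous_fst,
      hM'0, hμM, fun i hi => ⟨?_, fun p hp => ?_⟩⟩
    · obtain ⟨X, hX⟩ := exists_logRadius_eq hN hs (by positivity : (0 : ℝ) ≤ i + 1)
      refine ⟨(X, 0), hX, ?_⟩
      simp only [modulated, h.flow.init, hX]
      exact (hgi i hi).1
    · refine (h.flow.le_init h.F_nonneg _ _).trans ?_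
      obtain ⟨h1, h2⟩ := hμ i (Finset.mem_range.2 (Nat.lt_succ_iff.2 hi))
      rcases (abs_eq (by norm_num)).1 hp with h3 | h3
      · rwa [show logRadius s p.1 = i + 1 + 1 / 2 by linarith]
      · rwa [show logRadius s p.1 = i + 1 - 1 / 2 by linarith]
  · exact ⟨r, c, c₀, L, B, φ, hr, hc, hc₀, hL, hφ, hφ0, hφ1, hφ2, hφc, hφL,
      fun p hp t ht => hbar _ (hgM _) _ hp t ht⟩

end IsProfile

/-- The diagonal map with entries `c` on `ℝ^N` and `d` on the last coordinate. -/
def diagMap (c : Fin N → ℝ) (d : ℝ) : Pt N →L[ℝ] Pt N :=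
  ((ContinuousLinearMap.pi fun i => c i •
      ContinuousLinearMap.proj (R := ℝ) (φ := fun _ => ℝ) i).comp
    (ContinuousLinearMap.fst ℝ (Fin N → ℝ) ℝ)).prod (d • ContinuousLinearMap.snd ℝ (Fin N → ℝ) ℝ)

theorem diagMap_apply (c : Fin N → ℝ) (d : ℝ) (p : Pt N) :
    diagMap c d p = (fun i => c i * p.1 i, d * p.2) := rfl

theorem diagMap_diagMap {c : Fin N → ℝ} {d : ℝ} (hc : ∀ i, c i ^ 2 = 1) (hd : d ^ 2 = 1)
    (p : Pt N) : diagMap c d (diagMap c d p) = p := by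
  simp only [diagMap_apply, ← mul_assoc, ← sq, hc, hd, one_mul]

/-- A diagonal sign change, as a linear automorphism. -/
def signChange {c : Fin N → ℝ} {d : ℝ} (hc : ∀ i, c i ^ 2 = 1) (hd : d ^ 2 = 1) :
    Pt N ≃L[ℝ] Pt N :=
  ContinuousLinearEquiv.equivOfInverse (diagMap c d) (diagMap c d) (diagMap_diagMap hc hd)
    (diagMap_diagMap hc hd)

theorem signChange_apply {c : Fin N → ℝ} {d : ℝ} (hc : ∀ i, c i ^ 2 = 1) (hd : d ^ 2 = 1)
    (p : Pt N) : signChange hc hd p = diagMap c d p := rfl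

theorem measurePreserving_mul_sign {c : ℝ} (hc : c ^ 2 = 1) :
    MeasurePreserving fun x : ℝ => c * x := by
  rcases mul_self_eq_one_iff.1 ((sq c).symm.trans hc) with rfl | rfl
  · simp only [one_mul]
    exact MeasurePreserving.id _
  · simpa using Measure.measurePreserving_neg (volume : Measure ℝ)

theorem isSymmetry_signChange {c : Fin N → ℝ} {d : ℝ} (hc : ∀ i, c i ^ 2 = 1) (hd : d ^ 2 = 1) :
    IsSymmetry (signChange hc hd) where
  measurePreserving := by
    have := (volume_preserving_pi fun i => measurePreserving_mul_sign (hc i)).prod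
      (measurePreserving_mul_sign hd)
    exact this
  sqSum_apply z := by
    simp only [signChange_apply, diagMap_apply, sqSum, mul_pow, hc, hd, one_mul]

theorem lap_comp_signChange {U : Pt N → ℝ} (hU : ContDiff ℝ (⊤ : ℕ∞) U) {c : Fin N → ℝ} {d : ℝ}
    (hc : ∀ i, c i ^ 2 = 1) (hd : d ^ 2 = 1) (h : ∀ p, U (signChange hc hd p) = U p) (p : Pt N) :
    lap U (signChange hc hd p) = lap U p := by
  have h1 := lap_comp_signs hU (diagMap c d) (fun j => ⟨c j, hc j, ?_⟩) ⟨d, hd, ?_⟩ p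
  · have h2 : (fun q => U (diagMap c d q)) = U := funext h
    rw [signChange_apply, ← h1, h2]
  · refine Prod.ext (funext fun i => ?_) (by simp [diagMap_apply])
    by_cases hi : i = j
    · subst hi; simp [diagMap_apply]
    · simp [diagMap_apply, hi]
  · refine Prod.ext (funext fun i => ?_) ?_ <;> simp [diagMap_apply]

theorem update_neg_eq (j : Fin N) (X : Fin N → ℝ) :
    Function.update X j (-(X j)) = fun i => Function.update (1 : Fin N → ℝ) j (-1) i * X i := by
  funext i
  by_cases hi : i = j
  · subst hi; simp
  · simp [Function.update_of_ne hi]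

theorem update_one_sq (j i : Fin N) : (Function.update (1 : Fin N → ℝ) j (-1) i) ^ 2 = 1 := by
  by_cases hi : i = j
  · subst hi; simp
  · simp [Function.update_of_ne hi]

section positivity_set

variable {u : Pt N → ℝ}

theorem eq_zero_of_mem_frontier (hu : Continuous u) {p : Pt N} (hp : p ∈ frontier {p | 0 < u p}) :
    u p = 0 :=
  (frontier_lt_subset_eq continuous_const hu hp).symm

theorem smoothBoundary_of_transversal (hu : ContDiff ℝ (⊤ : ℕ∞) u)
    (h : ∀ p, u p = 0 → fderiv ℝ u p p < 0) : SmoothBoundary {p | 0 < u p} := by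
  intro p hp
  have h0 := h p (eq_zero_of_mem_frontier hu.continuous hp)
  refine ⟨fun q => -u q, hu.neg.contDiffAt, fun h1 => ?_, Eventually.of_forall fun q => ?_⟩
  · rw [fderiv_fun_neg, neg_eq_zero] at h1
    rw [h1] at h0
    simp at h0
  · simp

theorem starShaped_of_transversal (hu : ContDiff ℝ (⊤ : ℕ∞) u)
    (h : ∀ p, u p = 0 → fderiv ℝ u p p < 0) {p : Pt N} (hp : 0 < u p) {t : ℝ}
    (ht : t ∈ Ioc (0 : ℝ) 1) : 0 < u (t • p) := by
  by_contra! hle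
  have hd : ∀ s : ℝ, HasDerivAt (fun s : ℝ => u (s • p)) (fderiv ℝ u (s • p) p) s := fun s =>
    ((hu.differentiable (by simp) (s • p)).hasFDerivAt.comp_hasDerivAt s
      ((hasDerivAt_id s).smul_const p)).congr_deriv (by simp)
  have hcont : Continuous fun s : ℝ => u (s • p) :=
    hu.continuous.comp (continuous_id.smul continuous_const)
  have hA : IsCompact (Icc t 1 ∩ {s | u (s • p) ≤ 0}) :=
    isCompact_Icc.inter_right (isClosed_le hcont continuous_const)
  obtain ⟨s, ⟨hs, hs0⟩, hmax⟩ := hA.exists_isGreatest ⟨t, ⟨le_rfl, ht.2⟩, hle⟩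
  have hspos : 0 < s := ht.1.trans_le hs.1
  have hs1 : s < 1 := by
    refine lt_of_le_of_ne hs.2 fun h1 => ?_
    simp only [mem_ofPred_eq, h1, one_smul] at hs0
    linarith
  have hright : ∀ x ∈ Ioc s 1, 0 < u (x • p) := by
    intro x hx
    by_contra! hx0
    exact hx.1.not_ge (hmax ⟨⟨hs.1.trans hx.1.le, hx.2⟩, hx0⟩)
  have hev : ∀ᶠ x in 𝓝[>] s, 0 < u (x • p) :=
    mem_of_superset (Ioc_mem_nhdsGT hs1) hright
  have hzero : u (s • p) = 0 := le_antisymm hs0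
    (ge_of_tendsto (hcont.continuousWithinAt (s := Ioi s) (x := s)) (hev.mono fun _ h => h.le))
  have hneg : fderiv ℝ u (s • p) p < 0 := by
    have := h _ hzero
    rw [map_smul, smul_eq_mul] at this
    exact neg_of_mul_neg_right this hspos.le
  have hslope := (hasDerivAt_iff_tendsto_slope.1 (hd s)).mono_left
    (nhdsWithin_mono s (fun x (hx : s < x) => hx.ne') : 𝓝[>] s ≤ 𝓝[≠] s)
  obtain ⟨x, hx, hx0, hxs⟩ := ((hslope.eventually_lt_const hneg).and
    (hev.and self_mem_nhdsWithin)).exists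
  rw [slope_def_field, hzero, sub_zero] at hx
  exact absurd (div_pos hx0 (sub_pos.2 hxs)) hx.not_gt

end positivity_set

theorem volume_abs_snd_eq_one : volume {p : Pt N | |p.2| = 1} = 0 := by
  have : {p : Pt N | |p.2| = 1} = univ ×ˢ ({1, -1} : Set ℝ) := by
    ext p
    simp [abs_eq]
  have h0 : volume ({1, -1} : Set ℝ) = 0 := (Set.toFinite _).measure_zero _
  rw [this, Measure.volume_eq_prod, Measure.prod_prod, h0, mul_zero]

theorem exists_thin_layer {K : Set (Pt N)} (hK : IsCompact K) {η : ℝ} (hη : 0 < η) :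
    ∃ t₀ : ℝ, 0 ≤ t₀ ∧ t₀ < 1 ∧
      volume (K ∩ {p : Pt N | t₀ ≤ |p.2| ∧ |p.2| ≤ 1}) < ENNReal.ofReal η := by
  set t : ℕ → ℝ := fun n => 1 - 1 / ((n : ℝ) + 1) with ht
  have hpos : ∀ n : ℕ, 0 < 1 / ((n : ℝ) + 1) := fun n => by positivity
  have hmono : Monotone t := fun m n hmn => by
    simp only [ht]
    have : 1 / ((n : ℝ) + 1) ≤ 1 / ((m : ℝ) + 1) := by gcongr
    linarith
  have hclosed : ∀ n, IsClosed {p : Pt N | t n ≤ |p.2| ∧ |p.2| ≤ 1} := fun n =>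
    (isClosed_le continuous_const continuous_snd.abs).inter
      (isClosed_le continuous_snd.abs continuous_const)
  have hanti : Antitone fun n => K ∩ {p : Pt N | t n ≤ |p.2| ∧ |p.2| ≤ 1} :=
    fun m n hmn p hp => ⟨hp.1, (hmono hmn).trans hp.2.1, hp.2.2⟩
  have hlim := tendsto_measure_iInter_atTop (μ := (volume : Measure (Pt N)))
    (fun n => (hK.isClosed.inter (hclosed n)).measurableSet.nullMeasurableSet) hanti
    ⟨0, ((measure_mono inter_subset_left).trans_lt hK.measure_lt_top).ne⟩
  have hzero : volume (⋂ n, K ∩ {p : Pt N | t n ≤ |p.2| ∧ |p.2| ≤ 1}) = 0 := by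
    refine measure_mono_null (fun p hp => ?_) volume_abs_snd_eq_one
    rw [mem_iInter] at hp
    have h1 : Tendsto t atTop (𝓝 1) := by
      simpa [ht] using (tendsto_one_div_add_atTop_nhds_zero_nat (𝕜 := ℝ)).const_sub 1
    exact le_antisymm (hp 0).2.2 (le_of_tendsto' h1 fun n => (hp n).2.1)
  rw [hzero] at hlim
  obtain ⟨n, hn⟩ := (hlim.eventually_lt_const (ENNReal.ofReal_pos.2 hη)).exists
  refine ⟨t n, ?_, by linarith [hpos n], hn⟩
  simp only [ht, sub_nonneg]
  rw [div_le_one (by positivity)]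
  linarith [(Nat.cast_nonneg n : (0 : ℝ) ≤ n)]

theorem continuous_dil : Continuous fun q : ℝ × Pt N => dil q.1 q.2 :=
  (continuous_fst.smul (continuous_fst.comp continuous_snd)).prodMk
    (continuous_snd.comp continuous_snd)

theorem norm_le_inv_mul_norm_dil {ε : ℝ} (hε : 0 < ε) (hε1 : ε ≤ 1) (p : Pt N) :
    ‖p‖ ≤ ε⁻¹ * ‖dil ε p‖ := by
  rw [inv_mul_eq_div, le_div_iff₀ hε, dil_apply, Prod.norm_def, Prod.norm_def]
  simp only [norm_smul, Real.norm_of_nonneg hε.le]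
  rcases le_total ‖p.1‖ ‖p.2‖ with h | h
  · rw [max_eq_right h]
    exact (mul_le_of_le_one_right (norm_nonneg _) hε1).trans (le_max_right _ _)
  · rw [max_eq_left h, mul_comm]
    exact le_max_left _ _

theorem dil_signChange (ε : ℝ) {c : Fin N → ℝ} {d : ℝ} (hc : ∀ i, c i ^ 2 = 1) (hd : d ^ 2 = 1)
    (p : Pt N) : dil ε (signChange hc hd p) = signChange hc hd (dil ε p) := by
  simp only [signChange_apply, diagMap_apply, dil_apply]
  refine Prod.ext (funext fun i => ?_) rfl
  simp only [Pi.smul_apply, smul_eq_mul]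
  ring

namespace IsLandscape

variable {f : ℝ → ℝ} {lam : ℝ} {k : ℕ} {t₀ : ℝ} {W : Pt N → ℝ} {a : ℝ}

theorem exists_bound (h : IsLandscape f lam k t₀ W a) : ∃ R > 0, ∀ p, -a ≤ W p → ‖p‖ ≤ R := by
  obtain ⟨R, hR⟩ := h.compact.isBounded.exists_norm_le
  exact ⟨max R 1, by positivity, fun p hp => (hR p hp).trans (le_max_left _ _)⟩

theorem eventually_pos (h : IsLandscape f lam k t₀ W a) {K : Set (Pt N)} (hK : IsCompact K)
    (C : ℝ) : ∀ᶠ ε in 𝓝 (0 : ℝ), ∀ p ∈ K ∩ {p | |p.2| ≤ t₀}, C * ε ^ 2 < W (dil ε p) := by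
  have hK' : IsCompact (K ∩ {p : Pt N | |p.2| ≤ t₀}) :=
    hK.inter_right (isClosed_le continuous_snd.abs continuous_const)
  refine hK'.eventually_forall_of_forall_eventually fun p hp => ?_
  have hcont : Continuous fun q : ℝ × Pt N => W (dil q.1 q.2) - C * q.1 ^ 2 :=
    (h.contDiff.continuous.comp continuous_dil).sub
      (continuous_const.mul (continuous_fst.pow 2))
  have h0 : 0 < W (dil 0 p) - C * 0 ^ 2 := by
    simpa [dil_apply] using h.inside p.2 hp.2
  filter_upwards [(hcont.tendsto ((0 : ℝ), p)).eventually_const_lt h0] with q hq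
  linarith

theorem exists_solution (h : IsLandscape f lam k t₀ W a) (hf : ContDiff ℝ (⊤ : ℕ∞) f)
    (hmono : Monotone f) (hconv : ConvexOn ℝ univ f) (hlam : 0 < lam) {K : Set (Pt N)}
    (hK : IsCompact K) {δ : ℝ} (hδ : 0 < δ) :
    ∃ ε > 0, ∃ u : Pt N → ℝ, ContDiff ℝ (⊤ : ℕ∞) u ∧ (∀ p, |u p - W (dil ε p)| ≤ δ) ∧
      (∀ p, u p = 0 → fderiv ℝ u p p < 0) ∧ (∀ p ∈ K, |p.2| ≤ t₀ → 0 < u p) ∧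
      (∀ (j : Fin N) (p : Pt N), u (Function.update p.1 j (-(p.1 j)), p.2) = u p) ∧
      (∀ p : Pt N, u (p.1, -p.2) = u p) ∧ (∀ p, 0 < u p → lap u p = -(lam * f (u p))) ∧
      Stable {p | 0 < u p} fun p => lam * deriv f (u p) := by
  obtain ⟨r, c, c₀, L, B, φ, hr, hc, hc₀, hL, hφ, h0, h1, h2, hφ₀, hψ, hbar⟩ := h.barrier
  obtain ⟨c', hc', τ, hτ, hstar⟩ := h.star
  obtain ⟨R, hR, hRb⟩ := h.exists_bound
  have ha := h.a_pos
  obtain ⟨C, hC, ε₁, hε₁, H⟩ := exists_correction h.contDiff hf hmono hconv hlam ha hr hc hc₀ hL hφ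
    h0 h1 h2 hφ₀ hψ h.compact h.eqn hbar
  set e := min δ (min τ (a / 8)) with he
  have hepos : 0 < e := by positivity
  have hsq : ∀ᶠ ε in 𝓝 (0 : ℝ), C * ε ^ 2 < e :=
    (show Continuous fun ε : ℝ => C * ε ^ 2 by fun_prop).continuousAt.eventually_lt_const
      (by simpa using hepos)
  have hlin : ∀ᶠ ε in 𝓝 (0 : ℝ), C * R * ε < c' :=
    (show Continuous fun ε : ℝ => C * R * ε by fun_prop).continuousAt.eventually_lt_const
      (by simpa using hc')
  have hall : ∀ᶠ ε in 𝓝[>] (0 : ℝ), 0 < ε ∧ ε < 1 ∧ ε < ε₁ ∧ C * ε ^ 2 < e ∧ C * R * ε < c' ∧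
      ∀ p ∈ K ∩ {p | |p.2| ≤ t₀}, C * ε ^ 2 < W (dil ε p) :=
    eventually_mem_nhdsWithin.and (((eventually_lt_nhds one_pos).and
      ((eventually_lt_nhds hε₁).and (hsq.and (hlin.and (h.eventually_pos hK C))))).filter_mono
        nhdsWithin_le_nhds)
  obtain ⟨ε, hε, hε1, hεε, hCe, hCR, hKpos⟩ := hall.exists
  obtain ⟨w, hw, hwC, hwr, hwd, hweq, hwσ⟩ := H ε hε hεε.le
  have hwe : ∀ p, |w p| ≤ e := fun p => (hwC p).trans hCe.le
  have heδ : e ≤ δ := min_le_left _ _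
  have heτ : e ≤ τ := (min_le_right _ _).trans (min_le_left _ _)
  have hea : e ≤ a / 8 := (min_le_right _ _).trans (min_le_right _ _)
  have hU : ContDiff ℝ (⊤ : ℕ∞) fun q => W (dil ε q) := h.contDiff.comp (dil ε).contDiff
  have hlow : ∀ p, 0 < W (dil ε p) + w p → -(a / 4) ≤ W (dil ε p) := fun p hp => by
    linarith [(abs_le.1 (hwe p)).2]
  have hsymm : ∀ {s : Fin N → ℝ} {d : ℝ} (hs : ∀ i, s i ^ 2 = 1) (hd : d ^ 2 = 1),
      (∀ p, W (signChange hs hd p) = W p) → ∀ p, W (dil ε (signChange hs hd p)) +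
        w (signChange hs hd p) = W (dil ε p) + w p := by
    intro s d hs hd hW p
    have hWd : ∀ p, W (dil ε (signChange hs hd p)) = W (dil ε p) := fun p => by
      rw [dil_signChange, hW]
    rw [hWd, hwσ _ (isSymmetry_signChange hs hd) hWd (lap_comp_signChange hU hs hd hWd)]
  refine ⟨ε, hε, fun p => W (dil ε p) + w p, hU.add hw, fun p => ?_, fun p hp => ?_,
    fun p hpK hp => ?_, fun j p => ?_, fun p => ?_, fun p hp => hweq p (hlow p hp), ?_⟩
  · rw [add_sub_cancel_left]
    exact (hwe p).trans heδ
  · have hWp : |W (dil ε p)| ≤ e := by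
      rw [eq_neg_of_add_eq_zero_left hp, abs_neg]
      exact hwe p
    have hd : fderiv ℝ (fun p => W (dil ε p) + w p) p p =
        fderiv ℝ W (dil ε p) (dil ε p) + fderiv ℝ w p p := by
      rw [fderiv_fun_add (hU.differentiable (by simp) p) (hw.differentiable (by simp) p),
        add_apply, fderiv_comp_clm h.contDiff]
    have hpR : ‖p‖ ≤ ε⁻¹ * R := (norm_le_inv_mul_norm_dil hε hε1.le p).trans
      (mul_le_mul_of_nonneg_left (hRb _ (by linarith [(abs_le.1 hWp).1])) (by positivity))
    have hwp : |fderiv ℝ w p p| ≤ C * R * ε := by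
      calc |fderiv ℝ w p p| ≤ ‖fderiv ℝ w p‖ * ‖p‖ := (fderiv ℝ w p).le_opNorm p
        _ ≤ C * ε ^ 2 * (ε⁻¹ * R) := by gcongr; exact hwd p
        _ = C * R * ε := by field_simp
    linarith [hstar _ (hWp.trans heτ), (abs_le.1 hwp).2]
  · linarith [hKpos p ⟨hpK, hp⟩, (abs_le.1 (hwC p)).1]
  · have hW : ∀ q, W (signChange (update_one_sq j) (one_pow 2) q) = W q := fun q => by
      rw [← h.symm_fst j q, update_neg_eq, signChange_apply, diagMap_apply, one_mul]
    have := hsymm (update_one_sq j) (one_pow 2) hW p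
    rwa [signChange_apply, diagMap_apply, one_mul, ← update_neg_eq] at this
  · have hd : (-1 : ℝ) ^ 2 = 1 := by norm_num
    have hW : ∀ q, W (signChange (fun _ : Fin N => one_pow 2) hd q) = W q := fun q => by
      rw [← h.symm_snd q, signChange_apply, diagMap_apply]
      simp
    have := hsymm (fun _ => one_pow 2) hd hW p
    simpa only [signChange_apply, diagMap_apply, one_mul, neg_one_mul] using this
  · refine stable_of_barrier (continuous_const.mul ((hf.continuous_deriv (by simp)).comp
      (hU.add hw).continuous)) hφ (fun y => hc₀.trans_le (hφ₀ y)) hc fun p hp => ?_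
    exact hbar (dil ε p) (by linarith [hlow p hp]) _ (by linarith [(abs_le.1 (hwr p)).2])

theorem exists_localMax (h : IsLandscape f lam k t₀ W a) :
    ∃ δ > 0, δ < a ∧ ∀ ε > 0, ∀ u : Pt N → ℝ, Continuous u → (∀ p, |u p - W (dil ε p)| ≤ δ) →
      ∃ S : Finset (Pt N), k ≤ S.card ∧ ∀ p ∈ S, 0 < u p ∧ IsLocalMax u p := by
  obtain ⟨ℓ, M, μ, hℓ, hM, hμ, hridge⟩ := h.ridges
  have ha := h.a_pos
  set δ := min (M / 2) (min ((M - μ) / 4) (a / 2)) with hδ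
  have hMμ := sub_pos.2 hμ
  have hδpos : 0 < δ := by positivity
  have hδM : δ ≤ M / 2 := min_le_left _ _
  have hδμ : δ ≤ (M - μ) / 4 := (min_le_right _ _).trans (min_le_left _ _)
  have hδa : δ ≤ a / 2 := (min_le_right _ _).trans (min_le_right _ _)
  refine ⟨δ, hδpos, by linarith, fun ε hε u hu huW => ?_⟩
  have hdil : Continuous (dil ε : Pt N → Pt N) := (dil ε).continuous
  have hmax : ∀ i : ℕ, ∃ p, i ≤ k → |ℓ (dil ε p) - (i + 1)| < 1 / 2 ∧ 0 < u p ∧ IsLocalMax u p := by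
    intro i
    by_cases hi : i ≤ k
    swap
    · exact ⟨0, fun h => absurd h hi⟩
    obtain ⟨⟨q, hq, hqM⟩, hsep⟩ := hridge i hi
    have hcont : Continuous fun p => |ℓ (dil ε p) - (i + 1)| :=
      ((hℓ.comp hdil).sub continuous_const).abs
    have hA : IsCompact ({p | dil ε p ∈ {p | -a ≤ W p}} ∩ {p | |ℓ (dil ε p) - (i + 1)| ≤ 1 / 2}) :=
      (isCompact_dil_preimage hε.ne' h.compact).inter_right (isClosed_le hcont continuous_const)
    have hq0 : dil ε (dil ε⁻¹ q) = q := dil_dil_inv hε.ne' q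
    have hqA : dil ε⁻¹ q ∈
        {p | dil ε p ∈ {p | -a ≤ W p}} ∩ {p | |ℓ (dil ε p) - (i + 1)| ≤ 1 / 2} := by
      simp only [mem_inter_iff, mem_ofPred_eq, hq0, hq, hqM]
      exact ⟨by linarith, by norm_num⟩
    obtain ⟨p, ⟨hpW, hpℓ⟩, hpmax⟩ := hA.exists_isMaxOn ⟨_, hqA⟩ hu.continuousOn
    have hup : M - δ ≤ u p := by
      have h1 := hpmax hqA
      have h2 := (abs_le.1 (huW (dil ε⁻¹ q))).1
      rw [hq0, hqM] at h2
      simp only [mem_ofPred_eq] at h1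
      linarith
    have h3 := (abs_le.1 (huW p)).2
    have hlt : |ℓ (dil ε p) - (i + 1)| < 1 / 2 :=
      lt_of_le_of_ne hpℓ fun h4 => by linarith [hsep _ h4]
    refine ⟨p, fun _ => ⟨hlt, by linarith, ?_⟩⟩
    have hWlt : -a < W (dil ε p) := by linarith
    filter_upwards [hcont.continuousAt.eventually_lt_const hlt,
      (h.contDiff.continuous.comp hdil).continuousAt.eventually_const_lt hWlt] with z hz hzW
    exact hpmax ⟨le_of_lt hzW, hz.le⟩
  choose P hP using hmax
  refine ⟨(Finset.range k).image P, ?_, ?_⟩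
  · rw [Finset.card_image_of_injOn, Finset.card_range]
    intro i hi j hj hij
    have h1 := (hP i (Finset.mem_range.1 hi).le).1
    have h2 := (hP j (Finset.mem_range.1 hj).le).1
    rw [hij] at h1
    have h3 : |(i : ℝ) - j| < 1 := by
      rw [abs_lt] at *
      constructor <;> linarith [h1.1, h1.2, h2.1, h2.2]
    have h4 : |(i : ℤ) - j| < 1 := by exact_mod_cast h3
    have := Int.abs_lt_one_iff.1 h4
    lia
  · intro p hp
    obtain ⟨i, hi, rfl⟩ := Finset.mem_image.1 hp
    exact (hP i (Finset.mem_range.1 hi).le).2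

theorem symmDiff_subset {ε δ : ℝ} (h : IsLandscape f lam k t₀ W a) (hδ : δ < a) {u : Pt N → ℝ}
    (hu : ∀ p, |u p - W (dil ε p)| ≤ δ) {K : Set (Pt N)} (hK : ∀ p ∈ K, |p.2| ≤ t₀ → 0 < u p) :
    K ∩ symmDiff {p : Pt N | p.2 ∈ Ioo (-1 : ℝ) 1} {p | 0 < u p} ⊆
      K ∩ {p | t₀ ≤ |p.2| ∧ |p.2| ≤ 1} := by
  rintro p ⟨hpK, hp⟩
  refine ⟨hpK, ?_⟩
  rcases hp with ⟨h1, h2⟩ | ⟨h1, h2⟩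
  · refine ⟨?_, (abs_lt.2 h1).le⟩
    by_contra! hlt
    exact h2 (hK p hpK hlt.le)
  · have h3 : 1 ≤ |p.2| := not_lt.1 fun h4 => h2 (abs_lt.1 h4)
    have h5 : W (dil ε p) < -a := h.outside _ h3
    simp only [mem_ofPred_eq] at h1
    linarith [(abs_le.1 (hu p)).2]

theorem isBounded_pos {ε δ : ℝ} (h : IsLandscape f lam k t₀ W a) (hε : 0 < ε) (hδ : δ < a)
    {u : Pt N → ℝ} (hu : ∀ p, |u p - W (dil ε p)| ≤ δ) : Bornology.IsBounded {p | 0 < u p} := by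
  refine (isCompact_dil_preimage hε.ne' h.compact).isBounded.subset fun p hp => ?_
  simp only [mem_ofPred_eq] at hp ⊢
  linarith [(abs_le.1 (hu p)).2]

end IsLandscape

end Domain

theorem statement0
    (N : ℕ) (hN : 1 ≤ N)
    (f : ℝ → ℝ) (hf : ContDiff ℝ (⊤ : ℕ∞) f) (hmono : Monotone f)
    (hconv : ConvexOn ℝ Set.univ f) (hf0 : 0 < f 0)
    (lam : ℝ) (hlam : 0 < lam)
    -- there exists a positive stable solution `u₀` of the 1-d problem at parameter `lam`
    (u₀ : ℝ → ℝ) (hu₀C : ContDiffOn ℝ 2 u₀ (Icc (-1) 1))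
    (hu₀eq : ∀ y ∈ Ioo (-1:ℝ) 1, deriv (deriv u₀) y = -(lam * f (u₀ y)))
    (hu₀pos : ∀ y ∈ Ioo (-1:ℝ) 1, 0 < u₀ y)
    (hu₀m1 : u₀ (-1) = 0) (hu₀1 : u₀ 1 = 0)
    (hu₀stable : ∀ ξ : ℝ → ℝ, ContDiff ℝ (⊤ : ℕ∞) ξ → HasCompactSupport ξ →
      tsupport ξ ⊆ Ioo (-1) 1 → ξ ≠ 0 →
      0 < (∫ y in Ioo (-1:ℝ) 1, (deriv ξ y) ^ 2)
          - lam * ∫ y in Ioo (-1:ℝ) 1, deriv f (u₀ y) * (ξ y) ^ 2)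
    (k : ℕ) (K : Set (Pt N)) (hK : IsCompact K) (η : ℝ) (hη : 0 < η) :
    ∃ (Ω : Set (Pt N)) (u : Pt N → ℝ),
      -- Ω bounded open with smooth boundary
      IsOpen Ω ∧ Bornology.IsBounded Ω ∧ SmoothBoundary Ω ∧
      -- (i) star-shaped with respect to the origin and symmetric in each hyperplane
      (∀ p ∈ Ω, ∀ t ∈ Ioc (0:ℝ) 1, t • p ∈ Ω) ∧
      (∀ j : Fin N, ∀ p : Pt N, p ∈ Ω → (Function.update p.1 j (-(p.1 j)), p.2) ∈ Ω) ∧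
      (∀ p : Pt N, p ∈ Ω → (p.1, -p.2) ∈ Ω) ∧
      -- (ii) Ω is close to the strip S = ℝ^N × (−1,1) on the compact K
      volume (K ∩ symmDiff {p : Pt N | p.2 ∈ Ioo (-1:ℝ) 1} Ω) < ENNReal.ofReal η ∧
      -- (iii) u ∈ C²(closure Ω) solves −Δu = λ f(u), u > 0 in Ω, u = 0 on ∂Ω, u stable
      ContDiffOn ℝ 2 u (closure Ω) ∧
      (∀ p ∈ Ω, lap u p = -(lam * f (u p))) ∧
      (∀ p ∈ Ω, 0 < u p) ∧
      (∀ p ∈ frontier Ω, u p = 0) ∧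
      Stable Ω (fun p => lam * deriv f (u p)) ∧
      -- (iv) u has at least k local maximum points in Ω
      (∃ S : Finset (Pt N), k ≤ S.card ∧ ∀ p ∈ S, p ∈ Ω ∧ IsLocalMax u p) := by
  obtain ⟨F, v, M, α, hprofile⟩ :=
    exists_profile hf hmono hconv hf0 hlam hu₀C hu₀eq hu₀pos hu₀m1 hu₀1 hu₀stable
  obtain ⟨t₀, ht₀, ht₁, hlayer⟩ := exists_thin_layer hK hη
  obtain ⟨W, a, hW⟩ := hprofile.exists_landscape hN k ht₀ ht₁
  obtain ⟨δ, hδ, hδa, hmax⟩ := hW.exists_localMax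
  obtain ⟨ε, hε, u, hu, huW, htrans, hKpos, hsymm, hsymm', hlap, hstable⟩ :=
    hW.exists_solution hf hmono hconv hlam hK hδ
  exact ⟨{p | 0 < u p}, u, isOpen_lt continuous_const hu.continuous, hW.isBounded_pos hε hδa huW,
    smoothBoundary_of_transversal hu htrans,
    fun _ hp _ ht => starShaped_of_transversal hu htrans hp ht,
    fun j p hp => hp.trans_eq (hsymm j p).symm, fun p hp => hp.trans_eq (hsymm' p).symm,
    (measure_mono (hW.symmDiff_subset hδa huW hKpos)).trans_lt hlayer,
    (hu.of_le (WithTop.coe_le_coe.2 le_top)).contDiffOn, hlap, fun _ hp => hp,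
    fun _ hp => eq_zero_of_mem_frontier hu.continuous hp, hstable,
    hmax ε hε u hu.continuous huW⟩
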